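/- arXiv:0912.1124 — 2 statements merged into one kernel-verified Lean document; each statement's English description precedes it below -/
import Mathlib

section
/- Let p: B → G be a Fell bundle over a locally compact Hausdorff groupoid G, A := Γ₀(G⁰; B), and let I be a G-invariant ideal of A. Then for every x ∈ G, the Rieffel correspondence on ideals satisfies h_x(I(s(x))) = I(r(x)); in particular, B(x)·I(s(x)) = I(r(x))·B(x) (closed linear spans of products in B). -/
noncomputable section

open Filter
open scoped Topology

/-- A locally compact Hausdorff groupoid, encoded "flatly": the partially defined
multiplication `gmul` is a total function whose value is only meaningful (and only
constrained by the axioms) on composable pairs, i.e. pairs `(x, y)` with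
`src x = rng y`. -/
structure LCGroupoid where
  /-- the underlying space of the groupoid -/
  G : Type
  [topG : TopologicalSpace G]
  t2G : T2Space G
  lcG : LocallyCompactSpace G
  /-- the source map (with values in the unit space) -/
  src : G → G
  /-- the range map (with values in the unit space) -/
  rng : G → G
  /-- the partial multiplication (junk value unless `src x = rng y`) -/
  gmul : G → G → G
  /-- inversion -/
  ginv : G → G
  src_rng : ∀ x, src (rng x) = rng x
  rng_rng : ∀ x, rng (rng x) = rng x
  src_src : ∀ x, src (src x) = src x
  rng_src : ∀ x, rng (src x) = src x
  rng_gmul : ∀ x y, src x = rng y → rng (gmul x y) = rng x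
  src_gmul : ∀ x y, src x = rng y → src (gmul x y) = src y
  gmul_assoc : ∀ x y z, src x = rng y → src y = rng z →
    gmul (gmul x y) z = gmul x (gmul y z)
  gmul_rng : ∀ x, gmul (rng x) x = x
  gmul_src : ∀ x, gmul x (src x) = x
  src_ginv : ∀ x, src (ginv x) = rng x
  rng_ginv : ∀ x, rng (ginv x) = src x
  ginv_ginv : ∀ x, ginv (ginv x) = x
  gmul_ginv : ∀ x, gmul x (ginv x) = rng x
  ginv_gmul : ∀ x, gmul (ginv x) x = src x
  ginv_gmul_eq : ∀ x y, src x = rng y → ginv (gmul x y) = gmul (ginv y) (ginv x)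
  ginv_unit : ∀ u, rng u = u → ginv u = u
  cont_ginv : Continuous ginv
  cont_gmul : Continuous (fun q : {q : G × G // src q.1 = rng q.2} => gmul q.1.1 q.1.2)

attribute [instance] LCGroupoid.topG

/-- The unit space `G⁰` of the groupoid, i.e. the set of units, with its subspace
topology. -/
def LCGroupoid.UnitSpace (Γ : LCGroupoid) : Type := {u : Γ.G // Γ.rng u = u}

instance (Γ : LCGroupoid) : TopologicalSpace Γ.UnitSpace :=
  instTopologicalSpaceSubtype

/-- The data and most axioms of a Fell bundle `p : B → G` over a locally compact
Hausdorff groupoid, again encoded "flatly": the total space is `T`, the fibre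
`B(x)` is `{b : T | p b = x}`, the fibrewise algebraic operations are total
functions which are constrained by the axioms only on the appropriate domains
(e.g. `badd` on pairs in a common fibre, `bmul` on pairs whose base points are
composable).  The axioms say: each fibre is a complex Banach space (whose
topology is the subspace topology); the norm is upper semicontinuous and the
bundle operations are continuous; `bmul`/`bstar` are a continuous bilinear
associative multiplication and involution covering the groupoid operations;
each unit fibre `B(u)` is a C*-algebra (C*-identity, submultiplicativity,
positivity of `b* b`). Saturation is added in `FellBundle` below. -/
structure FellBundleData extends LCGroupoid where
  /-- the total space of the bundle -/
  T : Type
  [topT : TopologicalSpace T]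
  /-- the bundle projection -/
  p : T → G
  /-- the fibrewise norm -/
  bnorm : T → ℝ
  /-- fibrewise addition (junk unless both arguments lie in a common fibre) -/
  badd : T → T → T
  /-- fibrewise scalar multiplication -/
  bsmul : ℂ → T → T
  /-- the zero section -/
  bzero : G → T
  /-- the Fell bundle multiplication (junk unless `src (p a) = rng (p b)`) -/
  bmul : T → T → T
  /-- the Fell bundle involution -/
  bstar : T → T
  p_cont : Continuous p
  p_open : IsOpenMap p
  p_badd : ∀ a b, p a = p b → p (badd a b) = p a
  p_bsmul : ∀ c a, p (bsmul c a) = p a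
  p_bzero : ∀ x, p (bzero x) = x
  p_bmul : ∀ a b, src (p a) = rng (p b) → p (bmul a b) = gmul (p a) (p b)
  p_bstar : ∀ a, p (bstar a) = ginv (p a)
  badd_comm : ∀ a b, p a = p b → badd a b = badd b a
  badd_assoc : ∀ a b c, p a = p b → p b = p c → badd (badd a b) c = badd a (badd b c)
  bzero_badd : ∀ a, badd (bzero (p a)) a = a
  badd_neg : ∀ a, badd a (bsmul (-1) a) = bzero (p a)
  one_bsmul : ∀ a, bsmul 1 a = a
  mul_bsmul : ∀ c d a, bsmul (c * d) a = bsmul c (bsmul d a)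
  add_bsmul : ∀ c d a, bsmul (c + d) a = badd (bsmul c a) (bsmul d a)
  bsmul_badd : ∀ c a b, p a = p b → bsmul c (badd a b) = badd (bsmul c a) (bsmul c b)
  zero_bsmul : ∀ a, bsmul 0 a = bzero (p a)
  bsmul_bzero : ∀ c x, bsmul c (bzero x) = bzero x
  bnorm_nonneg : ∀ a, 0 ≤ bnorm a
  bnorm_badd_le : ∀ a b, p a = p b → bnorm (badd a b) ≤ bnorm a + bnorm b
  bnorm_bsmul : ∀ c a, bnorm (bsmul c a) = ‖c‖ * bnorm a
  bnorm_eq_zero : ∀ a, bnorm a = 0 ↔ a = bzero (p a)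
  /-- each fibre is complete -/
  fiber_complete : ∀ x (f : ℕ → T), (∀ n, p (f n) = x) →
    (∀ ε : ℝ, 0 < ε → ∃ N, ∀ m n, N ≤ m → N ≤ n →
      bnorm (badd (f m) (bsmul (-1) (f n))) < ε) →
    ∃ L, p L = x ∧
      Tendsto (fun n => bnorm (badd (f n) (bsmul (-1) L))) atTop (nhds 0)
  cont_badd : Continuous (fun q : {q : T × T // p q.1 = p q.2} => badd q.1.1 q.1.2)
  cont_bsmul : Continuous (fun q : ℂ × T => bsmul q.1 q.2)
  cont_bzero : Continuous bzero
  usc_bnorm : UpperSemicontinuous bnorm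
  /-- on each fibre, the subspace topology is finer than the norm topology -/
  fiber_nbhd_norm : ∀ b, ∀ ε : ℝ, 0 < ε →
    ∃ U ∈ nhds b, ∀ c ∈ U, p c = p b → bnorm (badd c (bsmul (-1) b)) < ε
  /-- on each fibre, the norm topology is finer than the subspace topology -/
  norm_nbhd_fiber : ∀ b, ∀ U ∈ nhds b, ∃ ε : ℝ, 0 < ε ∧
    ∀ c, p c = p b → bnorm (badd c (bsmul (-1) b)) < ε → c ∈ U
  /-- if `‖b_i‖ → 0` and `p (b_i) → x` then `b_i → 0_x` -/
  zero_nbhd : ∀ x, ∀ U ∈ nhds (bzero x), ∃ V ∈ nhds x, ∃ ε : ℝ, 0 < ε ∧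
    ∀ b, p b ∈ V → bnorm b < ε → b ∈ U
  bmul_assoc : ∀ a b c, src (p a) = rng (p b) → src (p b) = rng (p c) →
    bmul (bmul a b) c = bmul a (bmul b c)
  bmul_badd : ∀ a a' b, p a = p a' → src (p a) = rng (p b) →
    bmul (badd a a') b = badd (bmul a b) (bmul a' b)
  badd_bmul : ∀ a b b', p b = p b' → src (p a) = rng (p b) →
    bmul a (badd b b') = badd (bmul a b) (bmul a b')
  bsmul_bmul : ∀ (c : ℂ) a b, src (p a) = rng (p b) →
    bmul (bsmul c a) b = bsmul c (bmul a b)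
  bmul_bsmul : ∀ (c : ℂ) a b, src (p a) = rng (p b) →
    bmul a (bsmul c b) = bsmul c (bmul a b)
  cont_bmul :
    Continuous (fun q : {q : T × T // src (p q.1) = rng (p q.2)} => bmul q.1.1 q.1.2)
  bstar_bstar : ∀ a, bstar (bstar a) = a
  bstar_badd : ∀ a b, p a = p b → bstar (badd a b) = badd (bstar a) (bstar b)
  bstar_bsmul : ∀ c a, bstar (bsmul c a) = bsmul (starRingEnd ℂ c) (bstar a)
  bstar_bmul : ∀ a b, src (p a) = rng (p b) →
    bstar (bmul a b) = bmul (bstar b) (bstar a)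
  cont_bstar : Continuous bstar
  /-- the C*-identity `‖b* b‖ = ‖b‖ ^ 2` (this holds in every fibre since `B(x)` is
  an imprimitivity bimodule with inner products `⟨a, b⟩ = a* b` and `a b*`) -/
  cstar_identity : ∀ a, bnorm (bmul (bstar a) a) = bnorm a ^ 2
  /-- the norm on each unit fibre (a C*-algebra) is submultiplicative -/
  unit_submul : ∀ a b, p a = p b → rng (p a) = p a →
    bnorm (bmul a b) ≤ bnorm a * bnorm b
  /-- `b* b ≥ 0` in the C*-algebra `B(s(b))`: positivity in a C*-algebra is
  encoded as being of the form `c* c` -/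
  bmul_pos : ∀ a, ∃ c, p c = src (p a) ∧ bmul (bstar a) a = bmul (bstar c) c

attribute [instance] FellBundleData.topT

namespace FellBundleData

variable (Ω : FellBundleData)

/-- The fibre `B(x)` of the bundle over `x`, as a subset of the total space. -/
def fiberSet (x : Ω.G) : Set Ω.T := {b | Ω.p b = x}

/-- Finite sums of elements of `S`, computed in the fibre over `x`. -/
def finSums (x : Ω.G) (S : Set Ω.T) : Set Ω.T :=
  {t | ∃ l : List Ω.T, (∀ a ∈ l, a ∈ S) ∧ t = l.foldr Ω.badd (Ω.bzero x)}

/-- The linear span of `S` inside the fibre over `x`. -/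
def spanIn (x : Ω.G) (S : Set Ω.T) : Set Ω.T :=
  Ω.finSums x {t | ∃ c s, s ∈ S ∧ t = Ω.bsmul c s}

/-- The closed linear span of `S` inside the fibre over `x`. -/
def closedSpan (x : Ω.G) (S : Set Ω.T) : Set Ω.T := closure (Ω.spanIn x S)

end FellBundleData

/-- A (saturated) Fell bundle over a locally compact Hausdorff groupoid. -/
structure FellBundle extends FellBundleData where
  /-- saturation: `B(x) B(y)` spans a dense subspace of `B(xy)` -/
  saturated : ∀ x y, src x = rng y →
    toFellBundleData.closedSpan (gmul x y)
        {t | ∃ a b, p a = x ∧ p b = y ∧ t = bmul a b} =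
      toFellBundleData.fiberSet (gmul x y)

namespace FellBundleData

variable (Ω : FellBundleData)

/-- `Ω.IsA σ` says that `σ` is an element of the C*-algebra `A = Γ₀(G⁰; B)` of the
Fell bundle sitting over the unit space: a continuous section over `G⁰` vanishing
at infinity. -/
def IsA (σ : Ω.toLCGroupoid.UnitSpace → Ω.T) : Prop :=
  (∀ u, Ω.p (σ u) = u.1) ∧ Continuous σ ∧
    ∀ ε : ℝ, 0 < ε →
      ∃ K : Set Ω.toLCGroupoid.UnitSpace, IsCompact K ∧ ∀ u ∉ K, Ω.bnorm (σ u) < ε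

/-- `Ω.IsIdealA J` says that `J` is a (closed, two-sided) ideal in the C*-algebra
`A = Γ₀(G⁰; B)`. -/
def IsIdealA (J : Set (Ω.toLCGroupoid.UnitSpace → Ω.T)) : Prop :=
  (∀ σ ∈ J, Ω.IsA σ) ∧
  ((fun u => Ω.bzero u.1) ∈ J) ∧
  (∀ σ ∈ J, ∀ τ ∈ J, (fun u => Ω.badd (σ u) (τ u)) ∈ J) ∧
  (∀ c : ℂ, ∀ σ ∈ J, (fun u => Ω.bsmul c (σ u)) ∈ J) ∧
  (∀ σ ∈ J, ∀ τ, Ω.IsA τ →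
    (fun u => Ω.bmul (σ u) (τ u)) ∈ J ∧ (fun u => Ω.bmul (τ u) (σ u)) ∈ J) ∧
  (∀ σ, Ω.IsA σ →
    (∀ ε : ℝ, 0 < ε → ∃ τ ∈ J, ∀ u, Ω.bnorm (Ω.badd (σ u) (Ω.bsmul (-1) (τ u))) < ε) →
    σ ∈ J)

/-- The image `q_u(J) = J(u) ⊆ B(u) = A(u)` of a subset `J ⊆ A` in the fibre over
the unit `u`. -/
def fiberIm (J : Set (Ω.toLCGroupoid.UnitSpace → Ω.T)) (u : Ω.G) : Set Ω.T :=
  {t | ∃ σ ∈ J, ∃ h : Ω.rng u = u, t = σ ⟨u, h⟩}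

/-- A representation of the C*-algebra `B(u)` (`u` a unit) on a Hilbert space `H`:
a `*`-homomorphism `π` on the fibre over `u`, automatically norm-decreasing. -/
def IsFiberRep (u : Ω.G) {H : Type} [NormedAddCommGroup H] [InnerProductSpace ℂ H]
    [CompleteSpace H] (π : Ω.T → H →L[ℂ] H) : Prop :=
  (∀ a b, Ω.p a = u → Ω.p b = u → π (Ω.badd a b) = π a + π b) ∧
  (∀ (c : ℂ) a, Ω.p a = u → π (Ω.bsmul c a) = c • π a) ∧
  (∀ a b, Ω.p a = u → Ω.p b = u → π (Ω.bmul a b) = (π a).comp (π b)) ∧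
  (∀ a, Ω.p a = u → π (Ω.bstar a) = ContinuousLinearMap.adjoint (π a)) ∧
  (∀ a, Ω.p a = u → ‖π a‖ ≤ Ω.bnorm a)

/-- An irreducible representation of the C*-algebra `B(u)`: nonzero, and with no
nontrivial closed invariant subspace. -/
def IsIrredFiberRep (u : Ω.G) {H : Type} [NormedAddCommGroup H]
    [InnerProductSpace ℂ H] [CompleteSpace H] (π : Ω.T → H →L[ℂ] H) : Prop :=
  Ω.IsFiberRep u π ∧ (∃ a, Ω.p a = u ∧ π a ≠ 0) ∧
  (∀ K : Submodule ℂ H, IsClosed (K : Set H) →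
    (∀ a, Ω.p a = u → ∀ v ∈ K, π a v ∈ K) → K = ⊥ ∨ K = ⊤)

/-- The primitive ideal space `Prim A(u)` of the C*-algebra `A(u) = B(u)` over a
unit `u`: the set of kernels of irreducible representations of `B(u)`, viewed as
subsets of the fibre over `u`. -/
def PrimFiber (u : Ω.G) : Set (Set Ω.T) :=
  {P | Ω.rng u = u ∧
    ∃ (H : Type) (iN : NormedAddCommGroup H) (iP : InnerProductSpace ℂ H)
      (iC : CompleteSpace H) (π : Ω.T → H →L[ℂ] H),
      Ω.IsIrredFiberRep u π ∧ P = {a | Ω.p a = u ∧ π a = 0}}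

/-- The Rieffel correspondence `h_x` on ideals, induced by the
`A(r(x)) – A(s(x))`-imprimitivity bimodule `B(x)`: an ideal `J ⊆ A(s(x))` is sent
to the induced ideal `⟨B(x)·J, B(x)⟩_{A(r(x))} = span{(a d) b* : a, b ∈ B(x), d ∈ J}`
(closed span) in `A(r(x))`. -/
def hIdeal (x : Ω.G) (J : Set Ω.T) : Set Ω.T :=
  Ω.closedSpan (Ω.rng x)
    {t | ∃ a b d, Ω.p a = x ∧ Ω.p b = x ∧ d ∈ J ∧ t = Ω.bmul (Ω.bmul a d) (Ω.bstar b)}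

/-- `I ⊆ A` is a `G`-invariant ideal: it is an ideal, and its hull
`{(u, P) : I(u) ⊆ P} ⊆ Prim A` is invariant under the `G`-action
`x · (s(x), P) = (r(x), h_x(P))`. -/
def GInvariant (I : Set (Ω.toLCGroupoid.UnitSpace → Ω.T)) : Prop :=
  Ω.IsIdealA I ∧
  ∀ x (P : Set Ω.T), P ∈ Ω.PrimFiber (Ω.src x) →
    Ω.fiberIm I (Ω.src x) ⊆ P → Ω.fiberIm I (Ω.rng x) ⊆ Ω.hIdeal x P

/-- The subset `B_I = {b ∈ B : b* b ∈ I(s(b))}` of the total space associated to an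
ideal `I ⊆ A`. -/
def BIset (I : Set (Ω.toLCGroupoid.UnitSpace → Ω.T)) : Set Ω.T :=
  {b | Ω.bmul (Ω.bstar b) b ∈ Ω.fiberIm I (Ω.src (Ω.p b))}

end FellBundleData

section PureStates

open scoped ComplexOrder InnerProductSpace

variable {A : Type} [CStarAlgebra A]

/-- A self-adjoint `e` in the left ideal generated by a self-adjoint `j`, with `‖1 - e‖ ≤ 1`, such
that the compression of `j` by `1 - e` is small. -/
lemma exists_compression_norm_lt (j : A) (hj : IsSelfAdjoint j) {ε : ℝ} (hε : 0 < ε) :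
    ∃ k : A, IsSelfAdjoint (k * j) ∧ ‖1 - k * j‖ ≤ 1 ∧
      ‖(1 - k * j) * j * (1 - k * j)‖ ≤ ε := by
  have hpos : ∀ t : ℝ, 0 < t ^ 2 + ε ^ 2 := fun t => by positivity
  have hne : ∀ t : ℝ, t ^ 2 + ε ^ 2 ≠ 0 := fun t => (hpos t).ne'
  have c1 : Continuous fun t : ℝ => t / (t ^ 2 + ε ^ 2) := by fun_prop (disch := exact hne _)
  have c2 : Continuous fun t : ℝ => ε ^ 2 / (t ^ 2 + ε ^ 2) := by fun_prop (disch := exact hne _)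
  set k : A := cfc (fun t : ℝ => t / (t ^ 2 + ε ^ 2)) j with hk
  have hkj : k * j = cfc (fun t : ℝ => t / (t ^ 2 + ε ^ 2) * t) j := by
    rw [cfc_mul (fun t : ℝ => t / (t ^ 2 + ε ^ 2)) (fun t => t) j c1.continuousOn
      continuous_id.continuousOn, cfc_id' ℝ j]
  have h1 : 1 - k * j = cfc (fun t : ℝ => ε ^ 2 / (t ^ 2 + ε ^ 2)) j := by
    rw [hkj, ← cfc_one ℝ j, ← cfc_sub (1 : ℝ → ℝ) (fun t => t / (t ^ 2 + ε ^ 2) * t) j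
      continuousOn_const (c1.mul continuous_id).continuousOn]
    congr 1
    ext t
    have := hne t
    simp only [Pi.one_apply]
    field_simp
    ring
  refine ⟨k, ?_, ?_, ?_⟩
  · rw [hkj]; exact cfc_predicate _ _
  · rw [h1]
    refine norm_cfc_le zero_le_one fun t _ => ?_
    rw [Real.norm_of_nonneg (by positivity), div_le_one (hpos t)]
    nlinarith [sq_nonneg t]
  · have h2 : (1 - k * j) * j * (1 - k * j) =
        cfc (fun t : ℝ => ε ^ 2 / (t ^ 2 + ε ^ 2) * t * (ε ^ 2 / (t ^ 2 + ε ^ 2))) j := by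
      rw [cfc_mul (fun t : ℝ => ε ^ 2 / (t ^ 2 + ε ^ 2) * t) (fun t => ε ^ 2 / (t ^ 2 + ε ^ 2)) j
        (c2.mul continuous_id).continuousOn c2.continuousOn,
        cfc_mul (fun t : ℝ => ε ^ 2 / (t ^ 2 + ε ^ 2)) (fun t => t) j c2.continuousOn
          continuous_id.continuousOn, cfc_id' ℝ j, h1]
    rw [h2]
    refine norm_cfc_le hε.le fun t _ => ?_
    have hq : ε ^ 2 / (t ^ 2 + ε ^ 2) ≤ 1 := by
      rw [div_le_one (hpos t)]; nlinarith [sq_nonneg t]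
    have hq0 : 0 ≤ ε ^ 2 / (t ^ 2 + ε ^ 2) := by positivity
    have hm : ε ^ 2 / (t ^ 2 + ε ^ 2) * |t| ≤ ε := by
      rw [div_mul_eq_mul_div, div_le_iff₀ (hpos t)]
      nlinarith [sq_nonneg (|t| - ε), sq_abs t, abs_nonneg t, mul_nonneg hε.le (abs_nonneg t)]
    rw [Real.norm_eq_abs, abs_mul, abs_mul, abs_of_nonneg hq0]
    calc _ ≤ ε * 1 := mul_le_mul hm hq hq0 hε.le
      _ = ε := mul_one ε

variable [PartialOrder A]

/-- The states of `A` that vanish on `J`, as a subset of the space of all functions `A → ℂ`. -/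
def statesVanishing (J : Submodule ℂ A) : Set (A → ℂ) :=
  {φ | (∀ a b, φ (a + b) = φ a + φ b) ∧ (∀ (c : ℂ) a, φ (c • a) = c * φ a) ∧
    (∀ a, 0 ≤ a → 0 ≤ φ a) ∧ φ 1 = 1 ∧ (∀ j ∈ J, φ j = 0) ∧ ∀ a, ‖φ a‖ ≤ ‖a‖}

lemma isCompact_statesVanishing (J : Submodule ℂ A) : IsCompact (statesVanishing J) := by
  have h1 : IsCompact (Set.univ.pi fun a : A => Metric.closedBall (0 : ℂ) ‖a‖) :=
    isCompact_univ_pi fun a => isCompact_closedBall _ _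
  refine h1.of_isClosed_subset ?_ ?_
  · simp only [statesVanishing, Set.ofPred_and, Set.ofPred_forall]
    refine .inter (isClosed_iInter fun a => isClosed_iInter fun b => ?_)
      (.inter (isClosed_iInter fun c => isClosed_iInter fun a => ?_)
      (.inter (isClosed_iInter fun a => isClosed_iInter fun ha => ?_) (.inter ?_
      (.inter (isClosed_iInter fun j => isClosed_iInter fun hj => ?_)
      (isClosed_iInter fun a => ?_)))))
    · exact isClosed_eq (by fun_prop) (by fun_prop)
    · exact isClosed_eq (by fun_prop) (by fun_prop)
    · exact isClosed_le (by fun_prop) (by fun_prop)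
    · exact isClosed_eq (by fun_prop) (by fun_prop)
    · exact isClosed_eq (by fun_prop) (by fun_prop)
    · exact isClosed_le (by fun_prop) (by fun_prop)
  · intro φ hφ a _
    simpa using hφ.2.2.2.2.2 a

variable [StarOrderedRing A]

/-- If `a* a` is dominated, up to arbitrarily small errors, by elements of a closed ideal, then
`a` lies in that ideal. -/
lemma mem_of_star_mul_self_le (J : Submodule ℂ A) (hJ : IsClosed (J : Set A))
    (hl : ∀ a, ∀ j ∈ J, a * j ∈ J) (a : A)
    (h : ∀ ε : ℝ, 0 < ε → ∃ j ∈ J, IsSelfAdjoint j ∧ star a * a ≤ algebraMap ℝ A ε + j) :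
    a ∈ J := by
  rw [← SetLike.mem_coe, ← hJ.closure_eq, Metric.mem_closure_iff]
  intro δ hδ
  obtain ⟨j, hjJ, hj, hle⟩ := h (δ ^ 2 / 4) (by positivity)
  obtain ⟨k, hks, hk1, hk2⟩ := exists_compression_norm_lt j hj (ε := δ ^ 2 / 4) (by positivity)
  refine ⟨a * (k * j), hl _ _ (hl _ _ hjJ), ?_⟩
  set e := k * j with he
  have hs : star (1 - e) = 1 - e := by simp [hks.star_eq]
  have h1 : star (a * (1 - e)) * (a * (1 - e)) ≤
      (1 - e) * (algebraMap ℝ A (δ ^ 2 / 4) + j) * (1 - e) := by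
    have := star_left_conjugate_le_conjugate hle (1 - e)
    rw [hs] at this
    rw [star_mul, hs]
    simpa only [mul_assoc] using this
  have h2 := CStarAlgebra.norm_le_norm_of_nonneg_of_le (star_mul_self_nonneg _) h1
  rw [CStarRing.norm_star_mul_self] at h2
  have h3 : ‖(1 - e) * (algebraMap ℝ A (δ ^ 2 / 4) + j) * (1 - e)‖ ≤ δ ^ 2 / 4 + δ ^ 2 / 4 := by
    rw [mul_add, add_mul]
    refine (norm_add_le _ _).trans (add_le_add ?_ hk2)
    rw [Algebra.algebraMap_eq_smul_one, mul_smul_comm, mul_one, smul_mul_assoc, norm_smul,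
      Real.norm_of_nonneg (by positivity)]
    have : ‖(1 - e) * (1 - e)‖ ≤ 1 :=
      (norm_mul_le _ _).trans (mul_le_one₀ hk1 (norm_nonneg _) hk1)
    nlinarith [sq_nonneg δ]
  have h4 : a - a * e = a * (1 - e) := by rw [mul_sub, mul_one]
  rw [dist_eq_norm, h4]
  nlinarith [norm_nonneg (a * (1 - e)), sq_nonneg δ]

/-- A positive functional is bounded by its value at the unit. -/
lemma PositiveLinearMap.norm_apply_le_mul_re_one (f : A →ₚ[ℂ] ℂ) (a : A) :
    ‖f a‖ ≤ ‖a‖ * (f 1).re := by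
  have h1 : f a = ⟪f.toPreGNS 1, f.leftMulMapPreGNS a (f.toPreGNS 1)⟫_ℂ := by
    simp [PositiveLinearMap.preGNS_inner_def]
  have h2 : ‖f.toPreGNS 1‖ ^ 2 = (f 1).re := by
    have := congrArg Complex.re (f.preGNS_norm_sq (f.toPreGNS 1))
    simpa [← Complex.ofReal_pow] using this
  have h3 : ‖f.leftMulMapPreGNS a‖ ≤ ‖a‖ := LinearMap.mkContinuous_norm_le _ (norm_nonneg _) _
  rw [h1]
  calc _ ≤ ‖f.toPreGNS 1‖ * ‖f.leftMulMapPreGNS a (f.toPreGNS 1)‖ := norm_inner_le_norm _ _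
    _ ≤ ‖f.toPreGNS 1‖ * (‖a‖ * ‖f.toPreGNS 1‖) := by
      gcongr
      exact (ContinuousLinearMap.le_opNorm _ _).trans (by gcongr)
    _ = ‖a‖ * (f 1).re := by rw [← h2]; ring

/-- Hahn–Banach: a positive functional vanishing on a closed ideal and nonzero at `a* a`. -/
lemma exists_positive_functional (J : Submodule ℂ A) (hJ : IsClosed (J : Set A))
    (hl : ∀ a, ∀ j ∈ J, a * j ∈ J) (hst : ∀ j ∈ J, star j ∈ J) (a : A) (ha : a ∉ J) :
    ∃ f : A →ₚ[ℂ] ℂ, (∀ j ∈ J, f j = 0) ∧ 0 < (f (star a * a)).re := by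
  let C : Set A := {y | ∃ p j h : A, 0 ≤ p ∧ j ∈ J ∧ IsSelfAdjoint h ∧ y = p + j + Complex.I • h}
  have hCadd : ∀ y ∈ C, ∀ z ∈ C, y + z ∈ C := by
    rintro _ ⟨p, j, h, hp, hj, hh, rfl⟩ _ ⟨p', j', h', hp', hj', hh', rfl⟩
    exact ⟨p + p', j + j', h + h', add_nonneg hp hp', J.add_mem hj hj', hh.add hh', by
      rw [smul_add]; abel⟩
  have hCsmul : ∀ t : ℝ, 0 ≤ t → ∀ y ∈ C, t • y ∈ C := by
    rintro t ht _ ⟨p, j, h, hp, hj, hh, rfl⟩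
    refine ⟨t • p, t • j, t • h, smul_nonneg ht hp, ?_, IsSelfAdjoint.smul (.all _) hh, ?_⟩
    · exact (Complex.coe_smul t j) ▸ J.smul_mem _ hj
    · rw [smul_add, smul_add, smul_comm]
  have hconv : Convex ℝ C := by
    intro y hy z hz s t hs ht _
    exact hCadd _ (hCsmul s hs y hy) _ (hCsmul t ht z hz)
  have hnot : -(star a * a) ∉ closure C := by
    intro hmem
    refine ha (mem_of_star_mul_self_le J hJ hl a fun ε hε => ?_)
    obtain ⟨_, ⟨p, j, h, hp, hj, hh, rfl⟩, hd⟩ := Metric.mem_closure_iff.1 hmem ε hε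
    set w : A := star a * a + p + j + Complex.I • h with hw
    have hwn : ‖w‖ < ε := by
      rw [dist_eq_norm, ← norm_neg] at hd
      have h1 : w = -(-(star a * a) - (p + j + Complex.I • h)) := by rw [hw]; abel
      rwa [h1]
    have hsw : star w = star a * a + p + star j - Complex.I • h := by
      simp [hw, hh.star_eq, (IsSelfAdjoint.of_nonneg hp).star_eq, sub_eq_add_neg]
    set r : A := (2⁻¹ : ℝ) • (w + star w) with hr
    set j' : A := (2⁻¹ : ℝ) • (j + star j) with hj'
    have hre : r = star a * a + p + j' := by
      rw [hr, hj', hsw, hw]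
      module
    have hrs : IsSelfAdjoint r :=
      IsSelfAdjoint.smul (.all _) (IsSelfAdjoint.add_star_self w)
    have hrn : ‖r‖ ≤ ε := by
      rw [hr, norm_smul]
      have := norm_add_le w (star w)
      rw [norm_star] at this
      norm_num
      linarith
    have hj's : IsSelfAdjoint j' :=
      IsSelfAdjoint.smul (.all _) (IsSelfAdjoint.add_star_self j)
    have hj'J : j' ∈ J := by
      rw [hj', ← Complex.coe_smul]
      exact J.smul_mem _ (J.add_mem hj (hst _ hj))
    refine ⟨-j', J.neg_mem hj'J, hj's.neg, ?_⟩
    have h1 : r ≤ algebraMap ℝ A ε :=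
      hrs.le_algebraMap_norm_self.trans (algebraMap_mono A hrn)
    calc star a * a ≤ star a * a + p := le_add_of_nonneg_right hp
      _ = r + -j' := by rw [hre]; abel
      _ ≤ _ := by gcongr
  obtain ⟨f, s, hs1, hs2⟩ := RCLike.geometric_hahn_banach_point_closed (𝕜 := ℂ)
    hconv.closure isClosed_closure hnot
  have hs2' : ∀ y ∈ C, s < (f y).re := fun y hy => hs2 y (subset_closure hy)
  have h0C : (0 : A) ∈ C := ⟨0, 0, 0, le_rfl, J.zero_mem, .zero _, by simp⟩
  have hs0 : s < 0 := by simpa using hs2' 0 h0C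
  have hnn : ∀ y ∈ C, 0 ≤ (f y).re := by
    intro y hy
    by_contra! hneg
    have := hs2' _ (hCsmul (s / (f y).re) (div_nonneg_of_nonpos hs0.le hneg.le) y hy)
    rw [← Complex.coe_smul, map_smul, smul_eq_mul, Complex.re_ofReal_mul,
      div_mul_cancel₀ _ hneg.ne] at this
    exact lt_irrefl _ this
  have hJC : ∀ j ∈ J, j ∈ C := fun j hj => ⟨0, j, 0, le_rfl, hj, .zero _, by simp⟩
  have hJre : ∀ j ∈ J, (f j).re = 0 := fun j hj => by
    have h1 := hnn _ (hJC j hj)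
    have h2 := hnn _ (hJC _ (J.neg_mem hj))
    simp only [map_neg, Complex.neg_re] at h2
    linarith
  have hJ0 : ∀ j ∈ J, f j = 0 := fun j hj => by
    apply Complex.ext (hJre j hj)
    have := hJre _ (J.smul_mem Complex.I hj)
    simpa using this
  have hsa : ∀ h : A, IsSelfAdjoint h → (f h).im = 0 := fun h hh => by
    have h1 := hnn _ (⟨0, 0, h, le_rfl, J.zero_mem, hh, by simp⟩ : Complex.I • h ∈ C)
    have h2 := hnn _ (⟨0, 0, -h, le_rfl, J.zero_mem, hh.neg, by simp⟩ : -(Complex.I • h) ∈ C)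
    simp only [map_neg, map_smul, smul_eq_mul, Complex.neg_re, Complex.I_mul_re] at h1 h2
    linarith
  refine ⟨PositiveLinearMap.mk₀ f.toLinearMap fun p hp => ?_, hJ0, ?_⟩
  · rw [Complex.nonneg_iff]
    exact ⟨hnn p ⟨p, 0, 0, hp, J.zero_mem, .zero _, by simp⟩,
      (hsa p (IsSelfAdjoint.of_nonneg hp)).symm⟩
  · have h1 : (f (-(star a * a))).re < s := hs1
    rw [map_neg, Complex.neg_re] at h1
    change 0 < (f (star a * a)).re
    linarith

/-- A pure state vanishing on a closed ideal and not vanishing at `a* a`. -/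
lemma exists_extreme_state (J : Submodule ℂ A) (hJ : IsClosed (J : Set A))
    (hl : ∀ a, ∀ j ∈ J, a * j ∈ J) (hst : ∀ j ∈ J, star j ∈ J) (a : A) (ha : a ∉ J) :
    ∃ φ ∈ (statesVanishing J).extremePoints ℝ, 0 < (φ (star a * a)).re := by
  obtain ⟨f, hf0, hfa⟩ := exists_positive_functional J hJ hl hst a ha
  have hf1 : 0 < (f 1).re := by
    have h1 := f.norm_apply_le_mul_re_one (star a * a)
    have h2 := (Complex.re_le_norm (f (star a * a))).trans h1
    by_contra! h3
    nlinarith [norm_nonneg (star a * a)]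
  have hf1' : f 1 = ((f 1).re : ℂ) :=
    Complex.ext rfl (by simpa using (Complex.nonneg_iff.1 (f.map_nonneg (zero_le_one' A))).2.symm)
  have hψ : (fun b => ((f 1).re : ℂ)⁻¹ * f b) ∈ statesVanishing J := by
    refine ⟨fun b c => by simp [mul_add], fun c b => by simp; ring, fun b hb => ?_, ?_,
      fun j hj => by simp [hf0 j hj], fun b => ?_⟩
    · refine mul_nonneg ?_ (f.map_nonneg hb)
      rw [← Complex.ofReal_inv]
      exact Complex.zero_le_real.2 (by positivity)
    · have : ((f 1).re : ℂ) ≠ 0 := by exact_mod_cast hf1.ne'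
      rw [← hf1'] at this ⊢
      exact inv_mul_cancel₀ this
    · rw [norm_mul, norm_inv, Complex.norm_real, Real.norm_of_nonneg hf1.le, inv_mul_le_iff₀ hf1,
        mul_comm]
      exact f.norm_apply_le_mul_re_one b
  let l : (A → ℂ) →L[ℝ] ℝ :=
    Complex.reCLM.comp (ContinuousLinearMap.proj (R := ℝ) (φ := fun _ : A => ℂ) (star a * a))
  have hl' : ∀ φ, l φ = (φ (star a * a)).re := fun φ => rfl
  obtain ⟨φ₀, hφ₀, hmax⟩ := (isCompact_statesVanishing J).exists_isMaxOn ⟨_, hψ⟩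
    l.continuous.continuousOn
  set F : Set (A → ℂ) := {φ ∈ statesVanishing J | ∀ y ∈ statesVanishing J, l y ≤ l φ} with hF
  have hexp : IsExposed ℝ (statesVanishing J) F := fun _ => ⟨l, rfl⟩
  obtain ⟨φ, hφ⟩ := (hexp.isCompact (isCompact_statesVanishing J)).extremePoints_nonempty
    ⟨φ₀, hφ₀, fun y hy => hmax hy⟩
  refine ⟨φ, hexp.isExtreme.extremePoints_subset_extremePoints hφ, ?_⟩
  refine lt_of_lt_of_le ?_ (hφ.1.2 _ hψ)
  rw [hl', ← Complex.ofReal_inv, Complex.re_ofReal_mul]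
  positivity

/-- The cyclic vector of the GNS representation. -/
def PositiveLinearMap.gnsCyclic (f : A →ₚ[ℂ] ℂ) : f.GNS :=
  (f.toPreGNS 1 : f.PreGNS)

lemma PositiveLinearMap.gns_apply_cyclic (f : A →ₚ[ℂ] ℂ) (a : A) :
    f.gnsNonUnitalStarAlgHom a f.gnsCyclic = (f.toPreGNS a : f.PreGNS) := by
  simp [gnsCyclic]

lemma PositiveLinearMap.inner_gns_apply_cyclic (f : A →ₚ[ℂ] ℂ) (a : A) :
    ⟪f.gnsCyclic, f.gnsNonUnitalStarAlgHom a f.gnsCyclic⟫_ℂ = f a := by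
  rw [gns_apply_cyclic, gnsCyclic, UniformSpace.Completion.inner_coe, preGNS_inner_def]
  simp

lemma PositiveLinearMap.dense_range_gns_apply_cyclic (f : A →ₚ[ℂ] ℂ) :
    DenseRange fun a => f.gnsNonUnitalStarAlgHom a f.gnsCyclic := by
  have h : (fun a => f.gnsNonUnitalStarAlgHom a f.gnsCyclic) =
      (fun v : f.PreGNS => (v : f.GNS)) ∘ f.toPreGNS := by
    ext a; exact f.gns_apply_cyclic a
  rw [h]
  exact (UniformSpace.Completion.denseRange_coe).comp
    f.toPreGNS.surjective.denseRange (UniformSpace.Completion.continuous_coe _)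

lemma PositiveLinearMap.gns_eq_zero (f : A →ₚ[ℂ] ℂ) (j : A)
    (hj : ∀ a, f (star (j * a) * (j * a)) = 0) : f.gnsNonUnitalStarAlgHom j = 0 := by
  ext v
  induction v using UniformSpace.Completion.induction_on with
  | hp => apply isClosed_eq <;> fun_prop
  | ih v =>
    rw [gnsNonUnitalStarAlgHom_apply_coe, _root_.zero_apply, ← norm_eq_zero,
      UniformSpace.Completion.norm_coe, leftMulMapPreGNS_apply, preGNS_norm_def]
    have := hj (f.ofPreGNS v)
    simp_all

lemma inner_gns_nonneg (f : A →ₚ[ℂ] ℂ) (v : f.GNS) (a : A) (ha : 0 ≤ a) :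
    0 ≤ ⟪v, f.gnsNonUnitalStarAlgHom a v⟫_ℂ := by
  obtain ⟨s, rfl⟩ := CStarAlgebra.nonneg_iff_eq_star_mul_self.1 ha
  rw [map_mul, map_star, ContinuousLinearMap.star_eq_adjoint, mul_apply_eq_comp,
    ContinuousLinearMap.adjoint_inner_right]
  rw [inner_self_eq_norm_sq_to_K, RCLike.ofReal_eq_complex_ofReal, ← Complex.ofReal_pow]
  exact Complex.zero_le_real.2 (sq_nonneg _)

lemma vector_state_mem {J : Submodule ℂ A} (f : A →ₚ[ℂ] ℂ)
    (hJ : ∀ j ∈ J, f.gnsNonUnitalStarAlgHom j = 0) (v : f.GNS) {t : ℝ} (ht : 0 < t)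
    (hv : ‖v‖ ^ 2 = t) :
    (fun a => (t : ℂ)⁻¹ * ⟪v, f.gnsNonUnitalStarAlgHom a v⟫_ℂ) ∈ statesVanishing J := by
  have ht' : (t : ℂ) ≠ 0 := by exact_mod_cast ht.ne'
  refine ⟨fun b c => ?_, fun c b => ?_, fun b hb => ?_, ?_, fun j hj => by simp [hJ j hj],
    fun b => ?_⟩
  · simp [inner_add_right, mul_add]
  · simp [inner_smul_right]; ring
  · refine mul_nonneg ?_ (inner_gns_nonneg f v b hb)
    rw [← Complex.ofReal_inv]
    exact Complex.zero_le_real.2 (by positivity)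
  · have h1 : f.gnsNonUnitalStarAlgHom 1 = 1 := map_one f.gnsStarAlgHom
    simp only [h1, one_apply_eq_self, inner_self_eq_norm_sq_to_K]
    rw [inv_mul_eq_one₀ ht', ← hv]
    norm_cast
  · rw [norm_mul, norm_inv, Complex.norm_real, Real.norm_of_nonneg ht.le, inv_mul_le_iff₀ ht, ← hv]
    have h2 := NonUnitalStarAlgHom.norm_apply_le f.gnsNonUnitalStarAlgHom b
    calc _ ≤ ‖v‖ * ‖f.gnsNonUnitalStarAlgHom b v‖ := norm_inner_le_norm _ _
      _ ≤ ‖v‖ * (‖b‖ * ‖v‖) := by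
        gcongr
        exact (ContinuousLinearMap.le_opNorm _ _).trans (by gcongr)
      _ = _ := by ring

/-- The GNS representation of a pure state (vanishing on an ideal) is irreducible. -/
lemma gns_irreducible {J : Submodule ℂ A} (hl : ∀ a, ∀ j ∈ J, a * j ∈ J)
    (hr : ∀ a, ∀ j ∈ J, j * a ∈ J) (f : A →ₚ[ℂ] ℂ)
    (hφ : (fun a => f a) ∈ (statesVanishing J).extremePoints ℝ) (K : Submodule ℂ f.GNS)
    (hK : IsClosed (K : Set f.GNS))
    (hinv : ∀ a, ∀ v ∈ K, f.gnsNonUnitalStarAlgHom a v ∈ K) : K = ⊥ ∨ K = ⊤ := by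
  set π := f.gnsNonUnitalStarAlgHom with hπ
  have hπJ : ∀ j ∈ J, π j = 0 := fun j hj =>
    f.gns_eq_zero j fun a => hφ.1.2.2.2.2.1 _ (hl _ _ (hr _ _ hj))
  have : CompleteSpace K := hK.completeSpace_coe
  set P := K.starProjection with hP
  have hPK : ∀ v, P v ∈ K := fun v => K.starProjection_apply_mem v
  have hcomm : ∀ a v, P (π a v) = π a (P v) := by
    intro a v
    refine Submodule.eq_starProjection_of_mem_of_inner_eq_zero (hinv a _ (hPK v)) ?_
    intro w hw
    rw [← map_sub, ← ContinuousLinearMap.adjoint_inner_right, ← ContinuousLinearMap.star_eq_adjoint,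
      ← map_star]
    exact K.starProjection_inner_eq_zero v _ (hinv _ _ hw)
  set ξ := f.gnsCyclic with hξ
  set v₁ := P ξ with hv₁
  set v₂ := ξ - P ξ with hv₂
  have horth : ∀ w ∈ K, ⟪v₂, w⟫_ℂ = 0 := fun w hw => K.starProjection_inner_eq_zero ξ w hw
  have hsum : ξ = v₁ + v₂ := by simp [hv₁, hv₂]
  have hcross : ∀ a, ⟪v₁, π a v₂⟫_ℂ = 0 := fun a => by
    rw [← ContinuousLinearMap.adjoint_inner_left, ← ContinuousLinearMap.star_eq_adjoint,
      ← map_star, ← inner_conj_symm, horth _ (hinv _ _ (hPK ξ)), map_zero]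
  have hdec : ∀ a, f a = ⟪v₁, π a v₁⟫_ℂ + ⟪v₂, π a v₂⟫_ℂ := by
    intro a
    have h1 : ⟪v₂, π a v₁⟫_ℂ = 0 := horth _ (hinv a _ (hPK ξ))
    have h2 : ⟪v₁, π a v₂⟫_ℂ = 0 := hcross a
    rw [← f.inner_gns_apply_cyclic a, ← hξ, hsum,
      map_add, inner_add_left, inner_add_right, inner_add_right, h1, h2]
    ring
  have hπ1 : π 1 = 1 := map_one f.gnsStarAlgHom
  have hnorm : ‖v₁‖ ^ 2 + ‖v₂‖ ^ 2 = 1 := by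
    have := hdec 1
    rw [show f 1 = 1 from hφ.1.2.2.2.1, hπ1, one_apply_eq_self, one_apply_eq_self,
      inner_self_eq_norm_sq_to_K, inner_self_eq_norm_sq_to_K,
      RCLike.ofReal_eq_complex_ofReal] at this
    exact_mod_cast this.symm
  have hext : ∀ (Q R : f.GNS →L[ℂ] f.GNS), (∀ a v, Q (π a v) = π a (Q v)) →
      (∀ a v, R (π a v) = π a (R v)) → Q ξ = R ξ → Q = R := by
    intro Q R hQ hR h
    ext v
    refine (f.dense_range_gns_apply_cyclic).induction_on v
      (isClosed_eq Q.continuous R.continuous) fun a => ?_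
    change Q (π a ξ) = R (π a ξ)
    rw [hQ, hR, h]
  by_cases h1 : v₁ = 0
  · left
    have hP0 : P = 0 := hext P 0 hcomm (by simp) h1
    rw [Submodule.eq_bot_iff]
    intro v hv
    rw [← K.starProjection_eq_self_iff.2 hv, ← hP, hP0, _root_.zero_apply]
  by_cases h2 : v₂ = 0
  · right
    have hP1 : P = 1 := hext P 1 hcomm (by simp) (by
      rw [hv₂, sub_eq_zero] at h2; exact h2.symm)
    rw [Submodule.eq_top_iff']
    intro v
    have := hPK v
    rwa [hP1] at this
  exfalso
  have t1 : 0 < ‖v₁‖ ^ 2 := by positivity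
  have t2 : 0 < ‖v₂‖ ^ 2 := by positivity
  have hm1 := vector_state_mem f hπJ v₁ t1 rfl
  have hm2 := vector_state_mem f hπJ v₂ t2 rfl
  have c1 : ((‖v₁‖ ^ 2 : ℝ) : ℂ) ≠ 0 := by exact_mod_cast t1.ne'
  have c2 : ((‖v₂‖ ^ 2 : ℝ) : ℂ) ≠ 0 := by exact_mod_cast t2.ne'
  have heq := ((mem_extremePoints.1 hφ).2 _ hm1 _ hm2
    ⟨‖v₁‖ ^ 2, ‖v₂‖ ^ 2, t1, t2, hnorm, by
      ext a
      rw [Pi.add_apply, Pi.smul_apply, Pi.smul_apply, ← Complex.coe_smul, ← Complex.coe_smul,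
        smul_eq_mul, smul_eq_mul, mul_inv_cancel_left₀ c1, mul_inv_cancel_left₀ c2, hdec a]⟩).1
  have hv : v₁ = ((‖v₁‖ ^ 2 : ℝ) : ℂ) • ξ := by
    refine Dense.eq_of_inner_left ℂ f.dense_range_gns_apply_cyclic ?_
    rintro _ ⟨a, rfl⟩
    change ⟪v₁, π a ξ⟫_ℂ = ⟪_, π a ξ⟫_ℂ
    have e1 : ⟪v₁, π a ξ⟫_ℂ = ⟪v₁, π a v₁⟫_ℂ := by
      conv_lhs => rw [hsum, map_add, inner_add_right, hcross a, add_zero]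
    rw [e1, inner_smul_left, f.inner_gns_apply_cyclic, ← congrFun heq a, Complex.conj_ofReal, mul_inv_cancel_left₀ c1]
  have hPv : P v₁ = v₁ := K.starProjection_eq_self_iff.2 (hPK ξ)
  have hv' : v₁ = ((‖v₁‖ ^ 2 : ℝ) : ℂ) • v₁ := by
    conv_lhs => rw [← hPv, hv, map_smul]
  have h3 : ((1 : ℂ) - ((‖v₁‖ ^ 2 : ℝ) : ℂ)) • v₁ = 0 := by
    rw [sub_smul, one_smul, ← hv', sub_self]
  rcases smul_eq_zero.1 h3 with h4 | h4
  · have : (1 : ℝ) = ‖v₁‖ ^ 2 := by exact_mod_cast sub_eq_zero.1 h4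
    linarith
  · exact h1 h4

/-- A closed ideal of a unital C⋆-algebra is separated from any element outside it by the GNS
representation of a pure state. -/
lemma exists_irreducible_gns (J : Submodule ℂ A) (hJ : IsClosed (J : Set A))
    (hl : ∀ a, ∀ j ∈ J, a * j ∈ J) (hr : ∀ a, ∀ j ∈ J, j * a ∈ J) (a : A) (ha : a ∉ J) :
    ∃ f : A →ₚ[ℂ] ℂ, (∀ j ∈ J, f.gnsNonUnitalStarAlgHom j = 0) ∧
      f.gnsNonUnitalStarAlgHom a ≠ 0 ∧ ∀ K : Submodule ℂ f.GNS, IsClosed (K : Set f.GNS) →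
        (∀ b, ∀ v ∈ K, f.gnsNonUnitalStarAlgHom b v ∈ K) → K = ⊥ ∨ K = ⊤ := by
  have hst : ∀ j ∈ J, star j ∈ J := fun j hj =>
    mem_of_star_mul_self_le J hJ hl (star j) fun ε hε =>
      ⟨j * star j, hr _ _ hj, .mul_star_self j, by
        rw [star_star]
        exact le_add_of_nonneg_left (by simpa using algebraMap_mono A hε.le)⟩
  obtain ⟨φ, hφ, hφa⟩ := exists_extreme_state J hJ hl hst a ha
  let f : A →ₚ[ℂ] ℂ := PositiveLinearMap.mk₀
    { toFun := φ, map_add' := hφ.1.1, map_smul' := hφ.1.2.1 } hφ.1.2.2.1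
  refine ⟨f, fun j hj => f.gns_eq_zero j fun b => hφ.1.2.2.2.2.1 _ (hl _ _ (hr _ _ hj)), ?_,
    gns_irreducible hl hr f hφ⟩
  intro h0
  have h1 : f (star a * a) = 0 := by
    rw [← f.inner_gns_apply_cyclic, map_mul, h0, mul_zero, _root_.zero_apply, inner_zero_right]
  have h2 : (f (star a * a)).re = (φ (star a * a)).re := rfl
  rw [h1, Complex.zero_re] at h2
  linarith

/-- A closed ideal of a C⋆-algebra is the intersection of the kernels of the irreducible
representations that vanish on it. -/
theorem exists_irreducible_rep {B : Type} [NonUnitalCStarAlgebra B] (J : Submodule ℂ B)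
    (hJ : IsClosed (J : Set B)) (hl : ∀ a, ∀ j ∈ J, a * j ∈ J) (hr : ∀ a, ∀ j ∈ J, j * a ∈ J)
    (a : B) (ha : a ∉ J) :
    ∃ (H : Type) (_ : NormedAddCommGroup H) (_ : InnerProductSpace ℂ H) (_ : CompleteSpace H)
      (π : B →⋆ₙₐ[ℂ] (H →L[ℂ] H)), (∀ j ∈ J, π j = 0) ∧ π a ≠ 0 ∧
        ∀ K : Submodule ℂ H, IsClosed (K : Set H) → (∀ b, ∀ v ∈ K, π b v ∈ K) →
          K = ⊥ ∨ K = ⊤ := by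
  let _ : PartialOrder (Unitization ℂ B) := CStarAlgebra.spectralOrder _
  have : StarOrderedRing (Unitization ℂ B) := CStarAlgebra.spectralOrderedRing _
  let ι : B →⋆ₙₐ[ℂ] Unitization ℂ B := Unitization.inrNonUnitalStarAlgHom ℂ B
  let J' : Submodule ℂ (Unitization ℂ B) := J.map ((ι : B →ₙₐ[ℂ] Unitization ℂ B) : B →ₗ[ℂ] _)
  have hmem : ∀ y, y ∈ J' ↔ ∃ j ∈ J, (j : Unitization ℂ B) = y := fun _ => Iff.rfl
  have hJ' : IsClosed (J' : Set (Unitization ℂ B)) :=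
    (Unitization.isometry_inr (𝕜 := ℂ) (A := B)).isClosedEmbedding.isClosedMap _ hJ
  have hinl : ∀ c : ℂ, (Unitization.inl c : Unitization ℂ B) = c • 1 := fun c => by
    rw [← Algebra.algebraMap_eq_smul_one]; rfl
  have hl' : ∀ y, ∀ z ∈ J', y * z ∈ J' := by
    intro y z hz
    obtain ⟨j, hj, rfl⟩ := (hmem _).1 hz
    induction y using Unitization.ind with
    | inl_add_inr c b =>
      refine (hmem _).2 ⟨c • j + b * j, J.add_mem (J.smul_mem _ hj) (hl _ _ hj), ?_⟩
      simp [add_mul, hinl]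
  have hr' : ∀ y, ∀ z ∈ J', z * y ∈ J' := by
    intro y z hz
    obtain ⟨j, hj, rfl⟩ := (hmem _).1 hz
    induction y using Unitization.ind with
    | inl_add_inr c b =>
      refine (hmem _).2 ⟨c • j + j * b, J.add_mem (J.smul_mem _ hj) (hr _ _ hj), ?_⟩
      simp [mul_add, hinl]
  have ha' : (a : Unitization ℂ B) ∉ J' := by
    rintro ⟨j, hj, hja⟩
    exact ha (Unitization.inr_injective hja ▸ hj)
  obtain ⟨f, hf0, hfa, hfK⟩ := exists_irreducible_gns J' hJ' hl' hr' (a : Unitization ℂ B) ha'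
  refine ⟨f.GNS, inferInstance, inferInstance, inferInstance, f.gnsNonUnitalStarAlgHom.comp ι,
    fun j hj => hf0 _ ⟨j, hj, rfl⟩, hfa, fun K hK hinv => hfK K hK fun b v hv => ?_⟩
  induction b using Unitization.ind with
  | inl_add_inr c b =>
    have h1 : f.gnsNonUnitalStarAlgHom (Unitization.inl c) v = c • v := by
      have h2 : f.gnsNonUnitalStarAlgHom 1 = 1 := map_one f.gnsStarAlgHom
      rw [hinl, map_smul, h2]
      simp
    rw [map_add, _root_.add_apply, h1]
    exact K.add_mem (K.smul_mem _ hv) (hinv b v hv)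

end PureStates

namespace FellBundleData

variable (Ω : FellBundleData)

/-- The fibre over `x` as a type, carrying its Banach space structure. -/
@[ext] structure Fib (x : Ω.G) : Type where
  /-- the underlying point of the total space -/
  val : Ω.T
  prop : Ω.p val = x

variable {Ω} {x : Ω.G}

theorem Fib.p_eq (a b : Ω.Fib x) : Ω.p a.1 = Ω.p b.1 := a.2.trans b.2.symm

instance : Zero (Ω.Fib x) := ⟨⟨Ω.bzero x, Ω.p_bzero x⟩⟩
instance : Add (Ω.Fib x) := ⟨fun a b => ⟨Ω.badd a.1 b.1, by rw [Ω.p_badd _ _ (a.p_eq b), a.2]⟩⟩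
instance : SMul ℂ (Ω.Fib x) := ⟨fun c a => ⟨Ω.bsmul c a.1, by rw [Ω.p_bsmul, a.2]⟩⟩
instance : Neg (Ω.Fib x) := ⟨fun a => (-1 : ℂ) • a⟩
instance : Norm (Ω.Fib x) := ⟨fun a => Ω.bnorm a.1⟩

theorem Fib.add_val (a b : Ω.Fib x) : (a + b).1 = Ω.badd a.1 b.1 := rfl
theorem Fib.smul_val (c : ℂ) (a : Ω.Fib x) : (c • a).1 = Ω.bsmul c a.1 := rfl
theorem Fib.norm_def (a : Ω.Fib x) : ‖a‖ = Ω.bnorm a.1 := rfl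

instance : AddCommGroup (Ω.Fib x) where
  add_assoc a b c := Fib.ext (Ω.badd_assoc _ _ _ (a.p_eq b) (b.p_eq c))
  zero_add := by
    rintro ⟨a, rfl⟩
    exact Fib.ext (Ω.bzero_badd a)
  add_zero := by
    rintro ⟨a, rfl⟩
    exact Fib.ext ((Ω.badd_comm _ _ (Ω.p_bzero _).symm).trans (Ω.bzero_badd a))
  add_comm a b := Fib.ext (Ω.badd_comm _ _ (a.p_eq b))
  neg_add_cancel := by
    rintro ⟨a, rfl⟩
    exact Fib.ext ((Ω.badd_comm _ _ (Ω.p_bsmul _ _)).trans (Ω.badd_neg a))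
  nsmul := nsmulRec
  zsmul := zsmulRec

instance : Module ℂ (Ω.Fib x) where
  one_smul a := Fib.ext (Ω.one_bsmul _)
  mul_smul c d a := Fib.ext (Ω.mul_bsmul _ _ _)
  smul_zero c := Fib.ext (Ω.bsmul_bzero _ _)
  smul_add c a b := Fib.ext (Ω.bsmul_badd _ _ _ (a.p_eq b))
  add_smul c d a := Fib.ext (Ω.add_bsmul _ _ _)
  zero_smul := by
    rintro ⟨a, rfl⟩
    exact Fib.ext (Ω.zero_bsmul a)

theorem Fib.core : NormedSpace.Core ℂ (Ω.Fib x) where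
  norm_nonneg a := Ω.bnorm_nonneg _
  norm_smul c a := Ω.bnorm_bsmul _ _
  norm_triangle a b := Ω.bnorm_badd_le _ _ (a.p_eq b)
  norm_eq_zero_iff := by
    rintro ⟨a, rfl⟩
    exact (Ω.bnorm_eq_zero a).trans ⟨fun h => Fib.ext h, fun h => congrArg Fib.val h⟩

instance : NormedAddCommGroup (Ω.Fib x) := NormedAddCommGroup.ofCore Fib.core
instance : NormedSpace ℂ (Ω.Fib x) := NormedSpace.ofCore Fib.core

theorem Fib.sub_val (a b : Ω.Fib x) : (a - b).1 = Ω.badd a.1 (Ω.bsmul (-1) b.1) := by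
  rw [sub_eq_add_neg]
  rfl

theorem Fib.norm_sub_def (a b : Ω.Fib x) : ‖a - b‖ = Ω.bnorm (Ω.badd a.1 (Ω.bsmul (-1) b.1)) := by
  rw [Fib.norm_def, Fib.sub_val]

instance : CompleteSpace (Ω.Fib x) := by
  refine Metric.complete_of_cauchySeq_tendsto fun f hf => ?_
  obtain ⟨L, hL, h⟩ := Ω.fiber_complete x (fun n => (f n).1) (fun n => (f n).2) (by
    intro ε hε
    obtain ⟨N, hN⟩ := Metric.cauchySeq_iff.1 hf ε hε
    refine ⟨N, fun m n hm hn => ?_⟩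
    rw [← Fib.norm_sub_def, ← dist_eq_norm]
    exact hN m hm n hn)
  refine ⟨⟨L, hL⟩, tendsto_iff_norm_sub_tendsto_zero.2 (h.congr fun n => ?_)⟩
  rw [Fib.norm_sub_def]

/-- The subspace topology and the norm topology agree on fibres. -/
theorem Fib.continuous_val : Continuous (fun b : Ω.Fib x => b.1) := by
  refine continuous_iff_continuousAt.2 fun b U hU => mem_map.2 ?_
  obtain ⟨ε, hε, h⟩ := Ω.norm_nbhd_fiber b.1 U hU
  filter_upwards [Metric.ball_mem_nhds b hε] with c hc
  refine h c.1 (c.p_eq b) ?_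
  rwa [← Fib.norm_sub_def, ← dist_eq_norm]

theorem Fib.isInducing_val : Topology.IsInducing (fun b : Ω.Fib x => b.1) := by
  refine Topology.isInducing_iff_nhds.2 fun b => le_antisymm ?_ ?_
  · exact Fib.continuous_val.continuousAt.le_comap
  · intro V hV
    obtain ⟨ε, hε, h⟩ := Metric.mem_nhds_iff.1 hV
    obtain ⟨U, hU, h'⟩ := Ω.fiber_nbhd_norm b.1 ε hε
    refine ⟨U, hU, fun c hc => h ?_⟩
    rw [mem_ball_iff_norm, Fib.norm_sub_def]
    exact h' _ hc (c.p_eq b)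

section Unit

variable [hu : Fact (Ω.rng x = x)]

theorem src_unit : Ω.src x = x := by
  have := Ω.src_rng x
  rwa [hu.out] at this

theorem gmul_unit : Ω.gmul x x = x := by
  have := Ω.gmul_rng x
  rwa [hu.out] at this

theorem Fib.comp (a b : Ω.Fib x) : Ω.src (Ω.p a.1) = Ω.rng (Ω.p b.1) := by
  rw [a.2, b.2, src_unit, hu.out]

instance : Mul (Ω.Fib x) :=
  ⟨fun a b => ⟨Ω.bmul a.1 b.1, by rw [Ω.p_bmul _ _ (a.comp b), a.2, b.2, gmul_unit]⟩⟩
instance : Star (Ω.Fib x) :=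
  ⟨fun a => ⟨Ω.bstar a.1, by rw [Ω.p_bstar, a.2, Ω.ginv_unit _ hu.out]⟩⟩

theorem Fib.smul_mul (c : ℂ) (a b : Ω.Fib x) : c • a * b = c • (a * b) :=
  Fib.ext (Ω.bsmul_bmul _ _ _ (a.comp b))

theorem Fib.mul_smul' (c : ℂ) (a b : Ω.Fib x) : a * c • b = c • (a * b) :=
  Fib.ext (Ω.bmul_bsmul _ _ _ (a.comp b))

instance : NonUnitalRing (Ω.Fib x) where
  left_distrib a b c := Fib.ext (Ω.badd_bmul _ _ _ (b.p_eq c) (a.comp b))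
  right_distrib a b c := Fib.ext (Ω.bmul_badd _ _ _ (a.p_eq b) (a.comp c))
  zero_mul a := by
    have := Fib.smul_mul 0 a a
    rwa [zero_smul, zero_smul] at this
  mul_zero a := by
    have := Fib.mul_smul' 0 a a
    rwa [zero_smul, zero_smul] at this
  mul_assoc a b c := Fib.ext (Ω.bmul_assoc _ _ _ (a.comp b) (b.comp c))

instance : NonUnitalNormedRing (Ω.Fib x) where
  __ := (inferInstance : NonUnitalRing (Ω.Fib x))
  __ := (inferInstance : NormedAddCommGroup (Ω.Fib x))
  norm_mul_le a b := Ω.unit_submul _ _ (a.p_eq b) (by rw [a.2, hu.out])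

instance : StarRing (Ω.Fib x) where
  star_involutive _ := Fib.ext (Ω.bstar_bstar _)
  star_mul a b := Fib.ext (Ω.bstar_bmul _ _ (a.comp b))
  star_add a b := Fib.ext (Ω.bstar_badd _ _ (a.p_eq b))

instance : IsScalarTower ℂ (Ω.Fib x) (Ω.Fib x) := ⟨fun c a b => Fib.smul_mul c a b⟩
instance : SMulCommClass ℂ (Ω.Fib x) (Ω.Fib x) :=
  ⟨fun c a b => (Fib.mul_smul' c a b).symm⟩
instance : StarModule ℂ (Ω.Fib x) := ⟨fun c a => Fib.ext (Ω.bstar_bsmul c a.1)⟩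
instance : CStarRing (Ω.Fib x) := ⟨fun a => by
  have h := Ω.cstar_identity a.1
  rw [← sq]
  exact h.ge⟩

instance : NonUnitalCStarAlgebra (Ω.Fib x) where

end Unit

end FellBundleData

namespace FellBundleData

section Sections

variable {Ω : FellBundleData} {x : Ω.G}

theorem Fib.add_nhds (a b : Ω.Fib x) {U : Set Ω.T} (hU : U ∈ 𝓝 (a + b).1) :
    ∃ V ∈ 𝓝 a.1, ∃ W ∈ 𝓝 b.1, ∀ y (c d : Ω.Fib y), c.1 ∈ V → d.1 ∈ W → (c + d).1 ∈ U := by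
  have h := Ω.cont_badd.continuousAt (x := ⟨(a.1, b.1), a.p_eq b⟩) hU
  rw [mem_map, nhds_subtype_eq_comap, mem_comap] at h
  obtain ⟨N, hN, hNU⟩ := h
  obtain ⟨V, hV, W, hW, hVW⟩ := mem_nhds_prod_iff.1 hN
  refine ⟨V, hV, W, hW, fun y c d hc hd => ?_⟩
  exact hNU (a := ⟨(c.1, d.1), c.p_eq d⟩) (hVW ⟨hc, hd⟩)

theorem Fib.smul_nhds (k : ℂ) (a : Ω.Fib x) {U : Set Ω.T} (hU : U ∈ 𝓝 (k • a).1) :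
    ∃ S ∈ 𝓝 k, ∃ V ∈ 𝓝 a.1, ∀ y, ∀ m ∈ S, ∀ c : Ω.Fib y, c.1 ∈ V → (m • c).1 ∈ U := by
  have h := Ω.cont_bsmul.continuousAt (x := (k, a.1)) hU
  obtain ⟨S, hS, V, hV, hSV⟩ := mem_nhds_prod_iff.1 (mem_map.1 h)
  exact ⟨S, hS, V, hV, fun y m hm c hc => hSV (a := (m, c.1)) ⟨hm, hc⟩⟩

theorem Fib.sub_nhds (a b : Ω.Fib x) {U : Set Ω.T} (hU : U ∈ 𝓝 (a - b).1) :
    ∃ V ∈ 𝓝 a.1, ∃ W ∈ 𝓝 b.1, ∀ y (c d : Ω.Fib y), c.1 ∈ V → d.1 ∈ W → (c - d).1 ∈ U := by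
  have e : ∀ y (c d : Ω.Fib y), c - d = c + (-1 : ℂ) • d := fun y c d => by
    rw [neg_one_smul, sub_eq_add_neg]
  rw [e] at hU
  obtain ⟨V, hV, W, hW, h⟩ := Fib.add_nhds _ _ hU
  obtain ⟨S, hS, W', hW', h'⟩ := Fib.smul_nhds _ _ hW
  refine ⟨V, hV, W', hW', fun y c d hc hd => ?_⟩
  rw [e]
  exact h _ _ _ hc (h' _ _ (mem_of_mem_nhds hS) _ hd)

theorem Fib.eventually_exists (a : Ω.Fib x) {U : Set Ω.T} (hU : U ∈ 𝓝 a.1) :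
    ∀ᶠ z in 𝓝 x, ∃ b : Ω.Fib z, b.1 ∈ U := by
  have h := Ω.p_open.image_mem_nhds hU
  rw [a.2] at h
  filter_upwards [h] with z hz
  obtain ⟨b, hb, rfl⟩ := hz
  exact ⟨⟨b, rfl⟩, hb⟩

theorem Fib.norm_nhds (a : Ω.Fib x) {r : ℝ} (hr : ‖a‖ < r) :
    ∃ U ∈ 𝓝 a.1, ∀ y (c : Ω.Fib y), c.1 ∈ U → ‖c‖ < r :=
  ⟨_, Ω.usc_bnorm a.1 r hr, fun _ _ hc => hc⟩

theorem Fib.thin_nhds (a : Ω.Fib x) {δ : ℝ} (hδ : 0 < δ) :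
    ∃ U, IsOpen U ∧ a.1 ∈ U ∧ ∀ y (c d : Ω.Fib y), c.1 ∈ U → d.1 ∈ U → ‖c - d‖ < δ := by
  obtain ⟨N, hN, h⟩ := Fib.norm_nhds (a - a) (r := δ) (by simpa using hδ)
  obtain ⟨V, hV, W, hW, h'⟩ := Fib.sub_nhds a a hN
  obtain ⟨U, hU, hUo, haU⟩ := mem_nhds_iff.1 (inter_mem hV hW)
  exact ⟨U, hUo, haU, fun y c d hc hd => h _ _ (h' _ _ _ (hU hc).1 (hU hd).2)⟩

variable {Y : Type*} {q : Y → Ω.G}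

/-- A sequence of sections with geometrically decaying increments converges uniformly. -/
theorem exists_limit_section (f : ℕ → ∀ y, Ω.Fib (q y)) {C : ℝ}
    (h : ∀ n y, ‖f (n + 1) y - f n y‖ ≤ C / 2 / 2 ^ n) :
    ∃ F : ∀ y, Ω.Fib (q y), ∀ n y, ‖f n y - F y‖ ≤ C / 2 ^ n := by
  have hd : ∀ y n, dist (f n y) (f (n + 1) y) ≤ C / 2 / 2 ^ n := fun y n => by
    rw [dist_comm, dist_eq_norm]
    exact h n y
  choose F hF using fun y => cauchySeq_tendsto_of_complete (cauchySeq_of_le_geometric_two (hd y))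
  refine ⟨F, fun n y => ?_⟩
  rw [← dist_eq_norm]
  exact dist_le_of_le_geometric_two_of_tendsto (hd y) (hF y) n

variable [TopologicalSpace Y]

/-- The section `f` is within `ε` of being continuous at `y`. -/
def ApproxAt (f : ∀ y, Ω.Fib (q y)) (y : Y) (ε : ℝ) : Prop :=
  ∀ U ∈ 𝓝 (f y).1, ∀ᶠ z in 𝓝 y, ∃ b : Ω.Fib (q z), b.1 ∈ U ∧ ‖f z - b‖ < ε

theorem ApproxAt.of_continuousAt {f : ∀ y, Ω.Fib (q y)} {y : Y}
    (hf : ContinuousAt (fun z => (f z).1) y) {ε : ℝ} (hε : 0 < ε) : ApproxAt f y ε := by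
  intro U hU
  filter_upwards [hf hU] with z hz
  exact ⟨f z, hz, by simpa using hε⟩

theorem ApproxAt.continuousAt (hq : Continuous q) {f : ∀ y, Ω.Fib (q y)} {y : Y}
    (h : ∀ ε : ℝ, 0 < ε → ApproxAt f y ε) : ContinuousAt (fun z => (f z).1) y := by
  intro U hU
  obtain ⟨V, hV, W, hW, hVW⟩ := Fib.add_nhds (f y) 0 (U := U) (by simpa using hU)
  obtain ⟨N, hN, ε, hε, hNW⟩ := Ω.zero_nbhd (q y) W hW
  rw [mem_map]
  filter_upwards [h ε hε V hV, hq.continuousAt hN] with z ⟨b, hb, hbε⟩ hz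
  have := hVW _ b (f z - b) hb (hNW _ (by rw [Fib.prop]; exact hz) hbε)
  rwa [add_sub_cancel] at this

theorem ApproxAt.mono {f : ∀ y, Ω.Fib (q y)} {y : Y} {ε ε' : ℝ} (h : ApproxAt f y ε)
    (hε : ε ≤ ε') : ApproxAt f y ε' := fun U hU => by
  filter_upwards [h U hU] with z ⟨b, hb, hbε⟩
  exact ⟨b, hb, hbε.trans_le hε⟩

theorem ApproxAt.add {f g : ∀ y, Ω.Fib (q y)} {y : Y} {ε δ : ℝ} (hf : ApproxAt f y ε)
    (hg : ApproxAt g y δ) : ApproxAt (f + g) y (ε + δ) := by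
  intro U hU
  obtain ⟨V, hV, W, hW, h⟩ := Fib.add_nhds (f y) (g y) hU
  filter_upwards [hf V hV, hg W hW] with z ⟨b, hb, hb'⟩ ⟨c, hc, hc'⟩
  refine ⟨b + c, h _ _ _ hb hc, ?_⟩
  rw [Pi.add_apply, add_sub_add_comm]
  exact (norm_add_le _ _).trans_lt (add_lt_add hb' hc')

theorem ApproxAt.smul {f : ∀ y, Ω.Fib (q y)} {y : Y} {ε η : ℝ} (hf : ApproxAt f y ε)
    {φ : Y → ℂ} (hφ : ContinuousAt φ y) (hη : 0 < η) :
    ApproxAt (fun z => φ z • f z) y (‖φ y‖ * ε + η) := by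
  intro U hU
  obtain ⟨S, hS, V, hV, h⟩ := Fib.smul_nhds _ _ hU
  have hlt : ∀ᶠ z in 𝓝 y, ‖φ z‖ * ε < ‖φ y‖ * ε + η :=
    (hφ.norm.mul continuousAt_const).eventually
      (gt_mem_nhds (show ‖φ y‖ * ε < _ by linarith))
  filter_upwards [hf V hV, hφ hS, hlt] with z ⟨b, hb, hb'⟩ hz hz'
  refine ⟨φ z • b, h _ _ hz _ hb, ?_⟩
  rw [← smul_sub, norm_smul]
  exact (mul_le_mul_of_nonneg_left hb'.le (norm_nonneg _)).trans_lt hz'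

theorem ApproxAt.of_norm_lt (hq : Continuous q) {f : ∀ y, Ω.Fib (q y)} {y : Y} {η : ℝ}
    (h : ∀ z, ‖f z‖ < η) : ApproxAt f y (2 * η) := by
  intro U hU
  obtain ⟨V, hV, hVη⟩ := Fib.norm_nhds _ (h y)
  filter_upwards [hq.continuousAt ((f y).eventually_exists (inter_mem hU hV))] with z ⟨b, hb⟩
  refine ⟨b, hb.1, (norm_sub_le _ _).trans_lt ?_⟩
  linarith [h z, hVη _ _ hb.2]

theorem ApproxAt.of_near (hq : Continuous q) {f g : ∀ y, Ω.Fib (q y)} {y : Y} {ε η : ℝ}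
    (hg : ApproxAt g y ε) (h : ∀ z, ‖f z - g z‖ < η) : ApproxAt f y (ε + 2 * η) := by
  have := hg.add (ApproxAt.of_norm_lt hq (f := f - g) (y := y) h)
  rwa [add_sub_cancel] at this

theorem ApproxAt.of_eventually_zero (hq : Continuous q) {f : ∀ y, Ω.Fib (q y)} {y : Y} {ε : ℝ}
    (hε : 0 < ε) (h : ∀ᶠ z in 𝓝 y, f z = 0) : ApproxAt f y ε := by
  intro U hU
  rw [h.self_of_nhds] at hU
  filter_upwards [h, (Ω.cont_bzero.comp hq).continuousAt hU] with z hz hz'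
  exact ⟨0, hz', by simpa [hz] using hε⟩

theorem ApproxAt.sum (hq : Continuous q) {ι : Type*} {s : Finset ι}
    {f : ι → ∀ y, Ω.Fib (q y)} {y : Y}
    {ε : ι → ℝ} (h : ∀ i ∈ s, ApproxAt (f i) y (ε i)) {η : ℝ} (hη : 0 < η) :
    ApproxAt (∑ i ∈ s, f i) y (∑ i ∈ s, ε i + η) := by
  classical
  induction s using Finset.induction_on with
  | empty => simpa using ApproxAt.of_eventually_zero hq hη (by simp)
  | insert i s hi ih =>
    rw [Finset.sum_insert hi, Finset.sum_insert hi, add_assoc]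
    exact (h i (by simp)).add (ih fun j hj => h j (by simp [hj]))

/-- A section that picks values in a thin open set is approximately continuous. -/
theorem ApproxAt.of_thin (hq : Continuous q) {f : ∀ y, Ω.Fib (q y)} {U : Set Ω.T}
    (hU : IsOpen U) {δ : ℝ}
    (hthin : ∀ y (c d : Ω.Fib y), c.1 ∈ U → d.1 ∈ U → ‖c - d‖ < δ) {y : Y}
    (h : ∀ᶠ z in 𝓝 y, (f z).1 ∈ U) : ApproxAt f y δ := by
  intro V hV
  filter_upwards [h, hq.continuousAt
    ((f y).eventually_exists (inter_mem hV (hU.mem_nhds h.self_of_nhds)))] with z hz ⟨b, hb⟩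
  exact ⟨b, hb.1, hthin _ _ _ hz hb.2⟩

theorem continuous_limit_section (hq : Continuous q) {f : ℕ → ∀ y, Ω.Fib (q y)}
    {F : ∀ y, Ω.Fib (q y)} {ε : ℕ → ℝ} (hε : Tendsto ε atTop (𝓝 0))
    (hf : ∀ n y, ApproxAt (f n) y (ε n)) (hF : ∀ n y, ‖f n y - F y‖ ≤ ε n) :
    Continuous fun y => (F y).1 := by
  refine continuous_iff_continuousAt.2 fun y => ApproxAt.continuousAt hq fun η hη => ?_
  obtain ⟨n, hn⟩ := (hε.eventually (gt_mem_nhds (show 0 < η / 4 by positivity))).exists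
  refine ((hf n y).of_near hq (η := η / 4) fun z => ?_).mono (by linarith)
  rw [norm_sub_rev]
  exact (hF n z).trans_lt hn

end Sections

end FellBundleData

theorem exists_dependent_seq {α : Type*} {P : ℕ → α → Prop} {R : ℕ → α → α → Prop} {a : α}
    (ha : P 0 a) (h : ∀ n b, P n b → ∃ c, P (n + 1) c ∧ R n b c) :
    ∃ f : ℕ → α, f 0 = a ∧ ∀ n, P n (f n) ∧ R n (f n) (f (n + 1)) := by
  choose! s hs using h
  have hP : ∀ n, P n (Nat.rec a s n) := fun n => by
    induction n with
    | zero => exact ha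
    | succ n ih => exact (hs n _ ih).1
  exact ⟨fun n => Nat.rec a s n, rfl, fun n => ⟨hP n, (hs n _ (hP n)).2⟩⟩

namespace FellBundleData

section EnoughSections

variable {Ω : FellBundleData} {Y : Type*} [TopologicalSpace Y] {q : Y → Ω.G}

theorem Fib.exists_local_section (hq : Continuous q) {f : ∀ y, Ω.Fib (q y)} {ε δ : ℝ} {y : Y}
    (hf : ApproxAt f y ε) (hδ : 0 < δ) :
    ∃ (W : Set Y) (g : ∀ y, Ω.Fib (q y)), IsOpen W ∧ y ∈ W ∧ (∀ z ∈ W, ApproxAt g z δ) ∧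
      ∀ z ∈ W, ‖g z - f z‖ < ε := by
  classical
  obtain ⟨U, hU, hyU, hthin⟩ := (f y).thin_nhds hδ
  obtain ⟨W, hWs, hW, hyW⟩ := eventually_nhds_iff.1 (hf U (hU.mem_nhds hyU))
  choose! g hg using hWs
  refine ⟨W, g, hW, hyW, fun z hz => ?_, fun z hz => ?_⟩
  · refine ApproxAt.of_thin hq hU hthin ?_
    filter_upwards [hW.mem_nhds hz] with z' hz'
    exact (hg z' hz').1
  · rw [norm_sub_rev]
    exact (hg z hz).2

variable [LocallyCompactSpace Y] [T2Space Y]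

theorem exists_better_section (hq : Continuous q) {f : ∀ y, Ω.Fib (q y)} {ε δ : ℝ}
    (hf : ∀ y, ApproxAt f y ε) (hε : 0 < ε) (hδ : 0 < δ) {K : Set Y} (hK : IsCompact K)
    (hfK : ∀ y ∉ K, f y = 0) :
    ∃ (g : ∀ y, Ω.Fib (q y)), (∀ y, ApproxAt g y δ) ∧ (∀ y, ‖g y - f y‖ ≤ ε) ∧
      ∃ L : Set Y, IsCompact L ∧ ∀ y ∉ L, g y = 0 := by
  classical
  choose W g hWo hyW hgD hgf using fun y => Fib.exists_local_section hq (hf y) (half_pos (half_pos hδ))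
  obtain ⟨t, ht⟩ := hK.elim_finite_subcover W hWo fun y _ => Set.mem_iUnion.2 ⟨y, hyW y⟩
  obtain ⟨φ, hφ, hφc⟩ := PartitionOfUnity.exists_isSubordinate_of_locallyFinite_t2space hK
    (fun i : t => W i) (fun i => hWo i) (locallyFinite_of_finite _) (by
      rwa [← Set.iUnion_subtype (fun y => y ∈ t) (fun y => W y)] at ht)
  have hsum : ∀ y, ∑ i, φ i y ≤ 1 := fun y => by
    rw [← finsum_eq_sum_of_fintype]
    exact φ.sum_le_one y
  have hcont : ∀ i, Continuous fun y => ((φ i y : ℝ) : ℂ) := fun i =>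
    Complex.continuous_ofReal.comp (φ i).continuous
  have hnorm : ∀ i y, ‖((φ i y : ℝ) : ℂ)‖ = φ i y := fun i y => by
    rw [Complex.norm_real, Real.norm_of_nonneg (φ.nonneg i y)]
  have hoff : ∀ i y, y ∉ tsupport (φ i) → ((φ i y : ℝ) : ℂ) = 0 := fun i y hy => by
    rw [image_eq_zero_of_notMem_tsupport hy, Complex.ofReal_zero]
  refine ⟨∑ i : t, fun y => ((φ i y : ℝ) : ℂ) • g i y, fun y => ?_, fun y => ?_,
    ⋃ i, tsupport (φ i), isCompact_iUnion fun i => hφc i, fun y hy => ?_⟩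
  · have hc : (0 : ℝ) < δ / 4 / (Fintype.card t + 1) := by positivity
    refine (ApproxAt.sum hq (s := Finset.univ)
      (ε := fun i => φ i y * (δ / 2 / 2) + δ / 4 / (Fintype.card t + 1))
      (fun i _ => ?_) (η := δ / 4) (by positivity)).mono ?_
    · by_cases hy : y ∈ tsupport (φ i)
      · have := (hgD i y (hφ i hy)).smul (φ := fun y => ((φ i y : ℝ) : ℂ)) (hcont i).continuousAt hc
        rwa [hnorm] at this
      · refine ApproxAt.of_eventually_zero hq
          (add_pos_of_nonneg_of_pos (mul_nonneg (φ.nonneg i y) (by positivity)) hc) ?_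
        filter_upwards [(isClosed_tsupport (φ i)).isOpen_compl.mem_nhds hy] with z hz
        rw [hoff i z hz, zero_smul]
    · rw [Finset.sum_add_distrib, ← Finset.sum_mul, Finset.sum_const, nsmul_eq_mul,
        Finset.card_univ]
      have h1 := mul_le_mul_of_nonneg_right (hsum y) (show 0 ≤ δ / 2 / 2 by positivity)
      have h2 : (Fintype.card t : ℝ) * (δ / 4 / (Fintype.card t + 1)) ≤ δ / 4 := by
        rw [← mul_div_assoc, div_le_iff₀ (by positivity)]
        nlinarith
      linarith
  · have hfy : f y = ∑ i, ((φ i y : ℝ) : ℂ) • f y := by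
      by_cases hy : y ∈ K
      · rw [← Finset.sum_smul, ← Complex.ofReal_sum, ← finsum_eq_sum_of_fintype,
          φ.sum_eq_one hy, Complex.ofReal_one, one_smul]
      · simp [hfK y hy]
    rw [hfy, Finset.sum_apply, ← Finset.sum_sub_distrib]
    calc ‖∑ i, (((φ i y : ℝ) : ℂ) • g i y - ((φ i y : ℝ) : ℂ) • f y)‖
        ≤ ∑ i, φ i y * ε := by
          refine norm_sum_le_of_le _ fun i _ => ?_
          rw [← smul_sub, norm_smul, hnorm]
          by_cases hy : y ∈ tsupport (φ i)
          · exact mul_le_mul_of_nonneg_left (hgf i y (hφ i hy)).le (φ.nonneg i y)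
          · rw [image_eq_zero_of_notMem_tsupport hy, zero_mul, zero_mul]
      _ ≤ 1 * ε := by
          rw [← Finset.sum_mul]
          exact mul_le_mul_of_nonneg_right (hsum y) hε.le
      _ = ε := one_mul ε
  · rw [Finset.sum_apply]
    refine Finset.sum_eq_zero fun i _ => ?_
    rw [hoff i y fun h => hy (Set.mem_iUnion.2 ⟨i, h⟩), zero_smul]

/-- Every fibre element is approximated by the value of a continuous section vanishing at
infinity. -/
theorem exists_section_near (hq : Continuous q) {y : Y} (b : Ω.Fib (q y)) {ε : ℝ} (hε : 0 < ε) :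
    ∃ F : ∀ y, Ω.Fib (q y), ‖F y - b‖ < ε ∧ (Continuous fun y => (F y).1) ∧
      ∀ η : ℝ, 0 < η → ∃ K : Set Y, IsCompact K ∧ ∀ z ∉ K, ‖F z‖ < η := by
  classical
  obtain ⟨U, hU, hbU, hthin⟩ := b.thin_nhds (half_pos (half_pos (half_pos hε)))
  obtain ⟨W, hWs, hW, hyW⟩ := eventually_nhds_iff.1
    (hq.continuousAt (b.eventually_exists (hU.mem_nhds hbU)))
  choose! g hg using hWs
  obtain ⟨φ, hφW, hφ1, hφ01, hφc⟩ := exists_continuous_sum_one_of_isOpen_isCompact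
    (n := 1) (s := fun _ => W) (fun _ => hW) (isCompact_singleton (x := y)) (by simpa using hyW)
  have hφy : φ 0 y = 1 := by simpa using hφ1 rfl
  have hcont : Continuous fun z => ((φ 0 z : ℝ) : ℂ) :=
    Complex.continuous_ofReal.comp (φ 0).continuous
  have hoff : ∀ z, z ∉ tsupport (φ 0) → ((φ 0 z : ℝ) : ℂ) • g z = 0 := fun z hz => by
    rw [image_eq_zero_of_notMem_tsupport hz, Complex.ofReal_zero, zero_smul]
  have hstart : ∀ z, ApproxAt (fun z => ((φ 0 z : ℝ) : ℂ) • g z) z (ε / 2 / 2 / 2 ^ 0) := fun z => by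
    by_cases hz : z ∈ tsupport (φ 0)
    · have hD : ApproxAt g z (ε / 2 / 2 / 2) := by
        refine ApproxAt.of_thin hq hU hthin ?_
        filter_upwards [hW.mem_nhds (hφW 0 hz)] with z' hz'
        exact hg z' hz'
      refine (hD.smul hcont.continuousAt (show 0 < ε / 2 / 2 / 2 by positivity)).mono ?_
      rw [Complex.norm_real, Real.norm_of_nonneg (hφ01 0 z).1]
      have := mul_le_mul_of_nonneg_right (hφ01 0 z).2 (show 0 ≤ ε / 2 / 2 / 2 by positivity)
      rw [pow_zero, div_one]
      linarith
    · refine ApproxAt.of_eventually_zero hq (by positivity) ?_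
      filter_upwards [(isClosed_tsupport (φ 0)).isOpen_compl.mem_nhds hz] with z' hz'
      exact hoff z' hz'
  obtain ⟨f, hf0, hf⟩ := exists_dependent_seq
    (P := fun n (f : ∀ y, Ω.Fib (q y)) => (∀ y, ApproxAt f y (ε / 2 / 2 / 2 ^ n)) ∧
      ∃ L : Set Y, IsCompact L ∧ ∀ y ∉ L, f y = 0)
    (R := fun n f f' => ∀ y, ‖f' y - f y‖ ≤ ε / 2 / 2 / 2 ^ n)
    (a := fun z => ((φ 0 z : ℝ) : ℂ) • g z) ⟨hstart, tsupport (φ 0), hφc 0, hoff⟩ (by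
      rintro n f ⟨hf, K, hK, hfK⟩
      obtain ⟨f', h1, h2, h3⟩ := exists_better_section hq hf (by positivity)
        (show 0 < ε / 2 / 2 / 2 ^ (n + 1) by positivity) hK hfK
      exact ⟨f', ⟨h1, h3⟩, h2⟩)
  obtain ⟨F, hF⟩ := exists_limit_section f fun n => (hf n).2
  have hlim : Tendsto (fun n : ℕ => ε / 2 / 2 ^ n) atTop (𝓝 0) := by
    simpa [div_eq_mul_inv] using
      (tendsto_pow_atTop_nhds_zero_of_lt_one (r := (2⁻¹ : ℝ)) (by norm_num) (by norm_num)).const_mul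
        (ε / 2)
  refine ⟨F, ?_, continuous_limit_section hq hlim (fun n z => ((hf n).1.1 z).mono ?_) hF,
    fun η hη => ?_⟩
  · have h0 := hF 0 y
    have h1 := hthin _ _ _ (hg y hyW) hbU
    rw [norm_sub_rev] at h0
    have h2 : f 0 y = g y := by simp [hf0, hφy]
    rw [h2] at h0
    have h3 := norm_add_le (F y - g y) (g y - b)
    rw [sub_add_sub_cancel] at h3
    norm_num at h0
    linarith
  · rw [div_right_comm]
    exact half_le_self (by positivity)
  · obtain ⟨n, hn⟩ := (hlim.eventually (gt_mem_nhds hη)).exists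
    obtain ⟨L, hL, hfL⟩ := (hf n).1.2
    refine ⟨L, hL, fun z hz => ?_⟩
    have h0 := hF n z
    rw [hfL z hz, zero_sub, norm_neg] at h0
    exact h0.trans_lt hn

end EnoughSections

end FellBundleData

theorem exists_norm_mul_sub_lt {B : Type*} [NonUnitalCStarAlgebra B] (a : B) {δ : ℝ}
    (hδ : 0 < δ) : ∃ e : B, ‖a * e - a‖ < δ := by
  let := CStarAlgebra.spectralOrder B
  have := CStarAlgebra.spectralOrderedRing B
  have h := (CStarAlgebra.increasingApproximateUnit B).tendsto_mul_left a
  have := (CStarAlgebra.increasingApproximateUnit B).neBot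
  obtain ⟨e, he⟩ := (h.eventually (Metric.ball_mem_nhds a hδ)).exists
  exact ⟨e, by rwa [dist_eq_norm] at he⟩

theorem exists_norm_mul_sub_lt' {B : Type*} [NonUnitalCStarAlgebra B] (a : B) {δ : ℝ}
    (hδ : 0 < δ) : ∃ e : B, ‖e * a - a‖ < δ := by
  obtain ⟨e, he⟩ := exists_norm_mul_sub_lt (star a) hδ
  refine ⟨star e, ?_⟩
  rwa [← norm_star, star_sub, star_mul, star_star]

theorem LCGroupoid.continuous_rng (Γ : LCGroupoid) : Continuous Γ.rng := by
  have h : Continuous fun x : Γ.G =>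
      (⟨(x, Γ.ginv x), (Γ.rng_ginv x).symm⟩ : {q : Γ.G × Γ.G // Γ.src q.1 = Γ.rng q.2}) :=
    (continuous_id.prodMk Γ.cont_ginv).subtype_mk _
  simpa [Function.comp_def, Γ.gmul_ginv] using Γ.cont_gmul.comp h

instance (Γ : LCGroupoid) : T2Space Γ.G := Γ.t2G

instance (Γ : LCGroupoid) : T2Space Γ.UnitSpace :=
  inferInstanceAs (T2Space {u : Γ.G // Γ.rng u = u})

instance (Γ : LCGroupoid) : LocallyCompactSpace Γ.UnitSpace :=
  haveI := Γ.lcG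
  (isClosed_eq Γ.continuous_rng continuous_id).isClosedEmbedding_subtypeVal.locallyCompactSpace

namespace FellBundleData

section Ideals

variable {Ω : FellBundleData}

theorem continuous_unit_val : Continuous fun u : Ω.toLCGroupoid.UnitSpace => u.1 :=
  continuous_subtype_val

instance (u : Ω.toLCGroupoid.UnitSpace) : Fact (Ω.rng u.1 = u.1) := ⟨u.2⟩

theorem isA_iff (σ : ∀ u : Ω.toLCGroupoid.UnitSpace, Ω.Fib u.1) :
    Ω.IsA (fun u => (σ u).1) ↔ (Continuous fun u => (σ u).1) ∧ ∀ ε : ℝ, 0 < ε →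
      ∃ K : Set Ω.toLCGroupoid.UnitSpace, IsCompact K ∧ ∀ u ∉ K, ‖σ u‖ < ε :=
  ⟨fun h => h.2, fun h => ⟨fun u => (σ u).2, h⟩⟩

theorem IsA.smul {σ : ∀ u : Ω.toLCGroupoid.UnitSpace, Ω.Fib u.1}
    (hσ : Ω.IsA fun u => (σ u).1) {φ : Ω.toLCGroupoid.UnitSpace → ℂ} (hφ : Continuous φ)
    (hφ1 : ∀ u, ‖φ u‖ ≤ 1) : Ω.IsA fun u => (φ u • σ u).1 := by
  rw [isA_iff (fun u => φ u • σ u)]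
  rw [isA_iff] at hσ
  refine ⟨Ω.cont_bsmul.comp (hφ.prodMk hσ.1), fun ε hε => ?_⟩
  obtain ⟨K, hK, h⟩ := hσ.2 ε hε
  refine ⟨K, hK, fun u hu => lt_of_le_of_lt ?_ (h u hu)⟩
  rw [norm_smul]
  exact mul_le_of_le_one_left (norm_nonneg _) (hφ1 u)

theorem exists_isA_near {u : Ω.toLCGroupoid.UnitSpace} (b : Ω.Fib u.1) {ε : ℝ} (hε : 0 < ε) :
    ∃ τ : ∀ u : Ω.toLCGroupoid.UnitSpace, Ω.Fib u.1, (Ω.IsA fun u => (τ u).1) ∧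
      ‖τ u - b‖ < ε := by
  obtain ⟨τ, h1, h2⟩ := exists_section_near continuous_unit_val b hε
  exact ⟨τ, (isA_iff τ).2 h2, h1⟩

variable {J : Set (Ω.toLCGroupoid.UnitSpace → Ω.T)}

theorem IsIdealA.exists_better (hJ : Ω.IsIdealA J) {u : Ω.toLCGroupoid.UnitSpace}
    {b : Ω.Fib u.1}
    (hb : ∀ ε : ℝ, 0 < ε → ∃ ρ : ∀ u : Ω.toLCGroupoid.UnitSpace, Ω.Fib u.1,
      (fun u => (ρ u).1) ∈ J ∧ ‖ρ u - b‖ < ε)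
    {ε : ℝ} (hε : 0 < ε) {σ : ∀ u : Ω.toLCGroupoid.UnitSpace, Ω.Fib u.1}
    (hσ : (fun u => (σ u).1) ∈ J) (hσb : ‖σ u - b‖ < ε) :
    ∃ σ' : ∀ u : Ω.toLCGroupoid.UnitSpace, Ω.Fib u.1, (fun u => (σ' u).1) ∈ J ∧
      ‖σ' u - b‖ < ε / 2 ∧ ∀ z, ‖σ' z - σ z‖ ≤ 2 * ε := by
  obtain ⟨hJA, hJ0, hJadd, hJsmul, hJmul, hJcl⟩ := hJ
  obtain ⟨ρ, hρ, hρb⟩ := hb (ε / 8) (by positivity)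
  have hη : (fun u => (ρ u - σ u).1) ∈ J := by
    simp_rw [Fib.sub_val]
    exact hJadd _ hρ _ (hJsmul (-1) _ hσ)
  have hηu : ‖ρ u - σ u‖ < ε + ε / 8 := by
    have := norm_sub_le (ρ u - b) (σ u - b)
    rw [sub_sub_sub_cancel_right] at this
    linarith
  obtain ⟨e, he⟩ := exists_norm_mul_sub_lt (ρ u - σ u) (show 0 < ε / 8 by positivity)
  obtain ⟨τ, hτ, hτe⟩ := exists_isA_near e (show 0 < 1 / 16 by norm_num)
  have hu : ‖(ρ u - σ u) * τ u - (ρ u - σ u)‖ < ε / 4 := by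
    have h1 : ‖(ρ u - σ u) * (τ u - e)‖ ≤ (ε + ε / 8) * (1 / 16) :=
      (norm_mul_le _ _).trans (mul_le_mul hηu.le hτe.le (norm_nonneg _) (by positivity))
    have h2 := norm_add_le ((ρ u - σ u) * (τ u - e)) ((ρ u - σ u) * e - (ρ u - σ u))
    rw [mul_sub, sub_add_sub_cancel, ← mul_sub] at h2
    linarith
  have hu2 : ‖(ρ u - σ u) * τ u‖ < 2 * ε := by
    have := norm_add_le ((ρ u - σ u) * τ u - (ρ u - σ u)) (ρ u - σ u)
    rw [sub_add_cancel] at this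
    linarith
  have hprod := (hJA _ (hJmul _ hη _ hτ).1).2.1
  have hopen : IsOpen {z | ‖(ρ z - σ z) * τ z‖ < 2 * ε} :=
    (Ω.usc_bnorm.isOpen_preimage (2 * ε)).preimage hprod
  obtain ⟨φ, hφ1, hφ0, hφc, hφ01⟩ := exists_continuous_one_zero_of_isCompact
    (isCompact_singleton (x := u)) hopen.isClosed_compl (by simpa using hu2)
  have hφn : ∀ z, ‖((φ z : ℝ) : ℂ)‖ = φ z := fun z => by
    rw [Complex.norm_real, Real.norm_of_nonneg (hφ01 z).1]
  have hφτ := hτ.smul (φ := fun z => ((φ z : ℝ) : ℂ))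
    (Complex.continuous_ofReal.comp φ.continuous) fun z => (hφn z).le.trans (hφ01 z).2
  refine ⟨fun z => σ z + (ρ z - σ z) * (((φ z : ℝ) : ℂ) • τ z),
    hJadd _ hσ _ (hJmul _ hη _ hφτ).1, ?_, fun z => ?_⟩
  · have hφu : φ u = 1 := hφ1 rfl
    have h1 := norm_add_le ((ρ u - σ u) * τ u - (ρ u - σ u)) (ρ u - b)
    simp only [hφu, Complex.ofReal_one, one_smul]
    have h2 : σ u + (ρ u - σ u) * τ u - b =
      (ρ u - σ u) * τ u - (ρ u - σ u) + (ρ u - b) := by abel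
    rw [h2]
    linarith
  · rw [add_sub_cancel_left, mul_smul_comm, norm_smul, hφn]
    by_cases hz : ‖(ρ z - σ z) * τ z‖ < 2 * ε
    · exact (mul_le_of_le_one_left (norm_nonneg _) (hφ01 z).2).trans hz.le
    · rw [hφ0 hz, Pi.zero_apply, zero_mul]
      positivity

/-- The image of an ideal in a fibre is closed. -/
theorem IsIdealA.exists_eq (hJ : Ω.IsIdealA J) {u : Ω.toLCGroupoid.UnitSpace}
    {b : Ω.Fib u.1}
    (hb : ∀ ε : ℝ, 0 < ε → ∃ ρ : ∀ u : Ω.toLCGroupoid.UnitSpace, Ω.Fib u.1,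
      (fun u => (ρ u).1) ∈ J ∧ ‖ρ u - b‖ < ε) :
    ∃ σ : ∀ u : Ω.toLCGroupoid.UnitSpace, Ω.Fib u.1, (fun u => (σ u).1) ∈ J ∧ σ u = b := by
  obtain ⟨σ₀, h₀, h₀b⟩ := hb 1 one_pos
  obtain ⟨f, -, hf⟩ := exists_dependent_seq
    (P := fun n (σ : ∀ u : Ω.toLCGroupoid.UnitSpace, Ω.Fib u.1) =>
      (fun u => (σ u).1) ∈ J ∧ ‖σ u - b‖ < 1 / 2 ^ n)
    (R := fun n σ σ' => ∀ z, ‖σ' z - σ z‖ ≤ 4 / 2 / 2 ^ n) (a := σ₀) ⟨h₀, by simpa using h₀b⟩ (by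
      rintro n σ ⟨hσ, hσb⟩
      obtain ⟨σ', h1, h2, h3⟩ := hJ.exists_better hb (by positivity) hσ hσb
      refine ⟨σ', ⟨h1, ?_⟩, fun z => (h3 z).trans_eq ?_⟩
      · rwa [pow_succ, ← div_div]
      · ring)
  obtain ⟨F, hF⟩ := exists_limit_section f fun n => (hf n).2
  have hlim : ∀ c : ℝ, Tendsto (fun n : ℕ => c / 2 ^ n) atTop (𝓝 0) := fun c => by
    simpa [div_eq_mul_inv] using
      (tendsto_pow_atTop_nhds_zero_of_lt_one (r := (2⁻¹ : ℝ)) (by norm_num) (by norm_num)).const_mul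
        c
  have hFA : Ω.IsA fun u => (F u).1 := by
    refine (isA_iff F).2 ⟨continuous_limit_section continuous_unit_val (hlim 4)
      (fun n z => ApproxAt.of_continuousAt ((hJ.1 _ (hf n).1.1).2.1.continuousAt) (by positivity))
      hF, fun ε hε => ?_⟩
    obtain ⟨n, hn⟩ := ((hlim 4).eventually (gt_mem_nhds (half_pos hε))).exists
    obtain ⟨K, hK, h⟩ := ((isA_iff _).1 (hJ.1 _ (hf n).1.1)).2 (ε / 2) (half_pos hε)
    refine ⟨K, hK, fun z hz => ?_⟩
    have h1 := norm_sub_norm_le (F z) (f n z)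
    rw [norm_sub_rev] at h1
    linarith [h z hz, hF n z]
  refine ⟨F, hJ.2.2.2.2.2 _ hFA fun ε hε => ?_, ?_⟩
  · obtain ⟨n, hn⟩ := ((hlim 4).eventually (gt_mem_nhds hε)).exists
    refine ⟨_, (hf n).1.1, fun z => ?_⟩
    rw [← Fib.norm_sub_def, norm_sub_rev]
    exact (hF n z).trans_lt hn
  · have h1 : Tendsto (fun n => f n u) atTop (𝓝 b) :=
      tendsto_iff_norm_sub_tendsto_zero.2
        (squeeze_zero (fun _ => norm_nonneg _) (fun n => (hf n).1.2.le) (hlim 1))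
    have h2 : Tendsto (fun n => f n u) atTop (𝓝 (F u)) :=
      tendsto_iff_norm_sub_tendsto_zero.2
        (squeeze_zero (fun _ => norm_nonneg _) (fun n => hF n u) (hlim 4))
    exact tendsto_nhds_unique h2 h1

end Ideals

end FellBundleData

namespace FellBundleData

section Spans

variable {Ω : FellBundleData} {x y z : Ω.G}

theorem isClosed_fiberSet (x : Ω.G) : IsClosed (Ω.fiberSet x) :=
  isClosed_singleton.preimage Ω.p_cont

theorem exists_fib_of_mem_spanIn {S : Set Ω.T} (hS : S ⊆ Ω.fiberSet x) {t : Ω.T}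
    (ht : t ∈ Ω.spanIn x S) :
    ∃ b ∈ Submodule.span ℂ {b : Ω.Fib x | b.1 ∈ S}, b.1 = t := by
  obtain ⟨l, hl, rfl⟩ := ht
  induction l with
  | nil => exact ⟨0, Submodule.zero_mem _, rfl⟩
  | cons a l ih =>
    obtain ⟨c, s, hs, rfl⟩ := hl a (by simp)
    obtain ⟨b, hb, hbl⟩ := ih fun a ha => hl a (by simp [ha])
    refine ⟨c • ⟨s, hS hs⟩ + b, Submodule.add_mem _
      (Submodule.smul_mem _ _ (Submodule.subset_span hs)) hb, ?_⟩
    rw [Fib.add_val, hbl]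
    rfl

theorem val_mem_spanIn {S : Set Ω.T} {b : Ω.Fib x}
    (hb : b ∈ Submodule.span ℂ {b : Ω.Fib x | b.1 ∈ S}) : b.1 ∈ Ω.spanIn x S := by
  rw [← Submodule.mem_toAddSubmonoid, Submodule.span_eq_closure] at hb
  obtain ⟨l, hl, rfl⟩ := AddSubmonoid.exists_list_of_mem_closure hb
  refine ⟨l.map Fib.val, fun a ha => ?_, ?_⟩
  · obtain ⟨b, hb, rfl⟩ := List.mem_map.1 ha
    obtain ⟨c, -, s, hs, rfl⟩ := Set.mem_smul.1 (hl b hb)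
    exact ⟨c, s.1, hs, rfl⟩
  · clear hl hb
    induction l with
    | nil => rfl
    | cons a l ih => rw [List.sum_cons, Fib.add_val, ih, List.map_cons, List.foldr_cons]

theorem mem_closedSpan_iff {S : Set Ω.T} (hS : S ⊆ Ω.fiberSet x) (b : Ω.Fib x) :
    b.1 ∈ Ω.closedSpan x S ↔
      b ∈ (Submodule.span ℂ {b : Ω.Fib x | b.1 ∈ S}).topologicalClosure := by
  have h : Ω.spanIn x S =
      Set.image Fib.val (Submodule.span ℂ {b : Ω.Fib x | b.1 ∈ S} : Set (Ω.Fib x)) := by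
    ext t
    refine ⟨exists_fib_of_mem_spanIn hS, ?_⟩
    rintro ⟨b, hb, rfl⟩
    exact val_mem_spanIn hb
  rw [← SetLike.mem_coe, Submodule.topologicalClosure_coe,
    Fib.isInducing_val.closure_eq_preimage_closure_image, closedSpan, h]
  rfl

theorem closedSpan_subset_fiberSet {S : Set Ω.T} (hS : S ⊆ Ω.fiberSet x) :
    Ω.closedSpan x S ⊆ Ω.fiberSet x := by
  refine closure_minimal (fun t ht => ?_) (isClosed_fiberSet x)
  obtain ⟨b, -, rfl⟩ := exists_fib_of_mem_spanIn hS ht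
  exact b.2

/-- A closed subspace containing the generators contains the closed span. -/
theorem closedSpan_induction {S : Set Ω.T} (hS : S ⊆ Ω.fiberSet x) (C : Submodule ℂ (Ω.Fib x))
    (hC : IsClosed (C : Set (Ω.Fib x))) (h : ∀ b : Ω.Fib x, b.1 ∈ S → b ∈ C) {b : Ω.Fib x}
    (hb : b.1 ∈ Ω.closedSpan x S) : b ∈ C :=
  Submodule.topologicalClosure_minimal _ (Submodule.span_le.2 h) hC
    ((mem_closedSpan_iff hS b).1 hb)

/-- The closed span as a subspace of the fibre. -/
theorem exists_submodule_closedSpan {S : Set Ω.T} (hS : S ⊆ Ω.fiberSet x) :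
    ∃ C : Submodule ℂ (Ω.Fib x), IsClosed (C : Set (Ω.Fib x)) ∧
      (∀ b : Ω.Fib x, b.1 ∈ S → b ∈ C) ∧ ∀ b ∈ C, b.1 ∈ Ω.closedSpan x S :=
  ⟨_, Submodule.isClosed_topologicalClosure _,
    fun _ hb => Submodule.le_topologicalClosure _ (Submodule.subset_span hb),
    fun b hb => (mem_closedSpan_iff hS b).2 hb⟩

theorem src_p_bmul {a b : Ω.T} (h : Ω.src (Ω.p a) = Ω.rng (Ω.p b)) :
    Ω.src (Ω.p (Ω.bmul a b)) = Ω.src (Ω.p b) := by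
  rw [Ω.p_bmul _ _ h, Ω.src_gmul _ _ h]

theorem rng_p_bmul {a b : Ω.T} (h : Ω.src (Ω.p a) = Ω.rng (Ω.p b)) :
    Ω.rng (Ω.p (Ω.bmul a b)) = Ω.rng (Ω.p a) := by
  rw [Ω.p_bmul _ _ h, Ω.rng_gmul _ _ h]

theorem src_p_bstar (a : Ω.T) : Ω.src (Ω.p (Ω.bstar a)) = Ω.rng (Ω.p a) := by
  rw [Ω.p_bstar, Ω.src_ginv]

theorem rng_p_bstar (a : Ω.T) : Ω.rng (Ω.p (Ω.bstar a)) = Ω.src (Ω.p a) := by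
  rw [Ω.p_bstar, Ω.rng_ginv]

/-- Left multiplication by a fibre element. -/
def Fib.mulLeft (h : Ω.src x = Ω.rng y) (hz : Ω.gmul x y = z) (a : Ω.Fib x) :
    Ω.Fib y →L[ℂ] Ω.Fib z where
  toFun b := ⟨Ω.bmul a.1 b.1, by rw [Ω.p_bmul _ _ (by rw [a.2, b.2, h]), a.2, b.2, hz]⟩
  map_add' b c := Fib.ext (Ω.badd_bmul _ _ _ (b.p_eq c) (by rw [a.2, b.2, h]))
  map_smul' k b := Fib.ext (Ω.bmul_bsmul _ _ _ (by rw [a.2, b.2, h]))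
  cont := Fib.isInducing_val.continuous_iff.2 (Ω.cont_bmul.comp
    ((continuous_const.prodMk Fib.continuous_val).subtype_mk fun b : Ω.Fib y =>
      (show Ω.src (Ω.p a.1) = Ω.rng (Ω.p b.1) by rw [a.2, b.2, h])))

/-- Right multiplication by a fibre element. -/
def Fib.mulRight (h : Ω.src x = Ω.rng y) (hz : Ω.gmul x y = z) (b : Ω.Fib y) :
    Ω.Fib x →L[ℂ] Ω.Fib z where
  toFun a := ⟨Ω.bmul a.1 b.1, by rw [Ω.p_bmul _ _ (by rw [a.2, b.2, h]), a.2, b.2, hz]⟩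
  map_add' a c := Fib.ext (Ω.bmul_badd _ _ _ (a.p_eq c) (by rw [a.2, b.2, h]))
  map_smul' k a := Fib.ext (Ω.bsmul_bmul _ _ _ (by rw [a.2, b.2, h]))
  cont := Fib.isInducing_val.continuous_iff.2 (Ω.cont_bmul.comp
    ((Fib.continuous_val.prodMk continuous_const).subtype_mk fun a : Ω.Fib x =>
      (show Ω.src (Ω.p a.1) = Ω.rng (Ω.p b.1) by rw [a.2, b.2, h])))

instance : Fact (Ω.rng (Ω.rng x) = Ω.rng x) := ⟨Ω.rng_rng x⟩
instance : Fact (Ω.rng (Ω.src x) = Ω.src x) := ⟨Ω.rng_src x⟩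

section FibreIdeal

variable {I : Set (Ω.toLCGroupoid.UnitSpace → Ω.T)} {u : Ω.G}

theorem IsIdealA.fiberIm_subset (hI : Ω.IsIdealA I) {t : Ω.T} (ht : t ∈ Ω.fiberIm I u) :
    Ω.p t = u := by
  obtain ⟨σ, hσ, h, rfl⟩ := ht
  exact (hI.1 σ hσ).1 _

variable [hu : Fact (Ω.rng u = u)]

theorem IsIdealA.mem_fiberIm_iff (hI : Ω.IsIdealA I) (b : Ω.Fib u) :
    b.1 ∈ Ω.fiberIm I u ↔ ∃ σ : ∀ u : Ω.toLCGroupoid.UnitSpace, Ω.Fib u.1,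
      (fun u => (σ u).1) ∈ I ∧ σ ⟨u, hu.out⟩ = b := by
  constructor
  · rintro ⟨σ, hσ, h, hb⟩
    exact ⟨fun u => ⟨σ u, (hI.1 σ hσ).1 u⟩, hσ, Fib.ext hb.symm⟩
  · rintro ⟨σ, hσ, rfl⟩
    exact ⟨_, hσ, hu.out, rfl⟩

/-- The image of an ideal in a unit fibre, as a subspace. -/
def IsIdealA.fib (hI : Ω.IsIdealA I) (u : Ω.G) [hu : Fact (Ω.rng u = u)] :
    Submodule ℂ (Ω.Fib u) where
  carrier := {b | b.1 ∈ Ω.fiberIm I u}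
  zero_mem' := ⟨_, hI.2.1, hu.out, rfl⟩
  add_mem' := by
    rintro a b ⟨σ, hσ, h, ha⟩ ⟨τ, hτ, _, hb⟩
    exact ⟨_, hI.2.2.1 _ hσ _ hτ, h, by rw [Fib.add_val, ha, hb]⟩
  smul_mem' := by
    rintro c a ⟨σ, hσ, h, ha⟩
    exact ⟨_, hI.2.2.2.1 c _ hσ, h, by rw [Fib.smul_val, ha]⟩

theorem IsIdealA.mem_fib (hI : Ω.IsIdealA I) (b : Ω.Fib u) :
    b ∈ hI.fib u ↔ b.1 ∈ Ω.fiberIm I u := Iff.rfl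

theorem IsIdealA.isClosed_fib (hI : Ω.IsIdealA I) : IsClosed (hI.fib u : Set (Ω.Fib u)) := by
  refine isClosed_of_closure_subset fun b hb => ?_
  refine (hI.mem_fiberIm_iff b).2 (hI.exists_eq (u := ⟨u, hu.out⟩) fun ε hε => ?_)
  obtain ⟨c, hc, hbc⟩ := Metric.mem_closure_iff.1 hb ε hε
  obtain ⟨ρ, hρ, rfl⟩ := (hI.mem_fiberIm_iff c).1 hc
  exact ⟨ρ, hρ, by rwa [← dist_eq_norm, dist_comm]⟩

theorem IsIdealA.mul_mem_fib (hI : Ω.IsIdealA I) (b : Ω.Fib u) {d : Ω.Fib u}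
    (hd : d ∈ hI.fib u) : b * d ∈ hI.fib u := by
  obtain ⟨σ, hσ, rfl⟩ := (hI.mem_fiberIm_iff d).1 hd
  refine hI.isClosed_fib.closure_subset (Metric.mem_closure_iff.2 fun ε hε => ?_)
  obtain ⟨τ, hτ, hτb⟩ := exists_isA_near (u := ⟨u, hu.out⟩) b
    (show 0 < ε / (‖σ ⟨u, hu.out⟩‖ + 1) by positivity)
  refine ⟨τ ⟨u, hu.out⟩ * σ ⟨u, hu.out⟩,
    (hI.mem_fiberIm_iff _).2 ⟨fun z => τ z * σ z, (hI.2.2.2.2.1 _ hσ _ hτ).2, rfl⟩, ?_⟩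
  rw [dist_comm, dist_eq_norm, ← sub_mul]
  refine (norm_mul_le _ _).trans_lt ?_
  rw [lt_div_iff₀ (by positivity)] at hτb
  nlinarith [norm_nonneg (τ ⟨u, hu.out⟩ - b)]

theorem IsIdealA.fib_mul_mem (hI : Ω.IsIdealA I) (b : Ω.Fib u) {d : Ω.Fib u}
    (hd : d ∈ hI.fib u) : d * b ∈ hI.fib u := by
  obtain ⟨σ, hσ, rfl⟩ := (hI.mem_fiberIm_iff d).1 hd
  refine hI.isClosed_fib.closure_subset (Metric.mem_closure_iff.2 fun ε hε => ?_)
  obtain ⟨τ, hτ, hτb⟩ := exists_isA_near (u := ⟨u, hu.out⟩) b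
    (show 0 < ε / (‖σ ⟨u, hu.out⟩‖ + 1) by positivity)
  refine ⟨σ ⟨u, hu.out⟩ * τ ⟨u, hu.out⟩,
    (hI.mem_fiberIm_iff _).2 ⟨fun z => σ z * τ z, (hI.2.2.2.2.1 _ hσ _ hτ).1, rfl⟩, ?_⟩
  rw [dist_comm, dist_eq_norm, ← mul_sub]
  refine (norm_mul_le _ _).trans_lt ?_
  rw [lt_div_iff₀ (by positivity)] at hτb
  nlinarith [norm_nonneg (τ ⟨u, hu.out⟩ - b)]

end FibreIdeal

end Spans

end FellBundleData

namespace FellBundleData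

section Rieffel

variable {Ω : FellBundleData} {x u : Ω.G}

theorem mem_of_mul_mem_left [Fact (Ω.rng u = u)] {C : Submodule ℂ (Ω.Fib u)}
    (hC : IsClosed (C : Set (Ω.Fib u))) {d : Ω.Fib u} (h : ∀ e, e * d ∈ C) : d ∈ C := by
  refine hC.closure_subset (Metric.mem_closure_iff.2 fun ε hε => ?_)
  obtain ⟨e, he⟩ := exists_norm_mul_sub_lt' d hε
  exact ⟨e * d, h e, by rwa [dist_comm, dist_eq_norm]⟩

theorem mem_of_mul_mem_right [Fact (Ω.rng u = u)] {C : Submodule ℂ (Ω.Fib u)}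
    (hC : IsClosed (C : Set (Ω.Fib u))) {d : Ω.Fib u} (h : ∀ e, d * e ∈ C) : d ∈ C := by
  refine hC.closure_subset (Metric.mem_closure_iff.2 fun ε hε => ?_)
  obtain ⟨e, he⟩ := exists_norm_mul_sub_lt d hε
  exact ⟨d * e, h e, by rwa [dist_comm, dist_eq_norm]⟩

/-- An element of a unit fibre lying in all primitive ideals above `I(u)` lies in `I(u)`. -/
theorem IsIdealA.mem_of_forall_prim {I : Set (Ω.toLCGroupoid.UnitSpace → Ω.T)}
    (hI : Ω.IsIdealA I) [hu : Fact (Ω.rng u = u)] (c : Ω.Fib u)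
    (h : ∀ P ∈ Ω.PrimFiber u, Ω.fiberIm I u ⊆ P → c.1 ∈ P) : c.1 ∈ Ω.fiberIm I u := by
  classical
  by_contra hc
  obtain ⟨H, iN, iP, iC, π, hπ0, hπc, hπ⟩ := exists_irreducible_rep (hI.fib u) hI.isClosed_fib
    (fun a j hj => hI.mul_mem_fib a hj) (fun a j hj => hI.fib_mul_mem a hj) c hc
  let ρ : Ω.T → H →L[ℂ] H := fun t => if h : Ω.p t = u then π ⟨t, h⟩ else 0
  have hρ : ∀ b : Ω.Fib u, ρ b.1 = π b := fun b => dif_pos b.2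
  refine hπc ((hρ c).symm.trans (h {a | Ω.p a = u ∧ ρ a = 0}
    ⟨hu.out, H, iN, iP, iC, ρ, ⟨⟨?_, ?_, ?_, ?_, ?_⟩, ⟨c.1, c.2, ?_⟩, ?_⟩, rfl⟩ ?_).2)
  · intro a b ha hb
    exact (hρ (⟨a, ha⟩ + ⟨b, hb⟩)).trans
      ((map_add π _ _).trans (congrArg₂ _ (hρ ⟨a, ha⟩).symm (hρ ⟨b, hb⟩).symm))
  · intro k a ha
    exact (hρ (k • ⟨a, ha⟩)).trans
      ((map_smul π _ _).trans (congrArg _ (hρ ⟨a, ha⟩).symm))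
  · intro a b ha hb
    exact (hρ (⟨a, ha⟩ * ⟨b, hb⟩)).trans
      ((map_mul π _ _).trans (congrArg₂ (· * ·) (hρ ⟨a, ha⟩).symm (hρ ⟨b, hb⟩).symm))
  · intro a ha
    have h1 : ρ a = π ⟨a, ha⟩ := hρ ⟨a, ha⟩
    have h2 : ρ (Ω.bstar a) = π (star ⟨a, ha⟩) := hρ (star ⟨a, ha⟩)
    rw [h1, h2, map_star, ContinuousLinearMap.star_eq_adjoint]
  · intro a ha
    have h1 : ρ a = π ⟨a, ha⟩ := hρ ⟨a, ha⟩
    rw [h1]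
    exact NonUnitalStarAlgHom.norm_apply_le π ⟨a, ha⟩
  · rwa [hρ]
  · exact fun K hK hinv => hπ K hK fun b v hv => by
      have := hinv b.1 b.2 v hv
      rwa [hρ] at this
  · intro t ht
    have htu := hI.fiberIm_subset ht
    exact ⟨htu, (hρ ⟨t, htu⟩).trans (hπ0 _ ht)⟩

/-- A primitive ideal of a unit fibre is a closed two-sided ideal. -/
theorem exists_submodule_of_mem_primFiber [hu : Fact (Ω.rng u = u)] {P : Set Ω.T}
    (hP : P ∈ Ω.PrimFiber u) :
    ∃ Q : Submodule ℂ (Ω.Fib u), IsClosed (Q : Set (Ω.Fib u)) ∧ (∀ b : Ω.Fib u, b ∈ Q ↔ b.1 ∈ P) ∧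
      ∀ a, ∀ d ∈ Q, a * d ∈ Q ∧ d * a ∈ Q := by
  obtain ⟨-, H, iN, iP, iC, π, ⟨⟨hadd, hsmul, hmul, -, hnorm⟩, -, -⟩, rfl⟩ := hP
  let L : Ω.Fib u →L[ℂ] H →L[ℂ] H := LinearMap.mkContinuous
    { toFun := fun b => π b.1
      map_add' := fun a b => hadd _ _ a.2 b.2
      map_smul' := fun c a => hsmul _ _ a.2 } 1 fun b => by
        rw [one_mul]
        exact hnorm _ b.2
  have hL : ∀ a b, L (a * b) = (L a).comp (L b) := fun a b => hmul _ _ a.2 b.2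
  refine ⟨L.ker, L.isClosed_ker, fun b => ⟨fun h => ⟨b.2, h⟩, fun h => h.2⟩,
    fun a d hd => ⟨?_, ?_⟩⟩
  · have hd : L d = 0 := hd
    show L (a * d) = 0
    rw [hL, hd, ContinuousLinearMap.comp_zero]
  · have hd : L d = 0 := hd
    show L (d * a) = 0
    rw [hL, hd, ContinuousLinearMap.zero_comp]

theorem hIdeal_generators_subset {J : Set Ω.T} (hJ : J ⊆ Ω.fiberSet (Ω.src x)) :
    {t | ∃ a b d, Ω.p a = x ∧ Ω.p b = x ∧ d ∈ J ∧ t = Ω.bmul (Ω.bmul a d) (Ω.bstar b)} ⊆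
      Ω.fiberSet (Ω.rng x) := by
  rintro t ⟨a, b, d, ha, hb, hd, rfl⟩
  have hd := hJ hd
  have h1 : Ω.src (Ω.p a) = Ω.rng (Ω.p d) := by rw [ha, hd, Ω.rng_src]
  have h2 : Ω.p (Ω.bmul a d) = x := by rw [Ω.p_bmul _ _ h1, ha, hd, Ω.gmul_src]
  show Ω.p _ = _
  rw [Ω.p_bmul _ _ (by rw [h2, rng_p_bstar, hb]), h2, Ω.p_bstar, hb, Ω.gmul_ginv]

theorem GInvariant.star_mul_mem {I : Set (Ω.toLCGroupoid.UnitSpace → Ω.T)}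
    (hI : Ω.GInvariant I) {b b' d : Ω.T} (hb : Ω.p b = x) (hb' : Ω.p b' = x)
    (hd : d ∈ Ω.fiberIm I (Ω.rng x)) :
    Ω.bmul (Ω.bstar b) (Ω.bmul d b') ∈ Ω.fiberIm I (Ω.src x) := by
  have hdr := hI.1.fiberIm_subset hd
  let L : Ω.Fib (Ω.rng x) →L[ℂ] Ω.Fib (Ω.src x) :=
    (Fib.mulLeft (Ω.src_ginv x) (Ω.ginv_gmul x)
      ⟨Ω.bstar b, by rw [Ω.p_bstar, hb]⟩).comp
    (Fib.mulRight (Ω.src_rng x) (Ω.gmul_rng x) ⟨b', hb'⟩)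
  have hL : ∀ d, (L d).1 = Ω.bmul (Ω.bstar b) (Ω.bmul d.1 b') := fun _ => rfl
  refine hI.1.mem_of_forall_prim (L ⟨d, hdr⟩) fun P hP hIP => ?_
  obtain ⟨Q, hQc, hQP, hQ⟩ := exists_submodule_of_mem_primFiber hP
  have hPs : P ⊆ Ω.fiberSet (Ω.src x) := by
    obtain ⟨-, _, _, _, _, _, _, rfl⟩ := hP
    exact fun _ h => h.1
  rw [← hQP]
  refine closedSpan_induction (hIdeal_generators_subset hPs) (Q.comap L.toLinearMap)
    (hQc.preimage L.continuous) (fun e he => ?_) (hI.2 x P hP hIP hd)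
  obtain ⟨a, c, f, ha, hc, hf, he⟩ := he
  have hf' : Ω.p f = Ω.src x := hPs hf
  let m : Ω.Fib (Ω.src x) := Fib.mulLeft (Ω.src_ginv x) (Ω.ginv_gmul x)
    ⟨Ω.bstar b, by rw [Ω.p_bstar, hb]⟩ ⟨a, ha⟩
  let n : Ω.Fib (Ω.src x) := Fib.mulLeft (Ω.src_ginv x) (Ω.ginv_gmul x)
    ⟨Ω.bstar c, by rw [Ω.p_bstar, hc]⟩ ⟨b', hb'⟩
  have key : L e = m * (⟨f, hf'⟩ * n) := by
    apply Fib.ext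
    show Ω.bmul (Ω.bstar b) (Ω.bmul e.1 b') =
      Ω.bmul (Ω.bmul (Ω.bstar b) a) (Ω.bmul f (Ω.bmul (Ω.bstar c) b'))
    have h1 : Ω.src (Ω.p a) = Ω.rng (Ω.p f) := by rw [ha, hf', Ω.rng_src]
    have h2 : Ω.src (Ω.p f) = Ω.rng (Ω.p (Ω.bstar c)) := by
      rw [rng_p_bstar, hf', hc, Ω.src_src]
    have h3 : Ω.src (Ω.p (Ω.bstar c)) = Ω.rng (Ω.p b') := by rw [src_p_bstar, hc, hb']
    have h4 : Ω.src (Ω.p (Ω.bstar b)) = Ω.rng (Ω.p a) := by rw [src_p_bstar, hb, ha]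
    rw [he, Ω.bmul_assoc (Ω.bmul a f) _ _ (by rw [src_p_bmul h1, h2]) h3,
      Ω.bmul_assoc a f _ h1 (by rw [rng_p_bmul h3, h2]),
      Ω.bmul_assoc _ a _ h4 (by rw [rng_p_bmul (by rw [rng_p_bmul h3, h2]), h1])]
  show L e ∈ Q
  rw [key]
  exact (hQ _ _ (hQ _ _ ((hQP _).2 hf)).2).1

theorem GInvariant.mul_star_mem {I : Set (Ω.toLCGroupoid.UnitSpace → Ω.T)}
    (hI : Ω.GInvariant I) {b b' d : Ω.T} (hb : Ω.p b = x) (hb' : Ω.p b' = x)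
    (hd : d ∈ Ω.fiberIm I (Ω.src x)) :
    Ω.bmul b (Ω.bmul d (Ω.bstar b')) ∈ Ω.fiberIm I (Ω.rng x) := by
  have h := hI.star_mul_mem (x := Ω.ginv x) (b := Ω.bstar b) (b' := Ω.bstar b') (d := d)
    (by rw [Ω.p_bstar, hb]) (by rw [Ω.p_bstar, hb']) (by rwa [Ω.rng_ginv])
  rwa [Ω.bstar_bstar, Ω.src_ginv] at h

end Rieffel

end FellBundleData

namespace FellBundle

open FellBundleData

variable {Ω : FellBundle} {x : Ω.G}

/-- `B(x) B(x)*` is total in `B(r(x))`. -/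
theorem mem_of_mul_star_mem {C : Submodule ℂ (Ω.Fib (Ω.rng x))}
    (hC : IsClosed (C : Set (Ω.Fib (Ω.rng x))))
    (h : ∀ e : Ω.Fib (Ω.rng x), ∀ a b, Ω.p a = x → Ω.p b = x →
      e.1 = Ω.bmul a (Ω.bstar b) → e ∈ C) (e : Ω.Fib (Ω.rng x)) : e ∈ C := by
  have hs := Ω.saturated x (Ω.ginv x) (Ω.rng_ginv x).symm
  rw [Ω.gmul_ginv] at hs
  refine closedSpan_induction ?_ C hC ?_ (hs.ge e.2)
  · rintro t ⟨a, b, ha, hb, rfl⟩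
    show Ω.p _ = _
    rw [Ω.p_bmul _ _ (by rw [ha, hb, Ω.rng_ginv]), ha, hb, Ω.gmul_ginv]
  · rintro e ⟨a, b, ha, hb, he⟩
    refine h e a (Ω.bstar b) ha (by rw [Ω.p_bstar, hb, Ω.ginv_ginv]) ?_
    rw [he, Ω.bstar_bstar]

/-- `B(x)* B(x)` is total in `B(s(x))`. -/
theorem mem_of_star_mul_mem {C : Submodule ℂ (Ω.Fib (Ω.src x))}
    (hC : IsClosed (C : Set (Ω.Fib (Ω.src x))))
    (h : ∀ e : Ω.Fib (Ω.src x), ∀ a b, Ω.p a = x → Ω.p b = x →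
      e.1 = Ω.bmul (Ω.bstar a) b → e ∈ C) (e : Ω.Fib (Ω.src x)) : e ∈ C := by
  have hs := Ω.saturated (Ω.ginv x) x (Ω.src_ginv x)
  rw [Ω.ginv_gmul] at hs
  refine closedSpan_induction ?_ C hC ?_ (hs.ge e.2)
  · rintro t ⟨a, b, ha, hb, rfl⟩
    show Ω.p _ = _
    rw [Ω.p_bmul _ _ (by rw [ha, hb, Ω.src_ginv]), ha, hb, Ω.ginv_gmul]
  · rintro e ⟨a, b, ha, hb, he⟩
    refine h e (Ω.bstar a) b (by rw [Ω.p_bstar, ha, Ω.ginv_ginv]) hb ?_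
    rw [he, Ω.bstar_bstar]

end FellBundle

namespace FellBundle

open FellBundleData

section Rieffel

variable {Ω : FellBundle} {x : Ω.G} {I : Set (Ω.toLCGroupoid.UnitSpace → Ω.T)}

theorem hIdeal_fiberIm_subset (hI : Ω.GInvariant I) :
    Ω.hIdeal x (Ω.fiberIm I (Ω.src x)) ⊆ Ω.fiberIm I (Ω.rng x) := by
  intro t ht
  have hS := hIdeal_generators_subset (x := x) (J := Ω.fiberIm I (Ω.src x))
    fun d hd => hI.1.fiberIm_subset hd
  refine closedSpan_induction hS (hI.1.fib (Ω.rng x)) hI.1.isClosed_fib ?_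
    (b := ⟨t, closedSpan_subset_fiberSet hS ht⟩) ht
  rintro e ⟨a, b, d, ha, hb, hd, he⟩
  have hds := hI.1.fiberIm_subset hd
  rw [hI.1.mem_fib, he, Ω.bmul_assoc _ _ _ (by rw [ha, hds, Ω.rng_src])
    (by rw [rng_p_bstar, hb, hds, Ω.src_src])]
  exact hI.mul_star_mem ha hb hd

theorem fiberIm_subset_hIdeal (hI : Ω.GInvariant I) :
    Ω.fiberIm I (Ω.rng x) ⊆ Ω.hIdeal x (Ω.fiberIm I (Ω.src x)) := by
  intro d hd
  have hdr := hI.1.fiberIm_subset hd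
  obtain ⟨C, hC, hSC, hCS⟩ := exists_submodule_closedSpan
    (hIdeal_generators_subset (x := x) (J := Ω.fiberIm I (Ω.src x))
      fun d hd => hI.1.fiberIm_subset hd)
  refine hCS ⟨d, hdr⟩ (mem_of_mul_mem_left hC fun e => ?_)
  refine mem_of_mul_star_mem (C := C.comap (LinearMap.mulRight ℂ ⟨d, hdr⟩))
    (hC.preimage (continuous_mul_const _)) (fun e a b ha hb he => ?_) e
  refine mem_of_mul_mem_right hC fun f => ?_
  refine mem_of_mul_star_mem (C := C.comap (LinearMap.mulLeft ℂ (e * ⟨d, hdr⟩)))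
    (hC.preimage (continuous_const_mul _)) (fun f a' b' ha' hb' hf => ?_) f
  refine hSC _ ⟨a, b', Ω.bmul (Ω.bstar b) (Ω.bmul d a'), ha, hb', hI.star_mul_mem hb ha' hd, ?_⟩
  show Ω.bmul (Ω.bmul e.1 d) f.1 = _
  have h1 : Ω.src (Ω.p a) = Ω.rng (Ω.p (Ω.bstar b)) := by rw [rng_p_bstar, ha, hb]
  have h2 : Ω.src (Ω.p (Ω.bstar b)) = Ω.rng (Ω.p d) := by rw [src_p_bstar, hb, hdr, Ω.rng_rng]
  have h3 : Ω.src (Ω.p d) = Ω.rng (Ω.p a') := by rw [hdr, ha', Ω.src_rng]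
  have h4 : Ω.src (Ω.p a') = Ω.rng (Ω.p (Ω.bstar b')) := by rw [rng_p_bstar, ha', hb']
  have h5 : Ω.src (Ω.p (Ω.bmul (Ω.bmul a (Ω.bstar b)) d)) = Ω.rng (Ω.p a') := by
    rw [src_p_bmul (by rw [src_p_bmul h1, h2]), h3]
  rw [he, hf, ← Ω.bmul_assoc _ d a' h2 h3,
    ← Ω.bmul_assoc a _ a' (by rw [rng_p_bmul h2, h1]) (by rw [src_p_bmul h2, h3]),
    ← Ω.bmul_assoc a _ d h1 h2, Ω.bmul_assoc _ _ _ h5 h4]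

theorem mul_fiberIm_subset_fiberSet (hI : Ω.IsIdealA I) :
    {t | ∃ b d, Ω.p b = x ∧ d ∈ Ω.fiberIm I (Ω.src x) ∧ t = Ω.bmul b d} ⊆ Ω.fiberSet x := by
  rintro t ⟨b, d, hb, hd, rfl⟩
  have hds := hI.fiberIm_subset hd
  show Ω.p _ = x
  rw [Ω.p_bmul _ _ (by rw [hb, hds, Ω.rng_src]), hb, hds, Ω.gmul_src]

theorem fiberIm_mul_subset_fiberSet (hI : Ω.IsIdealA I) :
    {t | ∃ d b, d ∈ Ω.fiberIm I (Ω.rng x) ∧ Ω.p b = x ∧ t = Ω.bmul d b} ⊆ Ω.fiberSet x := by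
  rintro t ⟨d, b, hd, hb, rfl⟩
  have hdr := hI.fiberIm_subset hd
  show Ω.p _ = x
  rw [Ω.p_bmul _ _ (by rw [hb, hdr, Ω.src_rng]), hb, hdr, Ω.gmul_rng]

theorem closedSpan_mul_fiberIm_subset (hI : Ω.GInvariant I) :
    Ω.closedSpan x {t | ∃ b d, Ω.p b = x ∧ d ∈ Ω.fiberIm I (Ω.src x) ∧ t = Ω.bmul b d} ⊆
      Ω.closedSpan x {t | ∃ d b, d ∈ Ω.fiberIm I (Ω.rng x) ∧ Ω.p b = x ∧ t = Ω.bmul d b} := by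
  intro t ht
  have hS := mul_fiberIm_subset_fiberSet (x := x) hI.1
  obtain ⟨C, hC, hSC, hCS⟩ := exists_submodule_closedSpan (fiberIm_mul_subset_fiberSet (x := x) hI.1)
  refine hCS ⟨t, closedSpan_subset_fiberSet hS ht⟩ (closedSpan_induction hS C hC ?_ ht)
  rintro e ⟨b, d, hb, hd, he⟩
  have hds := hI.1.fiberIm_subset hd
  let L : Ω.Fib (Ω.src x) →L[ℂ] Ω.Fib x :=
    Fib.mulLeft (Ω.rng_src x).symm (Ω.gmul_src x) ⟨b, hb⟩
  have hL : e = L ⟨d, hds⟩ := Fib.ext he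
  rw [hL]
  refine mem_of_mul_mem_right (C := C.comap L.toLinearMap) (hC.preimage L.continuous) fun f => ?_
  refine mem_of_star_mul_mem
    (C := (C.comap L.toLinearMap).comap (LinearMap.mulLeft ℂ ⟨d, hds⟩))
    ((hC.preimage L.continuous).preimage (continuous_const_mul _)) (fun f a c ha hc hf => ?_) f
  refine hSC _ ⟨Ω.bmul b (Ω.bmul d (Ω.bstar a)), c, hI.mul_star_mem hb ha hd, hc, ?_⟩
  show Ω.bmul b (Ω.bmul d f.1) = _
  have h1 : Ω.src (Ω.p b) = Ω.rng (Ω.p d) := by rw [hb, hds, Ω.rng_src]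
  have h2 : Ω.src (Ω.p d) = Ω.rng (Ω.p (Ω.bstar a)) := by rw [rng_p_bstar, ha, hds, Ω.src_src]
  have h3 : Ω.src (Ω.p (Ω.bstar a)) = Ω.rng (Ω.p c) := by rw [src_p_bstar, ha, hc]
  rw [hf, Ω.bmul_assoc b _ c (by rw [rng_p_bmul h2, h1]) (by rw [src_p_bmul h2, h3]),
    Ω.bmul_assoc d _ c h2 h3]

theorem closedSpan_fiberIm_mul_subset (hI : Ω.GInvariant I) :
    Ω.closedSpan x {t | ∃ d b, d ∈ Ω.fiberIm I (Ω.rng x) ∧ Ω.p b = x ∧ t = Ω.bmul d b} ⊆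
      Ω.closedSpan x {t | ∃ b d, Ω.p b = x ∧ d ∈ Ω.fiberIm I (Ω.src x) ∧ t = Ω.bmul b d} := by
  intro t ht
  have hS := fiberIm_mul_subset_fiberSet (x := x) hI.1
  obtain ⟨C, hC, hSC, hCS⟩ := exists_submodule_closedSpan (mul_fiberIm_subset_fiberSet (x := x) hI.1)
  refine hCS ⟨t, closedSpan_subset_fiberSet hS ht⟩ (closedSpan_induction hS C hC ?_ ht)
  rintro e ⟨d, b, hd, hb, he⟩
  have hdr := hI.1.fiberIm_subset hd
  let L : Ω.Fib (Ω.rng x) →L[ℂ] Ω.Fib x :=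
    Fib.mulRight (Ω.src_rng x) (Ω.gmul_rng x) ⟨b, hb⟩
  have hL : e = L ⟨d, hdr⟩ := Fib.ext he
  rw [hL]
  refine mem_of_mul_mem_left (C := C.comap L.toLinearMap) (hC.preimage L.continuous) fun f => ?_
  refine mem_of_mul_star_mem
    (C := (C.comap L.toLinearMap).comap (LinearMap.mulRight ℂ ⟨d, hdr⟩))
    ((hC.preimage L.continuous).preimage (continuous_mul_const _)) (fun f a c ha hc hf => ?_) f
  refine hSC _ ⟨a, Ω.bmul (Ω.bstar c) (Ω.bmul d b), ha, hI.star_mul_mem hc hb hd, ?_⟩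
  show Ω.bmul (Ω.bmul f.1 d) b = _
  have h1 : Ω.src (Ω.p a) = Ω.rng (Ω.p (Ω.bstar c)) := by rw [rng_p_bstar, ha, hc]
  have h2 : Ω.src (Ω.p (Ω.bstar c)) = Ω.rng (Ω.p d) := by rw [src_p_bstar, hc, hdr, Ω.rng_rng]
  have h3 : Ω.src (Ω.p d) = Ω.rng (Ω.p b) := by rw [hdr, hb, Ω.src_rng]
  rw [hf, Ω.bmul_assoc a _ d h1 h2, Ω.bmul_assoc a _ b (by rw [rng_p_bmul h2, h1])
    (by rw [src_p_bmul h2, h3]), Ω.bmul_assoc _ d b h2 h3]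

end Rieffel

end FellBundle

/-- Let `p : B → G` be a Fell bundle over a locally compact
Hausdorff groupoid, `A := Γ₀(G⁰; B)` and `I` a `G`-invariant ideal of `A`.  Then
for every `x ∈ G` the Rieffel correspondence on ideals satisfies
`h_x(I(s(x))) = I(r(x))`; in particular
`B(x) · I(s(x)) = I(r(x)) · B(x)` (closed linear spans of products in `B`). -/
theorem invariant_ideal_rieffel (Ω : FellBundle)
    (I : Set (Ω.toLCGroupoid.UnitSpace → Ω.T))
    (hI : Ω.toFellBundleData.GInvariant I) (x : Ω.G) :
    Ω.toFellBundleData.hIdeal x (Ω.toFellBundleData.fiberIm I (Ω.src x)) =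
        Ω.toFellBundleData.fiberIm I (Ω.rng x) ∧
      Ω.toFellBundleData.closedSpan x
          {t | ∃ b d, Ω.p b = x ∧ d ∈ Ω.toFellBundleData.fiberIm I (Ω.src x) ∧
            t = Ω.bmul b d} =
        Ω.toFellBundleData.closedSpan x
          {t | ∃ d b, d ∈ Ω.toFellBundleData.fiberIm I (Ω.rng x) ∧ Ω.p b = x ∧
            t = Ω.bmul d b} := by
  exact ⟨(FellBundle.hIdeal_fiberIm_subset hI).antisymm (FellBundle.fiberIm_subset_hIdeal hI),
    (FellBundle.closedSpan_mul_fiberIm_subset hI).antisymm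
      (FellBundle.closedSpan_fiberIm_mul_subset hI)⟩
end
end

section
/- Let p: B → G be a Fell bundle over a locally compact Hausdorff groupoid G, A := Γ₀(G⁰; B), and I an ideal of A. Then B_I := {b ∈ B : b*b ∈ I(s(b))} equals {b ∈ B : a*b ∈ I(s(b)) for all a ∈ B(p(b))}. In particular, every b ∈ B_I lies in B(p(b))·I(s(b)), the closed linear span of products c·d with c ∈ B(p(b)) and d ∈ I(s(b)). -/
noncomputable section

open Filter
open scoped Topology

namespace FellBundleData

variable (Ω : FellBundleData)

/-- The fibre `B(x)` as a type. -/
@[ext] structure Fiber (x : Ω.G) : Type where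
  /-- the underlying element of the total space -/
  val : Ω.T
  proj : Ω.p val = x

namespace Fiber

variable {Ω} {x : Ω.G}

instance : Zero (Ω.Fiber x) := ⟨⟨Ω.bzero x, Ω.p_bzero x⟩⟩
instance : Add (Ω.Fiber x) :=
  ⟨fun a b => ⟨Ω.badd a.1 b.1, (Ω.p_badd _ _ (a.2.trans b.2.symm)).trans a.2⟩⟩
instance : SMul ℂ (Ω.Fiber x) := ⟨fun c a => ⟨Ω.bsmul c a.1, (Ω.p_bsmul _ _).trans a.2⟩⟩
instance : Neg (Ω.Fiber x) := ⟨fun a => (-1 : ℂ) • a⟩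
instance : Norm (Ω.Fiber x) := ⟨fun a => Ω.bnorm a.1⟩

theorem p_eq (a b : Ω.Fiber x) : Ω.p a.1 = Ω.p b.1 := a.2.trans b.2.symm

theorem val_zero : (0 : Ω.Fiber x).1 = Ω.bzero x := rfl
theorem val_add (a b : Ω.Fiber x) : (a + b).1 = Ω.badd a.1 b.1 := rfl
theorem norm_def (a : Ω.Fiber x) : ‖a‖ = Ω.bnorm a.1 := rfl

theorem zero_add' (a : Ω.Fiber x) : 0 + a = a := by
  obtain ⟨a, rfl⟩ := a
  exact Fiber.ext (Ω.bzero_badd a)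

theorem add_comm' (a b : Ω.Fiber x) : a + b = b + a :=
  Fiber.ext (Ω.badd_comm _ _ (p_eq a b))

theorem neg_add' (a : Ω.Fiber x) : -a + a = 0 := by
  obtain ⟨a, rfl⟩ := a
  rw [add_comm']
  exact Fiber.ext (Ω.badd_neg a)

instance : AddCommGroup (Ω.Fiber x) where
  add_assoc a b c := Fiber.ext (Ω.badd_assoc _ _ _ (p_eq a b) (p_eq b c))
  zero_add := zero_add'
  add_zero a := by rw [add_comm', zero_add']
  nsmul := nsmulRec
  zsmul := zsmulRec
  neg_add_cancel := neg_add'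
  add_comm := add_comm'

instance : Module ℂ (Ω.Fiber x) where
  one_smul a := Fiber.ext (Ω.one_bsmul _)
  mul_smul c d a := Fiber.ext (Ω.mul_bsmul _ _ _)
  smul_zero c := Fiber.ext (Ω.bsmul_bzero _ _)
  smul_add c a b := Fiber.ext (Ω.bsmul_badd _ _ _ (p_eq a b))
  add_smul c d a := Fiber.ext (Ω.add_bsmul _ _ _)
  zero_smul a := by
    obtain ⟨a, rfl⟩ := a
    exact Fiber.ext (Ω.zero_bsmul a)

theorem core (x : Ω.G) : NormedSpace.Core ℂ (Ω.Fiber x) where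
  norm_nonneg a := Ω.bnorm_nonneg _
  norm_smul c a := Ω.bnorm_bsmul _ _
  norm_triangle a b := Ω.bnorm_badd_le _ _ (p_eq a b)
  norm_eq_zero_iff a := by
    obtain ⟨a, rfl⟩ := a
    exact (Ω.bnorm_eq_zero a).trans ⟨fun h => Fiber.ext h, fun h => congrArg Fiber.val h⟩

instance : NormedAddCommGroup (Ω.Fiber x) := NormedAddCommGroup.ofCore (core x)
instance : NormedSpace ℂ (Ω.Fiber x) := NormedSpace.ofCore (core x)

theorem val_sub (a b : Ω.Fiber x) : (a - b).1 = Ω.badd a.1 (Ω.bsmul (-1) b.1) := by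
  rw [sub_eq_add_neg]; rfl

theorem norm_sub_def (a b : Ω.Fiber x) : ‖a - b‖ = Ω.bnorm (Ω.badd a.1 (Ω.bsmul (-1) b.1)) := by
  rw [norm_def, val_sub]

instance : CompleteSpace (Ω.Fiber x) := by
  refine Metric.complete_of_cauchySeq_tendsto fun f hf => ?_
  obtain ⟨L, hL, h⟩ := Ω.fiber_complete x (fun n => (f n).1) (fun n => (f n).2) fun ε hε => by
    obtain ⟨N, hN⟩ := Metric.cauchySeq_iff.1 hf ε hε
    exact ⟨N, fun m n hm hn => by simpa [dist_eq_norm, norm_sub_def] using hN m hm n hn⟩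
  refine ⟨⟨L, hL⟩, tendsto_iff_norm_sub_tendsto_zero.2 ?_⟩
  exact h.congr fun n => (norm_sub_def (f n) ⟨L, hL⟩).symm

section Unit

variable {u : Ω.toLCGroupoid.UnitSpace}

theorem _root_.LCGroupoid.UnitSpace.src_eq {Γ : LCGroupoid} (u : Γ.UnitSpace) :
    Γ.src u.1 = u.1 := by
  rw [← u.2, Γ.src_rng]

theorem comp_unit (a b : Ω.Fiber u.1) : Ω.src (Ω.p a.1) = Ω.rng (Ω.p b.1) := by
  rw [a.2, b.2, u.src_eq, u.2]

instance : Mul (Ω.Fiber u.1) := ⟨fun a b => ⟨Ω.bmul a.1 b.1, by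
  rw [Ω.p_bmul _ _ (comp_unit a b), a.2, b.2]
  simpa [u.2] using Ω.gmul_rng u.1⟩⟩

instance : Star (Ω.Fiber u.1) := ⟨fun a => ⟨Ω.bstar a.1, by
  rw [Ω.p_bstar, a.2, Ω.ginv_unit _ u.2]⟩⟩

theorem val_mul (a b : Ω.Fiber u.1) : (a * b).1 = Ω.bmul a.1 b.1 := rfl

theorem add_mul' (a b c : Ω.Fiber u.1) : (a + b) * c = a * c + b * c :=
  Fiber.ext (Ω.bmul_badd _ _ _ (p_eq a b) (comp_unit a c))

theorem mul_add' (a b c : Ω.Fiber u.1) : a * (b + c) = a * b + a * c :=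
  Fiber.ext (Ω.badd_bmul _ _ _ (p_eq b c) (comp_unit a b))

theorem smul_mul' (c : ℂ) (a b : Ω.Fiber u.1) : (c • a) * b = c • (a * b) :=
  Fiber.ext (Ω.bsmul_bmul _ _ _ (comp_unit a b))

theorem mul_smul' (c : ℂ) (a b : Ω.Fiber u.1) : a * (c • b) = c • (a * b) :=
  Fiber.ext (Ω.bmul_bsmul _ _ _ (comp_unit a b))

instance : NonUnitalNormedRing (Ω.Fiber u.1) where
  __ := (inferInstance : NormedAddCommGroup (Ω.Fiber u.1))
  left_distrib := mul_add'
  right_distrib := add_mul'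
  zero_mul a := by rw [← zero_smul ℂ (0 : Ω.Fiber u.1), smul_mul', zero_smul, zero_smul]
  mul_zero a := by rw [← zero_smul ℂ (0 : Ω.Fiber u.1), mul_smul', zero_smul, zero_smul]
  mul_assoc a b c := Fiber.ext (Ω.bmul_assoc _ _ _ (comp_unit a b) (comp_unit b c))
  norm_mul_le a b := Ω.unit_submul _ _ (p_eq a b) (by rw [a.2, u.2])

instance : StarRing (Ω.Fiber u.1) where
  star_involutive _ := Fiber.ext (Ω.bstar_bstar _)
  star_mul a b := Fiber.ext (Ω.bstar_bmul _ _ (comp_unit a b))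
  star_add a b := Fiber.ext (Ω.bstar_badd _ _ (p_eq a b))

instance : NonUnitalCStarAlgebra (Ω.Fiber u.1) where
  norm_mul_self_le a := by
    rw [← pow_two]
    exact (Ω.cstar_identity a.1).ge
  smul_assoc c a b := smul_mul' c a b
  smul_comm c a b := (mul_smul' c a b).symm
  star_smul c a := Fiber.ext (Ω.bstar_bsmul c a.1)

end Unit

end Fiber

end FellBundleData

section CStar

variable {A : Type*} [NonUnitalCStarAlgebra A]

/-- The polynomials `1 - (1 - c h) ^ n` in `h`, which have no constant term. -/
def geomApproxUnit (c : ℝ) (h : A) : ℕ → A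
  | 0 => 0
  | n + 1 => geomApproxUnit c h n + ((c : ℂ) • h + (-(c : ℂ)) • (h * geomApproxUnit c h n))

open Unitization in
theorem one_sub_geomApproxUnit (c : ℝ) (h : A) (n : ℕ) :
    (1 : Unitization ℂ A) - geomApproxUnit c h n = (1 - c • (h : Unitization ℂ A)) ^ n := by
  induction n with
  | zero => simp [geomApproxUnit]
  | succ n ih =>
    rw [pow_succ', ← ih, geomApproxUnit]
    simp only [inr_add, inr_neg, inr_smul, inr_mul, ← Complex.coe_smul, sub_mul, mul_sub, one_mul,
      mul_one,
      smul_mul_assoc, neg_smul]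
    abel

theorem mul_one_sub_pow_le {s : ℝ} (h0 : 0 ≤ s) (h1 : s ≤ 1) (n : ℕ) :
    (n + 1) * (s * (1 - s) ^ n) ≤ 1 := by
  have hq : 0 ≤ 1 - s := by linarith
  have hb : (n + 1) * (1 - s) ^ n ≤ ∑ k ∈ Finset.range (n + 1), (1 - s) ^ k := by
    have := Finset.card_nsmul_le_sum (Finset.range (n + 1)) (fun k => (1 - s) ^ k) ((1 - s) ^ n)
      fun k hk => pow_le_pow_of_le_one hq (by linarith)
        (Nat.lt_succ_iff.1 (Finset.mem_range.1 hk))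
    simpa using this
  have hg := geom_sum_mul (1 - s) (n + 1)
  have hp : 0 ≤ (1 - s) ^ (n + 1) := pow_nonneg hq _
  nlinarith [mul_le_mul_of_nonneg_left hb h0]

open Polynomial in
theorem norm_one_sub_pow_mul_le {B : Type*} [CStarAlgebra B] (b : B) {M : ℝ} (hM : 0 < M)
    (hb : ‖star b * b‖ ≤ M) (n : ℕ) :
    ‖(1 - M⁻¹ • (star b * b)) ^ n * (star b * b) * (1 - M⁻¹ • (star b * b)) ^ n‖
      ≤ M / (n + 1) := by
  rcases subsingleton_or_nontrivial B with _ | _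
  · rw [Subsingleton.elim (_ * _) (0 : B), norm_zero]
    positivity
  set h := star b * b with hh
  have hsa : IsSelfAdjoint h := IsSelfAdjoint.star_mul_self b
  have key : (1 - M⁻¹ • h) ^ n * h * (1 - M⁻¹ • h) ^ n =
      cfc ((1 - C M⁻¹ * X) ^ n * X * (1 - C M⁻¹ * X) ^ n : ℝ[X]).eval h := by
    rw [cfc_polynomial _ h hsa]
    simp [Algebra.smul_def]
  rw [key]
  refine norm_cfc_le (by positivity) fun t ht => ?_
  have ht0 : 0 ≤ t := spectrum_star_mul_self_nonneg t ht
  have htM : t ≤ M := (le_abs_self t).trans ((spectrum.norm_le_norm_of_mem ht).trans hb)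
  have hs0 : 0 ≤ M⁻¹ * t := by positivity
  have hs1 : M⁻¹ * t ≤ 1 := by rw [inv_mul_le_iff₀ hM]; linarith
  have h1 := mul_one_sub_pow_le hs0 hs1 n
  have hp0 : 0 ≤ (1 - M⁻¹ * t) ^ n := pow_nonneg (by linarith) _
  have hp1 : (1 - M⁻¹ * t) ^ n ≤ 1 := pow_le_one₀ (by linarith) (by linarith)
  simp only [eval_mul, eval_pow, eval_sub, eval_one, eval_C, eval_X]
  rw [Real.norm_of_nonneg (by positivity), le_div_iff₀ (by positivity)]
  have h2 : t = M * (M⁻¹ * t) := by field_simp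
  generalize M⁻¹ * t = s at *
  subst h2
  have h3 : 0 ≤ (n + 1) * (s * (1 - s) ^ n) := by positivity
  nlinarith [mul_le_mul h1 hp1 hp0 zero_le_one]

open Unitization in
theorem norm_geomApproxUnit_le (b : A) {M : ℝ} (hM : 0 < M) (hb : ‖star b * b‖ ≤ M) (n : ℕ) :
    ‖(star b * b - star b * b * geomApproxUnit M⁻¹ (star b * b) n)
      - star (geomApproxUnit M⁻¹ (star b * b) n) *
        (star b * b - star b * b * geomApproxUnit M⁻¹ (star b * b) n)‖ ≤ M / (n + 1) := by
  have hb' : ‖star (b : Unitization ℂ A) * b‖ ≤ M := by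
    rwa [← inr_star, ← inr_mul, norm_inr]
  have key := norm_one_sub_pow_mul_le (b : Unitization ℂ A) hM hb' n
  have hE := one_sub_geomApproxUnit M⁻¹ (star b * b) n
  set E := geomApproxUnit M⁻¹ (star b * b) n
  rw [inr_mul, inr_star] at hE
  have hE' : (1 : Unitization ℂ A) - star (E : Unitization ℂ A) =
      (1 - M⁻¹ • (star (b : Unitization ℂ A) * b)) ^ n := by
    rw [← star_one, ← star_sub, hE]
    simp
  rw [← norm_inr (𝕜 := ℂ)]
  convert key using 2
  nth_rewrite 1 [← hE']
  rw [← hE]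
  simp only [inr_sub, inr_mul, inr_star]
  noncomm_ring

end CStar

namespace FellBundleData

variable {Ω : FellBundleData}

/-- The source of a groupoid element, as an element of the unit space. -/
def srcUnit (x : Ω.G) : Ω.toLCGroupoid.UnitSpace := ⟨Ω.src x, Ω.rng_src x⟩

/-- The values of `geomApproxUnit`, computed with the operations of the total space. -/
def approxUnit (Ω : FellBundleData) (c : ℝ) (h : Ω.T) : ℕ → Ω.T
  | 0 => Ω.bzero (Ω.p h)
  | n + 1 => Ω.badd (approxUnit Ω c h n)
      (Ω.badd (Ω.bsmul c h) (Ω.bsmul (-c) (Ω.bmul h (approxUnit Ω c h n))))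

theorem val_geomApproxUnit {u : Ω.toLCGroupoid.UnitSpace} (c : ℝ) (h : Ω.Fiber u.1) (n : ℕ) :
    (geomApproxUnit c h n).1 = Ω.approxUnit c h.1 n := by
  induction n with
  | zero => rw [approxUnit, h.2]; rfl
  | succ n ih => rw [approxUnit, ← ih]; rfl

theorem p_bmul_src {b e : Ω.T} (he : Ω.p e = Ω.src (Ω.p b)) : Ω.p (Ω.bmul b e) = Ω.p b := by
  rw [Ω.p_bmul _ _ (by rw [he, Ω.rng_src]), he, Ω.gmul_src]

theorem p_bstar_bmul {a b : Ω.T} (hab : Ω.p a = Ω.p b) :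
    Ω.p (Ω.bmul (Ω.bstar a) b) = Ω.src (Ω.p b) := by
  rw [Ω.p_bmul _ _ (by rw [Ω.p_bstar, Ω.src_ginv, hab]), Ω.p_bstar, hab, Ω.ginv_gmul]

theorem bstar_bmul_sub_bmul {b : Ω.T} (h e : Ω.Fiber (srcUnit (Ω.p b)).1)
    (hh : h.1 = Ω.bmul (Ω.bstar b) b) :
    Ω.bmul (Ω.bstar (Ω.badd b (Ω.bsmul (-1) (Ω.bmul b e.1))))
      (Ω.badd b (Ω.bsmul (-1) (Ω.bmul b e.1))) =
      ((h - h * e) - star e * (h - h * e)).1 := by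
  have he : Ω.p e.1 = Ω.src (Ω.p b) := e.2
  have hbe : Ω.p (Ω.bmul b e.1) = Ω.p b := p_bmul_src he
  have hcomp : Ω.src (Ω.p b) = Ω.rng (Ω.p e.1) := by rw [he, Ω.rng_src]
  have hs : Ω.src (Ω.p (Ω.bstar b)) = Ω.rng (Ω.p b) := by rw [Ω.p_bstar, Ω.src_ginv]
  set r := Ω.badd b (Ω.bsmul (-1) (Ω.bmul b e.1)) with hr
  have hpr : Ω.p r = Ω.p b := Ω.p_badd _ _ (by rw [Ω.p_bsmul, hbe])
  have hw : Ω.bmul (Ω.bstar b) r = (h - h * e).1 := by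
    rw [hr, Ω.badd_bmul _ _ _ (by rw [Ω.p_bsmul, hbe]) hs, Ω.bmul_bsmul _ _ _ (by rw [hbe, hs]),
      ← Ω.bmul_assoc _ _ _ hs hcomp, ← hh]
    rw [Fiber.val_sub]; rfl
  have hpe : Ω.p (Ω.bstar e.1) = Ω.src (Ω.p b) := (star e).2
  have hes : Ω.src (Ω.p (Ω.bstar e.1)) = Ω.rng (Ω.p (Ω.bstar b)) := by
    rw [hpe, Ω.p_bstar, Ω.rng_ginv, Ω.src_src]
  have hpes : Ω.p (Ω.bmul (Ω.bstar e.1) (Ω.bstar b)) = Ω.p (Ω.bstar b) := by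
    rw [Ω.p_bmul _ _ hes, hpe, Ω.p_bstar, ← Ω.rng_ginv, Ω.gmul_rng]
  have hstar : Ω.bstar r =
      Ω.badd (Ω.bstar b) (Ω.bsmul (-1) (Ω.bmul (Ω.bstar e.1) (Ω.bstar b))) := by
    rw [hr, Ω.bstar_badd _ _ (by rw [Ω.p_bsmul, hbe]), Ω.bstar_bsmul, Ω.bstar_bmul _ _ hcomp]
    simp
  rw [hstar, Ω.bmul_badd _ _ _ (by rw [Ω.p_bsmul, hpes]) (by rw [hpr, hs]),
    Ω.bsmul_bmul _ _ _ (by rw [hpes, hs, hpr]), Ω.bmul_assoc _ _ _ hes (by rw [hpr, hs]), hw,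
    Fiber.val_sub _ (star e * _)]
  rfl

theorem sq_bnorm_sub_bmul_approxUnit_le {b : Ω.T} {M : ℝ} (hM : 0 < M) (hb : Ω.bnorm b ≤ M)
    (n : ℕ) :
    Ω.bnorm (Ω.badd b (Ω.bsmul (-1)
      (Ω.bmul b (Ω.approxUnit (M ^ 2)⁻¹ (Ω.bmul (Ω.bstar b) b) n)))) ^ 2 ≤ M ^ 2 / (n + 1) := by
  obtain ⟨c, hc, hbc⟩ := Ω.bmul_pos b
  let c' : Ω.Fiber (srcUnit (Ω.p b)).1 := ⟨c, hc⟩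
  have hh : (star c' * c').1 = Ω.bmul (Ω.bstar b) b := hbc.symm
  have hn : ‖star c' * c'‖ ≤ M ^ 2 := by
    rw [Fiber.norm_def, hh, Ω.cstar_identity]
    exact pow_le_pow_left₀ (Ω.bnorm_nonneg b) hb 2
  have key := norm_geomApproxUnit_le c' (by positivity : 0 < M ^ 2) hn n
  rw [Fiber.norm_def, ← bstar_bmul_sub_bmul _ _ hh, Ω.cstar_identity, val_geomApproxUnit, hh] at key
  exact key

theorem exists_bnorm_sub_bmul_approxUnit_lt (Ω : FellBundleData) {M ε : ℝ} (hM : 0 < M)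
    (hε : 0 < ε) :
    ∃ n, ∀ b, Ω.bnorm b ≤ M → Ω.bnorm (Ω.badd b (Ω.bsmul (-1)
      (Ω.bmul b (Ω.approxUnit (M ^ 2)⁻¹ (Ω.bmul (Ω.bstar b) b) n)))) < ε := by
  obtain ⟨n, hn⟩ := exists_nat_gt (M ^ 2 / ε ^ 2)
  refine ⟨n, fun b hb => lt_of_pow_lt_pow_left₀ 2 hε.le
    ((sq_bnorm_sub_bmul_approxUnit_le hM hb n).trans_lt ?_)⟩
  rw [div_lt_iff₀ (by positivity)] at hn ⊢
  nlinarith [sq_nonneg ε, pow_pos hε 2]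

end FellBundleData

instance inst_s10 (Γ : LCGroupoid) : T2Space Γ.UnitSpace :=
  haveI := Γ.t2G
  inferInstanceAs (T2Space {u : Γ.G // Γ.rng u = u})

instance inst_s10_2 (Γ : LCGroupoid) : LocallyCompactSpace Γ.UnitSpace :=
  haveI := Γ.t2G
  haveI := Γ.lcG
  (isClosed_eq Γ.continuous_rng continuous_id).locallyCompactSpace

theorem LCGroupoid.UnitSpace.continuous_val {Γ : LCGroupoid} :
    Continuous (fun u : Γ.UnitSpace => u.1) :=
  continuous_subtype_val

namespace FellBundleData

variable {Ω : FellBundleData}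

theorem exists_badd_mem {a b : Ω.T} (h : Ω.p a = Ω.p b) {W : Set Ω.T}
    (hW : W ∈ 𝓝 (Ω.badd a b)) :
    ∃ U ∈ 𝓝 a, ∃ V ∈ 𝓝 b, ∀ a' ∈ U, ∀ b' ∈ V, Ω.p a' = Ω.p b' → Ω.badd a' b' ∈ W := by
  have := Ω.cont_badd.continuousAt (x := ⟨(a, b), h⟩) hW
  obtain ⟨s, hs, hsW⟩ := mem_nhds_subtype _ _ _ |>.1 this
  obtain ⟨U, hU, V, hV, hUV⟩ := mem_nhds_prod_iff.1 hs
  exact ⟨U, hU, V, hV, fun a' ha b' hb hab =>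
    hsW (a := ⟨(a', b'), hab⟩) (hUV (Set.mk_mem_prod ha hb))⟩

theorem exists_bsmul_mem {c : ℂ} {a : Ω.T} {W : Set Ω.T} (hW : W ∈ 𝓝 (Ω.bsmul c a)) :
    ∃ U ∈ 𝓝 c, ∃ V ∈ 𝓝 a, ∀ c' ∈ U, ∀ a' ∈ V, Ω.bsmul c' a' ∈ W := by
  have := Ω.cont_bsmul.continuousAt (x := (c, a)) hW
  obtain ⟨U, hU, V, hV, hUV⟩ := mem_nhds_prod_iff.1 this
  exact ⟨U, hU, V, hV, fun c' hc a' ha => hUV (Set.mk_mem_prod hc ha)⟩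

/-- Every point of the total space has a neighbourhood which is thin in each fibre. -/
theorem exists_thin_nhd (b : Ω.T) {ε : ℝ} (hε : 0 < ε) :
    ∃ W ∈ 𝓝 b, ∀ c ∈ W, ∀ d ∈ W, Ω.p c = Ω.p d →
      Ω.bnorm (Ω.badd c (Ω.bsmul (-1) d)) < ε := by
  have h0 : {t | Ω.bnorm t < ε} ∈ 𝓝 (Ω.badd b (Ω.bsmul (-1) b)) := by
    refine Ω.usc_bnorm _ _ ?_
    change Ω.bnorm _ < ε
    rwa [Ω.badd_neg, (Ω.bnorm_eq_zero _).2 (by rw [Ω.p_bzero])]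
  obtain ⟨U, hU, V, hV, hUV⟩ := exists_badd_mem (by rw [Ω.p_bsmul]) h0
  obtain ⟨C, hC, D, hD, hCD⟩ := exists_bsmul_mem hV
  exact ⟨U ∩ D, inter_mem hU hD, fun c hc d hd hcd =>
    hUV c hc.1 _ (hCD _ (mem_of_mem_nhds hC) d hd.2) (by rw [Ω.p_bsmul, hcd])⟩

theorem exists_nhd_of_bnorm_sub_lt {b : Ω.T} {N : Set Ω.T} (hN : N ∈ 𝓝 b) :
    ∃ N' ∈ 𝓝 b, ∃ δ : ℝ, 0 < δ ∧ ∀ x (c d : Ω.Fiber x), d.1 ∈ N' → ‖c - d‖ < δ → c.1 ∈ N := by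
  have hb : Ω.badd b (Ω.bzero (Ω.p b)) = b := by
    rw [Ω.badd_comm _ _ (Ω.p_bzero _).symm, Ω.bzero_badd]
  rw [← hb] at hN
  obtain ⟨U, hU, Z, hZ, hUZ⟩ := exists_badd_mem (Ω.p_bzero _).symm hN
  obtain ⟨V, hV, δ, hδ, hVδ⟩ := Ω.zero_nbhd _ _ hZ
  refine ⟨U ∩ Ω.p ⁻¹' V, inter_mem hU (Ω.p_cont.continuousAt hV), δ, hδ, fun x c d hd hcd => ?_⟩
  have := hUZ d.1 hd.1 (c - d).1 (hVδ _ (by rw [Fiber.p_eq (c - d) d]; exact hd.2) hcd)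
    (Fiber.p_eq _ _)
  rwa [← Fiber.val_add, add_sub_cancel] at this

/-- Sections over the unit space, without any continuity requirement. -/
abbrev UnitSection (Ω : FellBundleData) : Type := ∀ y : Ω.toLCGroupoid.UnitSpace, Ω.Fiber y.1

/-- A section is continuous at `x` up to the error `e`. -/
def AlmostContAt (e : Ω.toLCGroupoid.UnitSpace → ℝ) (σ : Ω.UnitSection)
    (x : Ω.toLCGroupoid.UnitSpace) : Prop :=
  ∀ W ∈ 𝓝 (σ x).1, ∀ᶠ y in 𝓝 x, ∃ c : Ω.Fiber y.1, c.1 ∈ W ∧ ‖σ y - c‖ ≤ e y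

namespace AlmostContAt

variable {e e' : Ω.toLCGroupoid.UnitSpace → ℝ} {σ τ : Ω.UnitSection}
  {x : Ω.toLCGroupoid.UnitSpace}

theorem mono (h : AlmostContAt e σ x) (he : ∀ᶠ y in 𝓝 x, e y ≤ e' y) : AlmostContAt e' σ x := by
  intro W hW
  filter_upwards [h W hW, he] with y ⟨c, hc, hcy⟩ hey
  exact ⟨c, hc, hcy.trans hey⟩

theorem of_eventually_zero (h : ∀ᶠ y in 𝓝 x, σ y = 0) (he : ∀ y, 0 ≤ e y) :
    AlmostContAt e σ x := by
  intro W hW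
  rw [h.self_of_nhds, Fiber.val_zero] at hW
  have hc : Continuous fun y : Ω.toLCGroupoid.UnitSpace => Ω.bzero y.1 :=
    Ω.cont_bzero.comp LCGroupoid.UnitSpace.continuous_val
  filter_upwards [h, hc.continuousAt hW] with y hy hyW
  exact ⟨0, hyW, by simpa [hy] using he y⟩

theorem add (h : AlmostContAt e σ x) (h' : AlmostContAt e' τ x) :
    AlmostContAt (e + e') (σ + τ) x := by
  intro W hW
  obtain ⟨U, hU, V, hV, hUV⟩ := exists_badd_mem (Fiber.p_eq _ _) hW
  filter_upwards [h U hU, h' V hV] with y ⟨c, hc, hcy⟩ ⟨d, hd, hdy⟩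
  refine ⟨c + d, hUV _ hc _ hd (Fiber.p_eq _ _), ?_⟩
  rw [Pi.add_apply, add_sub_add_comm]
  exact (norm_add_le _ _).trans (add_le_add hcy hdy)

theorem smul (h : AlmostContAt e σ x) {φ : Ω.toLCGroupoid.UnitSpace → ℂ}
    (hφ : ContinuousAt φ x) :
    AlmostContAt (fun y => ‖φ y‖ * e y) (fun y => φ y • σ y) x := by
  intro W hW
  obtain ⟨U, hU, V, hV, hUV⟩ := exists_bsmul_mem hW
  filter_upwards [hφ hU, h V hV] with y hy ⟨c, hc, hcy⟩
  refine ⟨φ y • c, hUV _ hy _ hc, ?_⟩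
  rw [← smul_sub, norm_smul]
  exact mul_le_mul_of_nonneg_left hcy (norm_nonneg _)

theorem sum {ι : Type*} (s : Finset ι) {e : ι → Ω.toLCGroupoid.UnitSpace → ℝ}
    {σ : ι → Ω.UnitSection} (h : ∀ i ∈ s, AlmostContAt (e i) (σ i) x) :
    AlmostContAt (fun y => ∑ i ∈ s, e i y) (fun y => ∑ i ∈ s, σ i y) x := by
  classical
  induction s using Finset.induction_on with
  | empty => exact of_eventually_zero (by simp) (by simp)
  | insert i s hi ih =>
    simp only [Finset.sum_insert hi]
    exact (h i (by simp)).add (ih fun j hj => h j (by simp [hj]))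

end AlmostContAt

theorem Continuous.almostContAt {σ : Ω.UnitSection} (h : Continuous fun y => (σ y).1)
    (x : Ω.toLCGroupoid.UnitSpace) : AlmostContAt (fun _ => 0) σ x := by
  intro W hW
  filter_upwards [h.continuousAt hW] with y hy
  exact ⟨σ y, hy, by simp⟩

theorem continuous_of_almostContAt {f : ℕ → Ω.UnitSection} {σ : Ω.UnitSection} {e d : ℕ → ℝ}
    (he : Tendsto e atTop (𝓝 0)) (hd : Tendsto d atTop (𝓝 0))
    (hf : ∀ n x, AlmostContAt (fun _ => e n) (f n) x) (hσ : ∀ n y, ‖σ y - f n y‖ ≤ d n) :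
    Continuous fun y => (σ y).1 := by
  refine continuous_iff_continuousAt.2 fun x N hN => ?_
  obtain ⟨N₁, hN₁, δ, hδ, h₁⟩ := exists_nhd_of_bnorm_sub_lt hN
  obtain ⟨N₂, hN₂, δ', hδ', h₂⟩ := exists_nhd_of_bnorm_sub_lt (interior_mem_nhds.2 hN₁)
  have hed : Tendsto (fun n => d n + e n) atTop (𝓝 0) := by simpa using hd.add he
  obtain ⟨n, hn, hn'⟩ := ((hd.eventually_lt_const hδ').and (hed.eventually_lt_const hδ)).exists
  have hfx : (f n x).1 ∈ interior N₁ := h₂ _ _ (σ x) (mem_of_mem_nhds hN₂) <| by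
    rw [norm_sub_rev]
    exact (hσ n x).trans_lt hn
  rw [mem_map]
  filter_upwards [hf n x _ (isOpen_interior.mem_nhds hfx)] with y ⟨c, hc, hcy⟩
  refine h₁ _ (σ y) c (interior_subset hc) (lt_of_le_of_lt ?_ hn')
  calc ‖σ y - c‖ = ‖(σ y - f n y) + (f n y - c)‖ := by rw [sub_add_sub_cancel]
    _ ≤ d n + e n := (norm_add_le _ _).trans (add_le_add (hσ n y) hcy)

/-- A sequence of sections with geometrically decreasing increments has a uniform limit. -/
theorem exists_limit_section_s10 {f : ℕ → Ω.UnitSection} {C : ℝ}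
    (hf : ∀ n y, ‖f (n + 1) y - f n y‖ ≤ C / 2 / 2 ^ n) :
    ∃ σ : Ω.UnitSection, (∀ n y, ‖σ y - f n y‖ ≤ C / 2 ^ n) ∧
      ∀ y, Tendsto (fun n => f n y) atTop (𝓝 (σ y)) := by
  have hd : ∀ y n, dist (f n y) (f (n + 1) y) ≤ C / 2 / 2 ^ n := fun y n => by
    rw [dist_comm, dist_eq_norm]
    exact hf n y
  have hlim := fun y => cauchySeq_tendsto_of_complete (cauchySeq_of_le_geometric_two (hd y))
  choose σ hσ using hlim
  refine ⟨σ, fun n y => ?_, hσ⟩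
  rw [← dist_eq_norm, dist_comm]
  exact dist_le_of_le_geometric_two_of_tendsto (hd y) (hσ y) n

theorem tendsto_div_two_pow (C : ℝ) : Tendsto (fun n : ℕ => C / 2 ^ n) atTop (𝓝 0) :=
  tendsto_const_nhds.div_atTop (tendsto_pow_atTop_atTop_of_one_lt one_lt_two)

end FellBundleData

namespace FellBundleData

variable {Ω : FellBundleData}

theorem AlmostContAt.of_thin {W : Set Ω.T} {ε : ℝ} (hWo : IsOpen W)
    (hW : ∀ c ∈ W, ∀ d ∈ W, Ω.p c = Ω.p d → Ω.bnorm (Ω.badd c (Ω.bsmul (-1) d)) < ε)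
    {σ : Ω.UnitSection} {x : Ω.toLCGroupoid.UnitSpace} (hσ : ∀ᶠ y in 𝓝 x, (σ y).1 ∈ W) :
    AlmostContAt (fun _ => ε) σ x := by
  intro N hN
  have himg : Ω.p '' (N ∩ W) ∈ 𝓝 x.1 := by
    rw [← (σ x).2]
    exact Ω.p_open.image_mem_nhds (inter_mem hN (hWo.mem_nhds hσ.self_of_nhds))
  filter_upwards [hσ, LCGroupoid.UnitSpace.continuous_val.continuousAt himg] with y hy ⟨t, ht, hty⟩
  refine ⟨⟨t, hty⟩, ht.1, ?_⟩
  rw [Fiber.norm_sub_def]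
  exact (hW _ hy _ ht.2 (Fiber.p_eq (σ y) ⟨t, hty⟩)).le

theorem exists_open_thin_nhd (b : Ω.T) {ε : ℝ} (hε : 0 < ε) :
    ∃ W, IsOpen W ∧ b ∈ W ∧ ∀ c ∈ W, ∀ d ∈ W, Ω.p c = Ω.p d →
      Ω.bnorm (Ω.badd c (Ω.bsmul (-1) d)) < ε := by
  obtain ⟨W, hW, h⟩ := exists_thin_nhd b hε
  exact ⟨interior W, isOpen_interior, mem_interior_iff_mem_nhds.2 hW,
    fun c hc d hd => h c (interior_subset hc) d (interior_subset hd)⟩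

theorem exists_local_refinement {ε ε' : ℝ} (hε' : 0 < ε') {σ : Ω.UnitSection}
    {x : Ω.toLCGroupoid.UnitSpace} (hσ : AlmostContAt (fun _ => ε) σ x) :
    ∃ V, IsOpen V ∧ x ∈ V ∧ ∃ β : Ω.UnitSection,
      ∀ y ∈ V, ‖β y - σ y‖ ≤ ε ∧ AlmostContAt (fun _ => ε') β y := by
  obtain ⟨W, hWo, hxW, hW⟩ := exists_open_thin_nhd (σ x).1 hε'
  obtain ⟨V, hV, hVo, hxV⟩ := eventually_nhds_iff.1 (hσ W (hWo.mem_nhds hxW))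
  have hsel : ∀ y, ∃ c : Ω.Fiber y.1, y ∈ V → c.1 ∈ W ∧ ‖σ y - c‖ ≤ ε := fun y => by
    by_cases hy : y ∈ V
    · obtain ⟨c, hc⟩ := hV y hy
      exact ⟨c, fun _ => hc⟩
    · exact ⟨0, fun h => absurd h hy⟩
  choose β hβ using hsel
  refine ⟨V, hVo, hxV, β, fun y hy => ⟨?_, ?_⟩⟩
  · rw [norm_sub_rev]
    exact (hβ y hy).2
  · exact AlmostContAt.of_thin hWo hW (mem_of_superset (hVo.mem_nhds hy) fun z hz => (hβ z hz).1)

theorem AlmostContAt.smul_of_tsupport {ε : ℝ} (hε : 0 ≤ ε) {σ : Ω.UnitSection}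
    {φ : C(Ω.toLCGroupoid.UnitSpace, ℝ)} {x : Ω.toLCGroupoid.UnitSpace}
    (h : x ∈ tsupport φ → AlmostContAt (fun _ => ε) σ x) :
    AlmostContAt (fun y => ‖(φ y : ℂ)‖ * ε) (fun y => (φ y : ℂ) • σ y) x := by
  by_cases hx : x ∈ tsupport φ
  · exact (h hx).smul (Complex.continuous_ofReal.comp φ.continuous).continuousAt
  · refine .of_eventually_zero ?_ fun y => by positivity
    filter_upwards [notMem_tsupport_iff_eventuallyEq.1 hx] with y hy
    simp [hy]

theorem exists_refinement {ε ε' : ℝ} (hε : 0 ≤ ε) (hε' : 0 < ε') {σ : Ω.UnitSection}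
    (hσ : ∀ x, AlmostContAt (fun _ => ε) σ x)
    {K : Set Ω.toLCGroupoid.UnitSpace} (hK : IsCompact K) (hσK : ∀ y ∉ K, σ y = 0) :
    ∃ τ : Ω.UnitSection, (∀ x, AlmostContAt (fun _ => ε') τ x) ∧
      (∃ K', IsCompact K' ∧ ∀ y ∉ K', τ y = 0) ∧ ∀ y, ‖τ y - σ y‖ ≤ ε := by
  choose V hVo hxV β hβ using fun x => exists_local_refinement hε' (hσ x)
  obtain ⟨t, -, ht⟩ := hK.elim_nhds_subcover V fun x _ => (hVo x).mem_nhds (hxV x)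
  obtain ⟨f, hfV, hfc⟩ := PartitionOfUnity.exists_isSubordinate_of_locallyFinite_t2space hK
    (fun i : t => V i.1) (fun i => hVo i.1) (locallyFinite_of_finite _)
    (by simpa [Set.iUnion_subtype] using ht)
  have hf0 : ∀ i y, ‖(f i y : ℂ)‖ = f i y := fun i y => by
    rw [Complex.norm_real, Real.norm_of_nonneg (f.nonneg i y)]
  have hf1 : ∀ y, ∑ i, f i y ≤ 1 := fun y => by
    rw [← finsum_eq_sum_of_fintype]
    exact f.sum_le_one y
  refine ⟨fun y => ∑ i, (f i y : ℂ) • β i.1 y, fun x => ?_, ?_, fun y => ?_⟩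
  · refine (AlmostContAt.sum Finset.univ fun i _ => AlmostContAt.smul_of_tsupport hε'.le
      (φ := f i) fun hx => (hβ _ x (hfV i hx)).2).mono (.of_forall fun y => ?_)
    simp only [hf0, ← Finset.sum_mul]
    exact mul_le_of_le_one_left hε'.le (hf1 y)
  · refine ⟨⋃ i, tsupport (f i), isCompact_iUnion hfc, fun y hy => Finset.sum_eq_zero fun i _ => ?_⟩
    rw [image_eq_zero_of_notMem_tsupport fun h => hy (Set.mem_iUnion.2 ⟨i, h⟩)]
    simp
  · have hsub : ∑ i, (f i y : ℂ) • β i.1 y - σ y = ∑ i, (f i y : ℂ) • (β i.1 y - σ y) := by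
      simp only [smul_sub, Finset.sum_sub_distrib, ← Finset.sum_smul]
      congr 1
      by_cases hy : y ∈ K
      · have : ∑ i, f i y = 1 := by
          rw [← finsum_eq_sum_of_fintype]
          exact f.sum_eq_one hy
        rw [← Complex.ofReal_sum, this, Complex.ofReal_one, one_smul]
      · rw [hσK y hy, smul_zero]
    rw [hsub]
    calc ‖∑ i, (f i y : ℂ) • (β i.1 y - σ y)‖ ≤ ∑ i, f i y * ε := by
          refine norm_sum_le_of_le _ fun i _ => ?_
          rw [norm_smul, hf0]
          by_cases hy : y ∈ tsupport (f i)
          · exact mul_le_mul_of_nonneg_left (hβ _ y (hfV i hy)).1 (f.nonneg i y)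
          · simp [image_eq_zero_of_notMem_tsupport hy]
      _ ≤ ε := by
          rw [← Finset.sum_mul]
          exact mul_le_of_le_one_left hε (hf1 y)

theorem exists_almostCont_section {u : Ω.toLCGroupoid.UnitSpace} (b : Ω.Fiber u.1) {ε : ℝ}
    (hε : 0 < ε) :
    ∃ σ : Ω.UnitSection, (∀ x, AlmostContAt (fun _ => ε) σ x) ∧
      (∃ K, IsCompact K ∧ ∀ y ∉ K, σ y = 0) ∧ σ u = b := by
  classical
  obtain ⟨W, hWo, hbW, hW⟩ := exists_open_thin_nhd b.1 hε
  let V : Set Ω.toLCGroupoid.UnitSpace := (fun y => y.1) ⁻¹' (Ω.p '' W)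
  have hVo : IsOpen V := (Ω.p_open W hWo).preimage LCGroupoid.UnitSpace.continuous_val
  have huV : u ∈ V := ⟨b.1, hbW, b.2⟩
  have hsel : ∀ y, ∃ c : Ω.Fiber y.1, y ∈ V → c.1 ∈ W := fun y => by
    by_cases hy : y ∈ V
    · obtain ⟨t, ht, hty⟩ := hy
      exact ⟨⟨t, hty⟩, fun _ => ht⟩
    · exact ⟨0, fun h => absurd h hy⟩
  choose β hβ using hsel
  let γ : Ω.UnitSection := Function.update β u b
  have hγ : ∀ y ∈ V, (γ y).1 ∈ W := fun y hy => by
    rcases eq_or_ne y u with rfl | hyu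
    · simpa [γ] using hbW
    · simpa [γ, hyu] using hβ y hy
  obtain ⟨φ, hφ1, hφc, hφV, hφ01⟩ := exists_continuousMap_one_of_isCompact_subset_isOpen
    isCompact_singleton hVo (Set.singleton_subset_iff.2 huV)
  refine ⟨fun y => (φ y : ℂ) • γ y, fun x => ?_, ⟨tsupport φ, hφc, fun y hy => ?_⟩, ?_⟩
  · refine (AlmostContAt.smul_of_tsupport hε.le fun hx => .of_thin hWo hW
      (mem_of_superset (hVo.mem_nhds (hφV hx)) hγ)).mono (.of_forall fun y => ?_)
    rw [Complex.norm_real, Real.norm_of_nonneg (hφ01 y).1]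
    exact mul_le_of_le_one_left hε.le (hφ01 y).2
  · simp [image_eq_zero_of_notMem_tsupport hy]
  · have : φ u = 1 := hφ1 rfl
    simp [this, γ]

/-- Approximate form of the existence of enough continuous sections. -/
theorem exists_isA_norm_sub_le {u : Ω.toLCGroupoid.UnitSpace} (b : Ω.Fiber u.1) {ε : ℝ}
    (hε : 0 < ε) :
    ∃ σ : Ω.UnitSection, Ω.IsA (fun y => (σ y).1) ∧ ‖σ u - b‖ ≤ ε := by
  let P : ℕ → Ω.UnitSection → Prop := fun n σ =>
    (∀ x, AlmostContAt (fun _ => ε / 2 / 2 ^ n) σ x) ∧ ∃ K, IsCompact K ∧ ∀ y ∉ K, σ y = 0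
  have hstep : ∀ n σ, P n σ → ∃ τ, P (n + 1) τ ∧ ∀ y, ‖τ y - σ y‖ ≤ ε / 2 / 2 ^ n := by
    rintro n σ ⟨hσ, K, hK, hσK⟩
    obtain ⟨τ, h1, h2, h3⟩ := exists_refinement (by positivity)
      (by positivity : 0 < ε / 2 / 2 ^ (n + 1)) hσ hK hσK
    exact ⟨τ, ⟨h1, h2⟩, h3⟩
  obtain ⟨σ₀, h0, h0K, h0u⟩ := exists_almostCont_section b (by positivity : 0 < ε / 2 / 2 ^ 0)
  choose! g hgP hg using hstep
  let f : ℕ → Ω.UnitSection := fun n => Nat.rec σ₀ g n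
  have hfP : ∀ n, P n (f n) := fun n => by
    induction n with
    | zero => exact ⟨h0, h0K⟩
    | succ n ih => exact hgP n _ ih
  obtain ⟨σ, hσ, -⟩ := exists_limit_section_s10 (f := f) fun n y => hg n (f n) (hfP n) y
  refine ⟨σ, ⟨fun y => (σ y).2, continuous_of_almostContAt (tendsto_div_two_pow _)
    (tendsto_div_two_pow _) (fun n => (hfP n).1) hσ, fun δ hδ => ?_⟩, ?_⟩
  · obtain ⟨n, hn⟩ := ((tendsto_div_two_pow ε).eventually_lt_const hδ).exists
    obtain ⟨K, hK, hfK⟩ := (hfP n).2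
    refine ⟨K, hK, fun y hy => lt_of_le_of_lt ?_ hn⟩
    have := hσ n y
    rwa [hfK y hy, sub_zero] at this
  · have := hσ 0 u
    rw [show f 0 u = b from h0u] at this
    simpa using this

end FellBundleData

namespace FellBundleData

variable {Ω : FellBundleData}

namespace IsA

variable {σ τ : Ω.UnitSection}

theorem zero : Ω.IsA fun y => ((0 : Ω.UnitSection) y).1 :=
  ⟨fun y => Ω.p_bzero y.1, Ω.cont_bzero.comp LCGroupoid.UnitSpace.continuous_val,
    fun _ hε => ⟨∅, isCompact_empty, fun y _ => (norm_zero (E := Ω.Fiber y.1)).trans_lt hε⟩⟩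

theorem add (hσ : Ω.IsA fun y => (σ y).1) (hτ : Ω.IsA fun y => (τ y).1) :
    Ω.IsA fun y => (σ y + τ y).1 := by
  refine ⟨fun y => (σ y + τ y).2, Ω.cont_badd.comp
    ((hσ.2.1.prodMk hτ.2.1).subtype_mk fun y => Fiber.p_eq (σ y) (τ y)), fun ε hε => ?_⟩
  obtain ⟨K, hK, h⟩ := hσ.2.2 (ε / 2) (by positivity)
  obtain ⟨L, hL, h'⟩ := hτ.2.2 (ε / 2) (by positivity)
  refine ⟨K ∪ L, hK.union hL, fun y hy => ?_⟩
  have h1 := h y fun hyK => hy (.inl hyK)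
  have h2 := h' y fun hyL => hy (.inr hyL)
  exact (norm_add_le (σ y) (τ y)).trans_lt ((add_lt_add h1 h2).trans_eq (add_halves ε))

theorem const_smul (c : ℂ) (hσ : Ω.IsA fun y => (σ y).1) : Ω.IsA fun y => (c • σ y).1 := by
  refine ⟨fun y => (c • σ y).2, Ω.cont_bsmul.comp (continuous_const.prodMk hσ.2.1), fun ε hε => ?_⟩
  obtain ⟨K, hK, h⟩ := hσ.2.2 (ε / (‖c‖ + 1)) (by positivity)
  refine ⟨K, hK, fun y hy => ?_⟩
  have h1 : ‖σ y‖ < ε / (‖c‖ + 1) := h y hy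
  rw [lt_div_iff₀ (by positivity)] at h1
  rw [← Fiber.norm_def, norm_smul]
  nlinarith [norm_nonneg (σ y)]

theorem fun_smul {φ : C(Ω.toLCGroupoid.UnitSpace, ℝ)} (hφ : ∀ y, φ y ∈ Set.Icc 0 1)
    (hσ : Ω.IsA fun y => (σ y).1) : Ω.IsA fun y => ((φ y : ℂ) • σ y).1 := by
  refine ⟨fun y => ((φ y : ℂ) • σ y).2, Ω.cont_bsmul.comp
    ((Complex.continuous_ofReal.comp φ.continuous).prodMk hσ.2.1), fun ε hε => ?_⟩
  obtain ⟨K, hK, h⟩ := hσ.2.2 ε hε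
  refine ⟨K, hK, fun y hy => ?_⟩
  rw [← Fiber.norm_def, norm_smul, Complex.norm_real, Real.norm_of_nonneg (hφ y).1]
  exact (mul_le_of_le_one_left (norm_nonneg _) (hφ y).2).trans_lt (h y hy)

theorem mul (hσ : Ω.IsA fun y => (σ y).1) (hτ : Ω.IsA fun y => (τ y).1) :
    Ω.IsA fun y => (σ y * τ y).1 := by
  refine ⟨fun y => (σ y * τ y).2, Ω.cont_bmul.comp
    ((hσ.2.1.prodMk hτ.2.1).subtype_mk fun y => Fiber.comp_unit (σ y) (τ y)), fun ε hε => ?_⟩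
  obtain ⟨K, hK, h⟩ := hσ.2.2 ε hε
  obtain ⟨L, hL, h'⟩ := hτ.2.2 1 one_pos
  refine ⟨K ∪ L, hK.union hL, fun y hy => ?_⟩
  have h1 : ‖σ y‖ < ε := h y fun hyK => hy (.inl hyK)
  have h2 : ‖τ y‖ < 1 := h' y fun hyL => hy (.inr hyL)
  refine (norm_mul_le (σ y) (τ y)).trans_lt ?_
  nlinarith [norm_nonneg (σ y), norm_nonneg (τ y)]

theorem star (hσ : Ω.IsA fun y => (σ y).1) : Ω.IsA fun y => (star (σ y)).1 := by
  refine ⟨fun y => (Star.star (σ y)).2, Ω.cont_bstar.comp hσ.2.1, fun ε hε => ?_⟩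
  obtain ⟨K, hK, h⟩ := hσ.2.2 ε hε
  exact ⟨K, hK, fun y hy => (norm_star (σ y)).trans_lt (h y hy)⟩

theorem of_limit {f : ℕ → Ω.UnitSection} (hf : ∀ n, Ω.IsA fun y => (f n y).1) {d : ℕ → ℝ}
    (hd : Tendsto d atTop (𝓝 0)) (hσ : ∀ n y, ‖σ y - f n y‖ ≤ d n) :
    Ω.IsA fun y => (σ y).1 := by
  refine ⟨fun y => (σ y).2, continuous_of_almostContAt tendsto_const_nhds hd
    (fun n => Continuous.almostContAt (hf n).2.1) hσ, fun ε hε => ?_⟩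
  obtain ⟨n, hn⟩ := (hd.eventually_lt_const (half_pos hε)).exists
  obtain ⟨K, hK, h⟩ := (hf n).2.2 (ε / 2) (half_pos hε)
  refine ⟨K, hK, fun y hy => ?_⟩
  have h1 : ‖f n y‖ < ε / 2 := h y hy
  have h2 : ‖σ y‖ ≤ ‖f n y‖ + ‖σ y - f n y‖ := norm_le_norm_add_norm_sub' (σ y) (f n y)
  change ‖σ y‖ < ε
  linarith [hσ n y]

theorem exists_bound (hσ : Ω.IsA fun y => (σ y).1) : ∃ M : ℝ, 0 < M ∧ ∀ y, ‖σ y‖ ≤ M := by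
  obtain ⟨K, hK, h⟩ := hσ.2.2 1 one_pos
  obtain ⟨C, hC⟩ := UpperSemicontinuousOn.bddAbove_of_isCompact hK
    ((Ω.usc_bnorm.comp hσ.2.1).upperSemicontinuousOn K)
  refine ⟨max C 1, by positivity, fun y => ?_⟩
  by_cases hy : y ∈ K
  · exact (hC (Set.mem_image_of_mem _ hy)).trans (le_max_left _ _)
  · exact (h y hy).le.trans (le_max_right _ _)

theorem geomApproxUnit (hσ : Ω.IsA fun y => (σ y).1) (c : ℝ) (n : ℕ) :
    Ω.IsA fun y => (geomApproxUnit c (σ y) n).1 := by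
  induction n with
  | zero => exact IsA.zero
  | succ n ih => exact ih.add ((hσ.const_smul _).add ((hσ.mul ih).const_smul _))

end IsA

theorem isIdealA_setOf_isA : Ω.IsIdealA {σ | Ω.IsA σ} :=
  ⟨fun _ h => h, IsA.zero,
    fun σ hσ τ hτ => IsA.add (σ := fun y => ⟨σ y, hσ.1 y⟩) (τ := fun y => ⟨τ y, hτ.1 y⟩) hσ hτ,
    fun c σ hσ => IsA.const_smul (σ := fun y => ⟨σ y, hσ.1 y⟩) c hσ,
    fun σ hσ τ hτ =>
      ⟨IsA.mul (σ := fun y => ⟨σ y, hσ.1 y⟩) (τ := fun y => ⟨τ y, hτ.1 y⟩) hσ hτ,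
        IsA.mul (σ := fun y => ⟨τ y, hτ.1 y⟩) (τ := fun y => ⟨σ y, hσ.1 y⟩) hτ hσ⟩,
    fun _ h _ => h⟩

namespace IsIdealA

variable {I : Set (Ω.toLCGroupoid.UnitSpace → Ω.T)} {σ τ : Ω.UnitSection}

theorem isA (hI : Ω.IsIdealA I) (hσ : (fun y => (σ y).1) ∈ I) : Ω.IsA fun y => (σ y).1 :=
  hI.1 _ hσ

theorem zero_mem (hI : Ω.IsIdealA I) : (fun y => ((0 : Ω.UnitSection) y).1) ∈ I := hI.2.1

theorem add_mem (hI : Ω.IsIdealA I) (hσ : (fun y => (σ y).1) ∈ I) (hτ : (fun y => (τ y).1) ∈ I) :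
    (fun y => (σ y + τ y).1) ∈ I :=
  hI.2.2.1 _ hσ _ hτ

theorem const_smul_mem (hI : Ω.IsIdealA I) (c : ℂ) (hσ : (fun y => (σ y).1) ∈ I) :
    (fun y => (c • σ y).1) ∈ I :=
  hI.2.2.2.1 c _ hσ

theorem sub_mem (hI : Ω.IsIdealA I) (hσ : (fun y => (σ y).1) ∈ I) (hτ : (fun y => (τ y).1) ∈ I) :
    (fun y => (σ y - τ y).1) ∈ I := by
  simpa [sub_eq_add_neg] using hI.add_mem hσ (hI.const_smul_mem (-1) hτ)

theorem mul_mem_right (hI : Ω.IsIdealA I) (hσ : (fun y => (σ y).1) ∈ I)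
    (hτ : Ω.IsA fun y => (τ y).1) : (fun y => (σ y * τ y).1) ∈ I :=
  (hI.2.2.2.2.1 _ hσ _ hτ).1

theorem mul_mem_left (hI : Ω.IsIdealA I) (hσ : Ω.IsA fun y => (σ y).1)
    (hτ : (fun y => (τ y).1) ∈ I) : (fun y => (σ y * τ y).1) ∈ I :=
  (hI.2.2.2.2.1 _ hτ _ hσ).2

theorem mem_of_approx (hI : Ω.IsIdealA I) (hσ : Ω.IsA fun y => (σ y).1)
    (h : ∀ ε : ℝ, 0 < ε → ∃ τ : Ω.UnitSection, (fun y => (τ y).1) ∈ I ∧ ∀ y, ‖σ y - τ y‖ < ε) :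
    (fun y => (σ y).1) ∈ I := by
  refine hI.2.2.2.2.2 _ hσ fun ε hε => ?_
  obtain ⟨τ, hτ, h⟩ := h ε hε
  exact ⟨_, hτ, fun y => (Fiber.norm_sub_def (σ y) (τ y)).symm.trans_lt (h y)⟩

theorem geomApproxUnit_mem (hI : Ω.IsIdealA I) (hσ : (fun y => (σ y).1) ∈ I) (c : ℝ) (n : ℕ) :
    (fun y => (geomApproxUnit c (σ y) n).1) ∈ I := by
  induction n with
  | zero => exact hI.zero_mem
  | succ n ih =>
    exact hI.add_mem ih (hI.add_mem (hI.const_smul_mem _ hσ)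
      (hI.const_smul_mem _ (hI.mul_mem_right hσ (hI.isA ih))))

theorem fun_smul_mem (hI : Ω.IsIdealA I) {φ : C(Ω.toLCGroupoid.UnitSpace, ℝ)}
    (hφ : ∀ y, φ y ∈ Set.Icc 0 1) (hσ : (fun y => (σ y).1) ∈ I) :
    (fun y => ((φ y : ℂ) • σ y).1) ∈ I := by
  have hA := hI.isA hσ
  refine hI.mem_of_approx (hA.fun_smul hφ) fun ε hε => ?_
  obtain ⟨M, hM, hσM⟩ := hA.exists_bound
  obtain ⟨n, hn⟩ := Ω.exists_bnorm_sub_bmul_approxUnit_lt hM hε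
  let e : Ω.UnitSection := fun y => geomApproxUnit (M ^ 2)⁻¹ (star (σ y) * σ y) n
  have he : Ω.IsA fun y => (e y).1 := (hA.star.mul hA).geomApproxUnit _ n
  refine ⟨fun y => σ y * ((φ y : ℂ) • e y), hI.mul_mem_right hσ (he.fun_smul hφ), fun y => ?_⟩
  have hy := hn (σ y).1 (hσM y)
  have hval : (σ y - σ y * e y).1 = Ω.badd (σ y).1 (Ω.bsmul (-1) (Ω.bmul (σ y).1
      (Ω.approxUnit (M ^ 2)⁻¹ (Ω.bmul (Ω.bstar (σ y).1) (σ y).1) n))) := by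
    rw [Fiber.val_sub, Fiber.val_mul, val_geomApproxUnit]
    rfl
  rw [← hval, ← Fiber.norm_def] at hy
  change ‖(φ y : ℂ) • σ y - σ y * ((φ y : ℂ) • e y)‖ < ε
  rw [mul_smul_comm, ← smul_sub, norm_smul, Complex.norm_real, Real.norm_of_nonneg (hφ y).1]
  exact (mul_le_of_le_one_left (norm_nonneg _) (hφ y).2).trans_lt hy

theorem exists_small_mem (hI : Ω.IsIdealA I) (hσ : (fun y => (σ y).1) ∈ I)
    {u : Ω.toLCGroupoid.UnitSpace} {δ : ℝ} (hu : ‖σ u‖ < δ) :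
    ∃ τ : Ω.UnitSection, (fun y => (τ y).1) ∈ I ∧ τ u = σ u ∧ ∀ y, ‖τ y‖ ≤ δ := by
  have hVo : IsOpen {y | ‖σ y‖ < δ} :=
    (Ω.usc_bnorm.comp (hI.isA hσ).2.1).isOpen_preimage δ
  obtain ⟨φ, hφ1, -, hφV, hφ01⟩ := exists_continuousMap_one_of_isCompact_subset_isOpen
    (isCompact_singleton (x := u)) hVo (Set.singleton_subset_iff.2 hu)
  refine ⟨fun y => (φ y : ℂ) • σ y, hI.fun_smul_mem hφ01 hσ, ?_, fun y => ?_⟩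
  · have : φ u = 1 := hφ1 rfl
    simp [this]
  · by_cases hy : y ∈ tsupport φ
    · rw [norm_smul, Complex.norm_real, Real.norm_of_nonneg (hφ01 y).1]
      exact (mul_le_of_le_one_left (norm_nonneg _) (hφ01 y).2).trans (hφV hy).le
    · simpa [image_eq_zero_of_notMem_tsupport hy] using (norm_nonneg _).trans hu.le

/-- The fibre `I(u)` of an ideal is closed in `B(u)`. -/
theorem exists_eq_of_approx (hI : Ω.IsIdealA I) {u : Ω.toLCGroupoid.UnitSpace} {t : Ω.Fiber u.1}
    (h : ∀ ε : ℝ, 0 < ε → ∃ σ : Ω.UnitSection, (fun y => (σ y).1) ∈ I ∧ ‖σ u - t‖ ≤ ε) :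
    ∃ σ : Ω.UnitSection, (fun y => (σ y).1) ∈ I ∧ σ u = t := by
  let P : ℕ → Ω.UnitSection → Prop := fun n σ =>
    (fun y => (σ y).1) ∈ I ∧ ‖σ u - t‖ ≤ 1 / 8 / 2 ^ n
  have hstep : ∀ n σ, P n σ → ∃ τ, P (n + 1) τ ∧ ∀ y, ‖τ y - σ y‖ ≤ 1 / 2 / 2 ^ n := by
    rintro n σ ⟨hσ, hσt⟩
    obtain ⟨ρ, hρ, hρt⟩ := h (1 / 8 / 2 ^ (n + 1)) (by positivity)
    have hlt : ‖ρ u - σ u‖ < 1 / 2 / 2 ^ n := by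
      have h1 := norm_sub_le_norm_sub_add_norm_sub (ρ u) t (σ u)
      rw [norm_sub_rev t] at h1
      have h2 : (0 : ℝ) < 1 / 2 ^ n := by positivity
      have h3 : (1 : ℝ) / 8 / 2 ^ (n + 1) = 1 / 16 * (1 / 2 ^ n) := by rw [pow_succ]; ring
      have h4 : (1 : ℝ) / 8 / 2 ^ n = 1 / 8 * (1 / 2 ^ n) := by ring
      have h5 : (1 : ℝ) / 2 / 2 ^ n = 1 / 2 * (1 / 2 ^ n) := by ring
      linarith
    obtain ⟨d, hd, hdu, hdn⟩ := hI.exists_small_mem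
      (σ := fun y => ρ y - σ y) (hI.sub_mem hρ hσ) hlt
    refine ⟨fun y => σ y + d y, ⟨hI.add_mem hσ hd, ?_⟩, fun y => ?_⟩
    · simpa [hdu] using hρt
    · simpa using hdn y
  obtain ⟨σ₀, h0⟩ := h (1 / 8 / 2 ^ 0) (by positivity)
  choose! g hgP hg using hstep
  let f : ℕ → Ω.UnitSection := fun n => Nat.rec σ₀ g n
  have hfP : ∀ n, P n (f n) := fun n => by
    induction n with
    | zero => exact h0
    | succ n ih => exact hgP n _ ih
  obtain ⟨σ, hσ, hlim⟩ := exists_limit_section_s10 (f := f) fun n y => hg n (f n) (hfP n) y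
  have hσA : Ω.IsA fun y => (σ y).1 :=
    IsA.of_limit (fun n => hI.isA (hfP n).1) (tendsto_div_two_pow 1) hσ
  refine ⟨σ, hI.mem_of_approx hσA fun ε hε => ?_, tendsto_nhds_unique (hlim u) ?_⟩
  · obtain ⟨n, hn⟩ := ((tendsto_div_two_pow 1).eventually_lt_const hε).exists
    exact ⟨f n, (hfP n).1, fun y => (hσ n y).trans_lt hn⟩
  · exact tendsto_iff_norm_sub_tendsto_zero.2 (squeeze_zero (fun _ => norm_nonneg _)
      (fun n => (hfP n).2) (tendsto_div_two_pow _))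

end IsIdealA

/-- There are enough continuous sections: `A → B(u)` is surjective. -/
theorem exists_isA_eq {u : Ω.toLCGroupoid.UnitSpace} (b : Ω.Fiber u.1) :
    ∃ σ : Ω.UnitSection, Ω.IsA (fun y => (σ y).1) ∧ σ u = b :=
  isIdealA_setOf_isA.exists_eq_of_approx fun _ hε => exists_isA_norm_sub_le b hε

namespace IsIdealA

variable {I : Set (Ω.toLCGroupoid.UnitSpace → Ω.T)} {u : Ω.toLCGroupoid.UnitSpace}

theorem mem_fiberIm_iff_s10 (hI : Ω.IsIdealA I) {t : Ω.Fiber u.1} :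
    t.1 ∈ Ω.fiberIm I u.1 ↔ ∃ σ : Ω.UnitSection, (fun y => (σ y).1) ∈ I ∧ σ u = t := by
  constructor
  · rintro ⟨σ, hσ, _, h⟩
    exact ⟨fun y => ⟨σ y, (hI.1 σ hσ).1 y⟩, hσ, Fiber.ext h.symm⟩
  · rintro ⟨σ, hσ, h⟩
    exact ⟨_, hσ, u.2, congrArg Fiber.val h.symm⟩

theorem mem_fiberIm_of_approx (hI : Ω.IsIdealA I) {t : Ω.Fiber u.1}
    (h : ∀ ε : ℝ, 0 < ε → ∃ s : Ω.Fiber u.1, s.1 ∈ Ω.fiberIm I u.1 ∧ ‖s - t‖ ≤ ε) :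
    t.1 ∈ Ω.fiberIm I u.1 := by
  refine hI.mem_fiberIm_iff_s10.2 (hI.exists_eq_of_approx fun ε hε => ?_)
  obtain ⟨s, hs, hst⟩ := h ε hε
  obtain ⟨σ, hσ, rfl⟩ := hI.mem_fiberIm_iff_s10.1 hs
  exact ⟨σ, hσ, hst⟩

theorem mul_mem_fiberIm (hI : Ω.IsIdealA I) (a : Ω.Fiber u.1) {t : Ω.Fiber u.1}
    (ht : t.1 ∈ Ω.fiberIm I u.1) : (a * t).1 ∈ Ω.fiberIm I u.1 := by
  obtain ⟨σ, hσ, rfl⟩ := hI.mem_fiberIm_iff_s10.1 ht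
  obtain ⟨τ, hτ, rfl⟩ := exists_isA_eq a
  exact hI.mem_fiberIm_iff_s10.2 ⟨_, hI.mul_mem_left hτ hσ, rfl⟩

theorem geomApproxUnit_mem_fiberIm (hI : Ω.IsIdealA I) {t : Ω.Fiber u.1}
    (ht : t.1 ∈ Ω.fiberIm I u.1) (c : ℝ) (n : ℕ) :
    (geomApproxUnit c t n).1 ∈ Ω.fiberIm I u.1 := by
  obtain ⟨σ, hσ, rfl⟩ := hI.mem_fiberIm_iff_s10.1 ht
  exact hI.mem_fiberIm_iff_s10.2 ⟨_, hI.geomApproxUnit_mem hσ c n, rfl⟩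

/-- If `b* b ∈ I(s(b))`, then `b` is a norm limit of products `b e` with `e ∈ I(s(b))`. -/
theorem exists_bnorm_sub_bmul_lt (hI : Ω.IsIdealA I) {b : Ω.T} (hb : b ∈ Ω.BIset I) {ε : ℝ}
    (hε : 0 < ε) :
    ∃ e : Ω.Fiber (srcUnit (Ω.p b)).1, e.1 ∈ Ω.fiberIm I (Ω.src (Ω.p b)) ∧
      Ω.bnorm (Ω.badd b (Ω.bsmul (-1) (Ω.bmul b e.1))) < ε := by
  have hM : 0 < Ω.bnorm b + 1 := by linarith [Ω.bnorm_nonneg b]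
  obtain ⟨n, hn⟩ := Ω.exists_bnorm_sub_bmul_approxUnit_lt hM hε
  let h : Ω.Fiber (srcUnit (Ω.p b)).1 := ⟨Ω.bmul (Ω.bstar b) b, p_bstar_bmul rfl⟩
  refine ⟨geomApproxUnit ((Ω.bnorm b + 1) ^ 2)⁻¹ h n, hI.geomApproxUnit_mem_fiberIm (t := h) hb _ n,
    ?_⟩
  rw [val_geomApproxUnit]
  exact hn b (by linarith)

end IsIdealA

theorem exists_bnorm_bmul_lt (a : Ω.T) {x : Ω.G} (hax : Ω.src (Ω.p a) = Ω.rng x) {ε : ℝ}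
    (hε : 0 < ε) :
    ∃ δ : ℝ, 0 < δ ∧ ∀ r, Ω.p r = x → Ω.bnorm r < δ → Ω.bnorm (Ω.bmul a r) < ε := by
  have hcomp : Ω.src (Ω.p a) = Ω.rng (Ω.p (Ω.bzero x)) := by rwa [Ω.p_bzero]
  have hzero : Ω.bnorm (Ω.bmul a (Ω.bzero x)) = 0 := by
    rw [← Ω.bsmul_bzero 0, Ω.bmul_bsmul _ _ _ hcomp, Ω.bnorm_bsmul, norm_zero, zero_mul]
  have hW : {t | Ω.bnorm t < ε} ∈ 𝓝 (Ω.bmul a (Ω.bzero x)) :=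
    Ω.usc_bnorm _ _ (hzero.trans_lt hε)
  obtain ⟨s, hs, hsW⟩ := mem_nhds_subtype _ _ _ |>.1
    (Ω.cont_bmul.continuousAt (x := ⟨(a, Ω.bzero x), hcomp⟩) hW)
  obtain ⟨U, hU, Z, hZ, hUZ⟩ := mem_nhds_prod_iff.1 hs
  obtain ⟨V, hV, δ, hδ, h⟩ := Ω.zero_nbhd x Z hZ
  refine ⟨δ, hδ, fun r hr hrδ => ?_⟩
  have har : Ω.src (Ω.p a) = Ω.rng (Ω.p r) := by rw [hr]; exact hax
  exact hsW (a := ⟨(a, r), har⟩) (hUZ (Set.mk_mem_prod (mem_of_mem_nhds hU)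
    (h r (by rw [hr]; exact mem_of_mem_nhds hV) hrδ)))

theorem IsIdealA.bstar_bmul_mem_fiberIm {I : Set (Ω.toLCGroupoid.UnitSpace → Ω.T)}
    (hI : Ω.IsIdealA I) {a b : Ω.T} (hb : b ∈ Ω.BIset I) (hab : Ω.p a = Ω.p b) :
    Ω.bmul (Ω.bstar a) b ∈ Ω.fiberIm I (Ω.src (Ω.p b)) := by
  let z : Ω.Fiber (srcUnit (Ω.p b)).1 := ⟨Ω.bmul (Ω.bstar a) b, p_bstar_bmul hab⟩
  refine hI.mem_fiberIm_of_approx (t := z) fun ε hε => ?_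
  have hs : Ω.src (Ω.p (Ω.bstar a)) = Ω.rng (Ω.p b) := by rw [Ω.p_bstar, Ω.src_ginv, hab]
  obtain ⟨δ, hδ, h⟩ := exists_bnorm_bmul_lt (Ω.bstar a) hs hε
  obtain ⟨e, he, hbe⟩ := hI.exists_bnorm_sub_bmul_lt hb hδ
  have hpbe : Ω.p (Ω.bmul b e.1) = Ω.p b := p_bmul_src e.2
  have hval : Ω.bmul (Ω.bstar a) (Ω.badd b (Ω.bsmul (-1) (Ω.bmul b e.1))) = (z - z * e).1 := by
    rw [Ω.badd_bmul _ _ _ (by rw [Ω.p_bsmul, hpbe]) hs, Ω.bmul_bsmul _ _ _ (by rw [hpbe, hs]),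
      ← Ω.bmul_assoc _ _ _ hs (by rw [e.2]; exact (Ω.rng_src _).symm), Fiber.val_sub]
    rfl
  refine ⟨z * e, hI.mul_mem_fiberIm z he, ?_⟩
  rw [norm_sub_rev, Fiber.norm_def, ← hval]
  exact (h _ (Ω.p_badd _ _ (by rw [Ω.p_bsmul, hpbe])) hbe).le

theorem mem_spanIn {x : Ω.G} {S : Set Ω.T} {t : Ω.T} (ht : t ∈ S) (hp : Ω.p t = x) :
    t ∈ Ω.spanIn x S := by
  refine ⟨[t], by simpa using ⟨1, t, ht, (Ω.one_bsmul t).symm⟩, ?_⟩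
  exact congrArg Fiber.val (add_zero (⟨t, hp⟩ : Ω.Fiber x)).symm

theorem IsIdealA.mem_closedSpan {I : Set (Ω.toLCGroupoid.UnitSpace → Ω.T)}
    (hI : Ω.IsIdealA I) {b : Ω.T} (hb : b ∈ Ω.BIset I) :
    b ∈ Ω.closedSpan (Ω.p b)
      {t | ∃ c d, Ω.p c = Ω.p b ∧ d ∈ Ω.fiberIm I (Ω.src (Ω.p b)) ∧ t = Ω.bmul c d} := by
  refine mem_closure_iff_nhds.2 fun U hU => ?_
  obtain ⟨ε, hε, hεU⟩ := Ω.norm_nbhd_fiber b U hU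
  obtain ⟨e, he, hbe⟩ := hI.exists_bnorm_sub_bmul_lt hb hε
  have hpbe : Ω.p (Ω.bmul b e.1) = Ω.p b := p_bmul_src e.2
  refine ⟨Ω.bmul b e.1, hεU _ hpbe ?_, mem_spanIn ⟨b, e.1, rfl, he, rfl⟩ hpbe⟩
  rw [← Fiber.norm_sub_def (⟨b, rfl⟩ : Ω.Fiber (Ω.p b)) ⟨_, hpbe⟩, norm_sub_rev,
    Fiber.norm_sub_def] at hbe
  exact hbe

end FellBundleData

/-- Let `p : B → G` be a Fell bundle over a locally compact
Hausdorff groupoid, `A := Γ₀(G⁰; B)`, and `I` an ideal of `A`.  Then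
`B_I := {b ∈ B : b* b ∈ I(s(b))}` equals
`{b ∈ B : a* b ∈ I(s(b)) for all a ∈ B(p(b))}`, and every `b ∈ B_I` lies in the
closed linear span `B(p(b)) · I(s(b))`. -/
theorem BIset_characterization (Ω : FellBundle)
    (I : Set (Ω.toLCGroupoid.UnitSpace → Ω.T)) (hI : Ω.toFellBundleData.IsIdealA I) :
    Ω.toFellBundleData.BIset I =
        {b | ∀ a, Ω.p a = Ω.p b →
          Ω.bmul (Ω.bstar a) b ∈ Ω.toFellBundleData.fiberIm I (Ω.src (Ω.p b))} ∧
      ∀ b ∈ Ω.toFellBundleData.BIset I,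
        b ∈ Ω.toFellBundleData.closedSpan (Ω.p b)
          {t | ∃ c d, Ω.p c = Ω.p b ∧
            d ∈ Ω.toFellBundleData.fiberIm I (Ω.src (Ω.p b)) ∧ t = Ω.bmul c d} := by
  refine ⟨Set.ext fun b => ⟨fun hb a hab => ?_, fun h => h b rfl⟩, fun b hb => ?_⟩
  · exact FellBundleData.IsIdealA.bstar_bmul_mem_fiberIm hI hb hab
  · exact FellBundleData.IsIdealA.mem_closedSpan hI hb
end
end
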